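/- Let ψ be the (σ,λ)-GFF on V_N and f_N^ψ(β) = (1/log N²) log Σ_{v∈V_N} e^{βψ_v}. For every η > 0 and β > 0 there exists a constant c = c(η,β,σ,λ) > 0 such that for all N large enough, P(|f_N^ψ(β) − f^ψ(β)| > η) ≤ N^{−c}. -/

import Mathlib

open Filter
open scoped Classical

noncomputable section GFFCommon

/-- Vertices of `ℤ²`. -/
abbrev Vtx : Type := ℤ × ℤ

/-- Sample space: a real-valued field indexed by the vertices of `ℤ²`. -/
abbrev FieldSp : Type := Vtx → ℝ

/-- The box `V_N = {0,1,…,N}²`. -/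
def VN (N : ℕ) : Finset Vtx := Finset.Icc (0, 0) ((N : ℤ), (N : ℤ))

/-- The boundary `∂B` of a finite box `B ⊆ ℤ²`:
vertices of `B` having a (Euclidean distance 1) neighbour outside `B`. -/
def bdry (B : Finset Vtx) : Finset Vtx :=
  B.filter fun v =>
    ¬((v.1 + 1, v.2) ∈ B ∧ (v.1 - 1, v.2) ∈ B ∧ (v.1, v.2 + 1) ∈ B ∧ (v.1, v.2 - 1) ∈ B)

/-- The interior `B° = B ∖ ∂B`. -/
def intr (B : Finset Vtx) : Finset Vtx := B \ bdry B

/-- The neighbourhood `[v]_λ` of `v` in `V_N`. -/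
def nbhd (N : ℕ) (lam : ℝ) (v : Vtx) : Finset Vtx :=
  if lam = 0 then VN N
  else if lam = 1 then {v}
  else (VN N).filter fun w =>
    |(w.1 : ℝ) - (v.1 : ℝ)| ≤ (N : ℝ) ^ ((1 : ℝ) - lam) / 2 ∧
    |(w.2 : ℝ) - (v.2 : ℝ)| ≤ (N : ℝ) ^ ((1 : ℝ) - lam) / 2

/-- The σ-algebra `F_{∂[v]_λ ∪ [v]_λ^c}`, generated by the field variables on the
boundary of `[v]_λ` and those outside of it. -/
def scaleAlg (N : ℕ) (lam : ℝ) (v : Vtx) : MeasurableSpace FieldSp :=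
  ⨆ w ∈ {w : Vtx | w ∈ VN N ∧ w ∉ intr (nbhd N lam v)},
    MeasurableSpace.comap (fun ω : FieldSp => ω w) inferInstance

/-- `G` is the Green function of simple random walk killed on `∂B`, normalized by `π/2`:
it vanishes unless both arguments are in `B°`, and in `B°` it satisfies the
first-step (discrete Poisson equation) characterization
`G(x,y) = (1/4)·Σ_{x'∼x} G(x',y) + (π/2)·1_{x=y}`. -/
def IsGreenFn (B : Finset Vtx) (G : Vtx → Vtx → ℝ) : Prop :=
  (∀ x y : Vtx, x ∉ intr B ∨ y ∉ intr B → G x y = 0) ∧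
  ∀ y ∈ intr B, ∀ x ∈ intr B,
    G x y = (G (x.1 + 1, x.2) y + G (x.1 - 1, x.2) y
        + G (x.1, x.2 + 1) y + G (x.1, x.2 - 1) y) / 4
      + (Real.pi / 2) * (if x = y then 1 else 0)

/-- `P` is the law (on the canonical space `FieldSp`) of the Gaussian free field on `V_N`:
a centered Gaussian field with covariance the Green function `G_{V_N}`. -/
def IsGFF (N : ℕ) (P : MeasureTheory.Measure FieldSp) : Prop :=
  MeasureTheory.IsProbabilityMeasure P ∧
  ∃ G : Vtx → Vtx → ℝ, IsGreenFn (VN N) G ∧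
    ∀ c : Vtx → ℝ,
      P.map (fun ω => ∑ v ∈ VN N, c v * ω v) =
        ProbabilityTheory.gaussianReal 0 (Real.toNNReal (∑ v ∈ VN N, ∑ w ∈ VN N, c v * c w * G v w))

open MeasureTheory in
/-- `φ_v(λ) = E[φ_v | F_{∂[v]_λ ∪ [v]_λ^c}]`. -/
def phiScale (N : ℕ) (P : MeasureTheory.Measure FieldSp) (v : Vtx) (lam : ℝ) : FieldSp → ℝ :=
  P[fun ω : FieldSp => ω v | scaleAlg N lam v]

/-- Admissible parameters `(σ,λ)`: `σ_1,…,σ_M > 0` and `0 = λ_0 < λ_1 < … < λ_M = 1`. -/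
def ScaleParams (M : ℕ) (sigv lamv : ℕ → ℝ) : Prop :=
  1 ≤ M ∧ (∀ i ∈ Finset.Icc 1 M, 0 < sigv i) ∧
  lamv 0 = 0 ∧ lamv M = 1 ∧ ∀ i, i < M → lamv i < lamv (i + 1)

/-- The `(σ,λ)`-GFF: `ψ_v = Σ_{i=1}^M σ_i (φ_v(λ_i) − φ_v(λ_{i−1}))`. -/
def psiFld (N M : ℕ) (sigv lamv : ℕ → ℝ) (P : MeasureTheory.Measure FieldSp) (v : Vtx) : FieldSp → ℝ :=
  fun ω => ∑ i ∈ Finset.Icc 1 M, sigv i * (phiScale N P v (lamv i) ω - phiScale N P v (lamv (i - 1)) ω)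

open MeasureTheory in
/-- `ψ_v(λ) = E[ψ_v | F_{∂[v]_λ ∪ [v]_λ^c}]`. -/
def psiScale (N M : ℕ) (sigv lamv : ℕ → ℝ) (P : MeasureTheory.Measure FieldSp) (v : Vtx) (lam : ℝ) :
    FieldSp → ℝ :=
  P[psiFld N M sigv lamv P v | scaleAlg N lam v]

/-- The increment `ψ_v(λ,λ') = ψ_v(λ') − ψ_v(λ)`. -/
def psiInc (N M : ℕ) (sigv lamv : ℕ → ℝ) (P : MeasureTheory.Measure FieldSp) (v : Vtx) (lam lam' : ℝ) :
    FieldSp → ℝ :=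
  fun ω => psiScale N M sigv lamv P v lam' ω - psiScale N M sigv lamv P v lam ω

/-- The step function `σ(s) = σ_1 1_{{0}}(s) + Σ_{i=1}^M σ_i 1_{(λ_{i−1},λ_i]}(s)`. -/
def stepFn (M : ℕ) (sigv lamv : ℕ → ℝ) (s : ℝ) : ℝ :=
  (if s = 0 then sigv 1 else 0) +
  ∑ i ∈ Finset.Icc 1 M, if lamv (i - 1) < s ∧ s ≤ lamv i then sigv i else 0

/-- `𝒥_f(s) = ∫_0^s f(r) dr`. -/
def Jint (f : ℝ → ℝ) (s : ℝ) : ℝ := ∫ r in (0:ℝ)..s, f r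

/-- `𝒥_f(s₁,s₂) = ∫_{s₁}^{s₂} f(r) dr`. -/
def Jint2 (f : ℝ → ℝ) (s₁ s₂ : ℝ) : ℝ := ∫ r in s₁..s₂, f r

/-- The speed function `𝒥_{σ²}`. -/
def Jsig2 (M : ℕ) (sigv lamv : ℕ → ℝ) (s : ℝ) : ℝ := Jint (fun r => (stepFn M sigv lamv r) ^ 2) s

/-- The normalized speed function `𝒥̄_{σ²} = 𝒥_{σ²}/𝒥_{σ²}(1)`. -/
def JsigBar (M : ℕ) (sigv lamv : ℕ → ℝ) (s : ℝ) : ℝ := Jsig2 M sigv lamv s / Jsig2 M sigv lamv 1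

/-- The concave hull on `[0,1]` of a function `f`, i.e. the pointwise infimum over all
concave functions dominating `f` on `[0,1]`. -/
def concaveHull (f : ℝ → ℝ) (s : ℝ) : ℝ :=
  sInf {y | ∃ g : ℝ → ℝ, ConcaveOn ℝ (Set.Icc (0:ℝ) 1) g ∧
    (∀ t ∈ Set.Icc (0:ℝ) 1, f t ≤ g t) ∧ y = g s}

/-- The effective parameters: jump scales `0 = λ⁰ < … < λ^m = 1`, values
`σ̄_1 > … > σ̄_m > 0`, and the left-continuous non-increasing step function `σ̄`
such that `∫_0^s σ̄²` is the concavification of `𝒥_{σ²}`. -/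
def EffParams (M : ℕ) (sigv lamv : ℕ → ℝ) (m : ℕ) (sigb lamb : ℕ → ℝ) (sigbar : ℝ → ℝ) : Prop :=
  1 ≤ m ∧ m ≤ M ∧ lamb 0 = 0 ∧ lamb m = 1 ∧ (∀ j, j < m → lamb j < lamb (j + 1)) ∧
  (∀ l, 1 ≤ l → l < m → sigb (l + 1) < sigb l) ∧ (∀ l ∈ Finset.Icc 1 m, 0 < sigb l) ∧
  sigbar 0 = sigb 1 ∧
  (∀ l ∈ Finset.Icc 1 m, ∀ s : ℝ, lamb (l - 1) < s → s ≤ lamb l → sigbar s = sigb l) ∧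
  (∀ s : ℝ, 0 < s → s ≤ 1 →
    concaveHull (Jsig2 M sigv lamv) s = ∫ r in (0:ℝ)..s, (sigbar r) ^ 2)

/-- `γ* = 𝒥_{σ²/σ̄}(1)`. -/
def gammaStar (M : ℕ) (sigv lamv : ℕ → ℝ) (sigbar : ℝ → ℝ) : ℝ :=
  ∫ s in (0:ℝ)..1, (stepFn M sigv lamv s) ^ 2 / sigbar s

/-- The critical levels `γ^l = ∫_0^1 σ²(s)/σ̄(s ∧ λ^l) ds`, `γ⁰ = 0`. -/
def gammaL (M : ℕ) (sigv lamv : ℕ → ℝ) (lamb : ℕ → ℝ) (sigbar : ℝ → ℝ) (l : ℕ) : ℝ :=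
  if l = 0 then 0 else ∫ s in (0:ℝ)..1, (stepFn M sigv lamv s) ^ 2 / sigbar (min s (lamb l))

/-- `EntE` is the entropy function `𝓔` of the model. -/
def IsEntropy (M : ℕ) (sigv lamv : ℕ → ℝ) (m : ℕ) (lamb : ℕ → ℝ) (sigbar : ℝ → ℝ)
    (EntE : ℝ → ℝ) : Prop :=
  EntE 0 = 1 ∧
  ∀ l ∈ Finset.Icc 1 m, ∀ γ : ℝ,
    gammaL M sigv lamv lamb sigbar (l - 1) < γ → γ ≤ gammaL M sigv lamv lamb sigbar l →
      EntE γ = (1 - lamb (l - 1)) -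
        (γ - ∫ s in (0:ℝ)..(lamb (l - 1)), (stepFn M sigv lamv s) ^ 2 / sigbar s) ^ 2 /
          Jint2 (fun r => (stepFn M sigv lamv r) ^ 2) (lamb (l - 1)) 1

/-- The limiting free energy of the `REM(σ)` model. -/
def fREM (σ β : ℝ) : ℝ :=
  if (2 / σ) < β then 2 * (β / (2 / σ)) else 1 + (β / (2 / σ)) ^ 2

/-- The index `l_β`. -/
def lbeta (m : ℕ) (sigb : ℕ → ℝ) (β : ℝ) : ℕ :=
  if β ≤ 2 / sigb m then sInf {l : ℕ | 1 ≤ l ∧ β ≤ 2 / sigb l} else m + 1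

/-- The limiting free energy `f^ψ(β)`, written with the `l_β` split. -/
def fpsiLim (m : ℕ) (sigb lamb : ℕ → ℝ) (β : ℝ) : ℝ :=
  (∑ j ∈ Finset.Icc 1 (lbeta m sigb β - 1), (2 * β / (2 / sigb j)) * (lamb j - lamb (j - 1))) +
  ∑ j ∈ Finset.Icc (lbeta m sigb β) m, (1 + β ^ 2 / (2 / sigb j) ^ 2) * (lamb j - lamb (j - 1))

/-- The set `ℬ` of non-critical inverse temperatures. -/
def critSet (m : ℕ) (sigb : ℕ → ℝ) : Set ℝ :=
  {β | 0 < β ∧ ∀ j ∈ Finset.Icc 1 m, β ≠ 2 / sigb j}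

/-- The partition function `Z_N^ψ(β)`. -/
def ZN (N M : ℕ) (sigv lamv : ℕ → ℝ) (P : MeasureTheory.Measure FieldSp) (β : ℝ) (ω : FieldSp) : ℝ :=
  ∑ v ∈ VN N, Real.exp (β * psiFld N M sigv lamv P v ω)

/-- The free energy `f_N^ψ(β)` on `V_N`. -/
def freeEnergy (N M : ℕ) (sigv lamv : ℕ → ℝ) (P : MeasureTheory.Measure FieldSp) (β : ℝ) (ω : FieldSp) : ℝ :=
  (Real.log ((N : ℝ) ^ 2))⁻¹ * Real.log (ZN N M sigv lamv P β ω)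

/-- The set `A_{N,ρ}` of points at distance at least `N^{1−ρ}` from `ℤ² ∖ V_N`. -/
def AN (N : ℕ) (ρ : ℝ) : Finset Vtx :=
  (VN N).filter fun v => ∀ z : Vtx, z ∉ VN N →
    (N : ℝ) ^ ((1 : ℝ) - ρ) ≤ Real.sqrt (((v.1 : ℝ) - (z.1 : ℝ)) ^ 2 + ((v.2 : ℝ) - (z.2 : ℝ)) ^ 2)

/-- The restricted partition function `Z_{N,ρ}^ψ(β)`. -/
def ZNres (N M : ℕ) (sigv lamv : ℕ → ℝ) (P : MeasureTheory.Measure FieldSp) (β ρ : ℝ) (ω : FieldSp) : ℝ :=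
  ∑ v ∈ AN N ρ, Real.exp (β * psiFld N M sigv lamv P v ω)

/-- The free energy `f_{N,ρ}^ψ(β)` on `A_{N,ρ}`. -/
def freeEnergyRes (N M : ℕ) (sigv lamv : ℕ → ℝ) (P : MeasureTheory.Measure FieldSp) (β ρ : ℝ)
    (ω : FieldSp) : ℝ :=
  (Real.log ((N : ℝ) ^ 2))⁻¹ * Real.log (ZNres N M sigv lamv P β ρ ω)

/-- The Gibbs weight `𝒢_{β,N}({v})`. -/
def gibbsW (N M : ℕ) (sigv lamv : ℕ → ℝ) (P : MeasureTheory.Measure FieldSp) (β : ℝ) (v : Vtx)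
    (ω : FieldSp) : ℝ :=
  Real.exp (β * psiFld N M sigv lamv P v ω) / ZN N M sigv lamv P β ω

/-- The restricted Gibbs weight `𝒢_{β,N,ρ}({v})`. -/
def gibbsWres (N M : ℕ) (sigv lamv : ℕ → ℝ) (P : MeasureTheory.Measure FieldSp) (β ρ : ℝ) (v : Vtx)
    (ω : FieldSp) : ℝ :=
  Real.exp (β * psiFld N M sigv lamv P v ω) / ZNres N M sigv lamv P β ρ ω

/-- `E𝒢_{β,N}^{×s}[F]`: the mean over the disorder of the `s`-fold Gibbs average of `F`. -/
def gibbsExp (N M : ℕ) (sigv lamv : ℕ → ℝ) (P : MeasureTheory.Measure FieldSp) (β : ℝ) (s : ℕ)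
    (F : (Fin s → Vtx) → ℝ) : ℝ :=
  ∫ ω, (∑ vv ∈ Fintype.piFinset (fun _ : Fin s => VN N),
    (∏ i, gibbsW N M sigv lamv P β (vv i) ω) * F vv) ∂P

/-- `E𝒢_{β,N,ρ}^{×s}[F]`, with an `ω`-dependent integrand allowed. -/
def gibbsExpRes (N M : ℕ) (sigv lamv : ℕ → ℝ) (P : MeasureTheory.Measure FieldSp) (β ρ : ℝ) (s : ℕ)
    (F : (Fin s → Vtx) → FieldSp → ℝ) : ℝ :=
  ∫ ω, (∑ vv ∈ Fintype.piFinset (fun _ : Fin s => AN N ρ),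
    (∏ i, gibbsWres N M sigv lamv P β ρ (vv i) ω) * F vv ω) ∂P

/-- `E𝒢_{β,N}^{×s}[F]`, with an `ω`-dependent integrand allowed. -/
def gibbsExpW (N M : ℕ) (sigv lamv : ℕ → ℝ) (P : MeasureTheory.Measure FieldSp) (β : ℝ) (s : ℕ)
    (F : (Fin s → Vtx) → FieldSp → ℝ) : ℝ :=
  ∫ ω, (∑ vv ∈ Fintype.piFinset (fun _ : Fin s => VN N),
    (∏ i, gibbsW N M sigv lamv P β (vv i) ω) * F vv ω) ∂P

/-- The covariance `E[ψ_v ψ_{v'}]`. -/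
def psiCov (N M : ℕ) (sigv lamv : ℕ → ℝ) (P : MeasureTheory.Measure FieldSp) (v v' : Vtx) : ℝ :=
  ∫ ω, psiFld N M sigv lamv P v ω * psiFld N M sigv lamv P v' ω ∂P

/-- `C₀` is a constant witnessing the uniform variance upper bound
`max_{v∈V_N} E[ψ_v²] ≤ 𝒥_{σ²}(1) log N + C₀` for `N` large. -/
def IsVarBound (M : ℕ) (sigv lamv : ℕ → ℝ) (P : ℕ → MeasureTheory.Measure FieldSp) (C₀ : ℝ) : Prop :=
  0 < C₀ ∧ ∃ N₀ : ℕ, ∀ N ≥ N₀, ∀ v ∈ VN N,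
    psiCov N M sigv lamv (P N) v v ≤ Jsig2 M sigv lamv 1 * Real.log N + C₀

/-- The overlap `q^N(v,v')`. -/
def overlapQ (N M : ℕ) (sigv lamv : ℕ → ℝ) (P : MeasureTheory.Measure FieldSp) (C₀ : ℝ) (v v' : Vtx) : ℝ :=
  psiCov N M sigv lamv P v v' / (Jsig2 M sigv lamv 1 * Real.log N + C₀)

/-- Convergence in probability to a constant, for a sequence of random variables on a
sequence of probability spaces. -/
def TendstoInProb (P : ℕ → MeasureTheory.Measure FieldSp) (X : ℕ → FieldSp → ℝ) (c : ℝ) : Prop :=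
  ∀ ε : ℝ, 0 < ε → Tendsto (fun N => P N {ω | ε < |X N ω - c|}) atTop (nhds 0)

/-- Convergence in `L^p` to a constant. -/
def TendstoLp (P : ℕ → MeasureTheory.Measure FieldSp) (X : ℕ → FieldSp → ℝ) (p c : ℝ) : Prop :=
  Tendsto (fun N => ∫ ω, |X N ω - c| ^ p ∂(P N)) atTop (nhds 0)

/-- The branching scale `b_N(v,v')`. -/
def bScale (N : ℕ) (v v' : Vtx) : ℝ :=
  sSup {lam : ℝ | lam ∈ Set.Icc (0:ℝ) 1 ∧ ((nbhd N lam v) ∩ (nbhd N lam v')).Nonempty}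

end GFFCommon

noncomputable section PotKernel
open Real MeasureTheory

def pkC (t : ℝ) : ℝ := 2 - cos t
def pkD (t : ℝ) : ℝ := sqrt ((pkC t) ^ 2 - 1)
def pkZ (t : ℝ) : ℝ := pkC t - pkD t
def pkF (x y : ℤ) (t : ℝ) : ℝ := (1 - pkZ t ^ y.natAbs * cos (x * t)) / pkD t
def pk (v : Vtx) : ℝ := ∫ t in (0:ℝ)..π, pkF v.1 v.2 t

lemma pkC_ge (t : ℝ) : 1 ≤ pkC t := by unfold pkC; linarith [cos_le_one t]
lemma pkD_nonneg (t : ℝ) : 0 ≤ pkD t := sqrt_nonneg _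
lemma pkD_sq (t : ℝ) : pkD t ^ 2 = pkC t ^ 2 - 1 := by
  unfold pkD; rw [sq_sqrt]; nlinarith [pkC_ge t]
lemma pkD_le_C (t : ℝ) : pkD t ≤ pkC t := by
  nlinarith [pkD_nonneg t, pkD_sq t, pkC_ge t]
lemma pkZ_mul (t : ℝ) : pkZ t * (pkC t + pkD t) = 1 := by
  unfold pkZ; nlinarith [pkD_sq t]
lemma pkZ_pos (t : ℝ) : 0 < pkZ t := by
  have := pkZ_mul t
  have h : 0 < pkC t + pkD t := by linarith [pkC_ge t, pkD_nonneg t]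
  by_contra hh
  nlinarith
lemma pkZ_le_one (t : ℝ) : pkZ t ≤ 1 := by
  have := pkZ_mul t
  nlinarith [pkC_ge t, pkD_nonneg t, pkZ_pos t]
lemma pkZ_le (t : ℝ) : pkZ t ≤ (1 + pkD t)⁻¹ := by
  rw [← one_div, le_div_iff₀ (by linarith [pkD_nonneg t])]
  have := pkZ_mul t
  nlinarith [pkC_ge t, pkD_nonneg t, pkZ_pos t]
lemma one_sub_pkZ (t : ℝ) : 1 - pkZ t ≤ pkD t := by
  unfold pkZ; linarith [pkC_ge t]
lemma pkD_lower {t : ℝ} (h0 : 0 ≤ t) (h1 : t ≤ π) : 2 / π * t ≤ pkD t := by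
  unfold pkD
  apply le_sqrt_of_sq_le
  have := cos_le_one_sub_mul_cos_sq (x := t) (by rw [abs_of_nonneg h0]; exact h1)
  have h2 : 2 / π ^ 2 * t ^ 2 ≤ pkC t - 1 := by unfold pkC; linarith
  have h3 : (2 / π * t) ^ 2 = 2 * (2 / π ^ 2 * t ^ 2) := by ring
  rw [h3]; nlinarith [pkC_ge t]
lemma pkD_pos {t : ℝ} (h0 : 0 < t) (h1 : t ≤ π) : 0 < pkD t :=
  lt_of_lt_of_le (by positivity) (pkD_lower h0.le h1)
lemma pkD_upper {t : ℝ} (h0 : 0 ≤ t) : pkD t ≤ t + t ^ 3 / 8 := by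
  unfold pkD
  apply sqrt_le_iff.2 ⟨by positivity, ?_⟩
  have h1 := one_sub_sq_div_two_le_cos (x := t)
  have h2 : pkC t ≤ 1 + t ^ 2 / 2 := by unfold pkC; linarith
  have : pkC t ^ 2 ≤ (1 + t ^ 2 / 2) ^ 2 := by
    have := pkC_ge t
    gcongr
  nlinarith [sq_nonneg (t^3)]
lemma pkD_lower2 {t : ℝ} (h0 : 0 < t) : t - t ^ 3 / 24 ≤ pkD t := by
  have h := sin_gt_sub_cube (x := t / 2) (by linarith)
  have h2 : |2 * sin (t/2)| ≤ pkD t := by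
    unfold pkD
    apply abs_le_sqrt
    have hc : cos t = 1 - 2 * sin (t/2) ^ 2 := by
      have := cos_two_mul' (t/2)
      rw [show 2 * (t/2) = t by ring] at this
      rw [this]; nlinarith [sin_sq_add_cos_sq (t/2)]
    unfold pkC; rw [hc]; nlinarith [sq_nonneg (sin (t/2) ^ 2)]
  have := le_abs_self (2 * sin (t/2))
  nlinarith

lemma pkF_num_nonneg (x y : ℤ) (t : ℝ) : 0 ≤ 1 - pkZ t ^ y.natAbs * cos (x * t) := by
  have h1 : pkZ t ^ y.natAbs ≤ 1 := pow_le_one₀ (pkZ_pos t).le (pkZ_le_one t)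
  have h2 : 0 < pkZ t ^ y.natAbs := pow_pos (pkZ_pos t) _
  nlinarith [cos_le_one (x * t), neg_one_le_cos (x*t)]

lemma pkF_bound (x y : ℤ) {t : ℝ} (h0 : 0 < t) (h1 : t ≤ π) :
    |pkF x y t| ≤ |(x:ℝ)| * (π / 2) + |(y:ℝ)| := by
  unfold pkF
  have hD := pkD_pos h0 h1
  rw [abs_of_nonneg (div_nonneg (pkF_num_nonneg x y t) hD.le), div_le_iff₀ hD]
  have hz := pkZ_pos t
  have hz1 := pkZ_le_one t
  have hp : 1 - y.natAbs * (1 - pkZ t) ≤ pkZ t ^ y.natAbs := by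
    have := one_add_mul_le_pow (a := pkZ t - 1) (by linarith) y.natAbs
    simp only [add_sub_cancel] at this
    linarith
  have hy : ((y.natAbs : ℕ) : ℝ) = |(y:ℝ)| := by
    rw [Nat.cast_natAbs]; simp
  rw [hy] at hp
  have hle : pkZ t ^ y.natAbs ≤ 1 := pow_le_one₀ hz.le hz1
  have hpos : 0 < pkZ t ^ y.natAbs := pow_pos hz _
  have hc : 1 - cos (x * t) ≤ |(x:ℝ)| * t := by
    have h2 := one_sub_sq_div_two_le_cos (x := x * t)
    have h3 := neg_one_le_cos (x * t)
    have h4 : (x * t)^2 = (|(x:ℝ)| * t)^2 := by rw [mul_pow, mul_pow, sq_abs]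
    rw [h4] at h2
    have : 0 ≤ |(x:ℝ)| * t := by positivity
    by_cases h5 : |(x:ℝ)| * t ≤ 2 <;> nlinarith
  have hDl := pkD_lower h0.le h1
  have ht : t ≤ π / 2 * pkD t := by
    have := mul_le_mul_of_nonneg_left hDl (show 0 ≤ π / 2 by positivity)
    calc t = π / 2 * (2 / π * t) := by field_simp
      _ ≤ _ := this
  have e1 : |(y:ℝ)| * (1 - pkZ t) ≤ |(y:ℝ)| * pkD t :=
    mul_le_mul_of_nonneg_left (one_sub_pkZ t) (abs_nonneg _)
  have e2 : |(x:ℝ)| * t ≤ |(x:ℝ)| * (π / 2 * pkD t) := mul_le_mul_of_nonneg_left ht (abs_nonneg _)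
  have e3 : pkZ t ^ y.natAbs * (1 - cos (x * t)) ≤ 1 - cos (x*t) := by
    nlinarith [cos_le_one (x * t)]
  nlinarith

lemma pkF_cont (x y : ℤ) : ContinuousOn (pkF x y) (Set.Ioc 0 π) := by
  unfold pkF
  apply ContinuousOn.div
  · unfold pkZ pkD pkC; fun_prop
  · unfold pkD pkC; fun_prop
  · intro t ht; exact (pkD_pos ht.1 ht.2).ne'

lemma pkF_int (x y : ℤ) : IntervalIntegrable (pkF x y) volume 0 π := by
  rw [intervalIntegrable_iff_integrableOn_Ioc_of_le pi_pos.le]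
  refine Integrable.mono' (g := fun _ => |(x:ℝ)| * (π / 2) + |(y:ℝ)|) (integrable_const _) ?_ ?_
  · exact (pkF_cont x y).aestronglyMeasurable measurableSet_Ioc
  · filter_upwards [ae_restrict_mem measurableSet_Ioc] with t ht
    exact pkF_bound x y ht.1 ht.2

lemma pk_cos_int (x : ℤ) : ∫ t in (0:ℝ)..π, cos (x * t) = if x = 0 then π else 0 := by
  split_ifs with h
  · simp [h]
  · rw [intervalIntegral.integral_comp_mul_left (fun t => cos t) (by exact_mod_cast h)]
    simp [integral_cos, sin_int_mul_pi]

lemma pk_harm (x y : ℤ) : pk (x + 1, y) + pk (x - 1, y) + pk (x, y + 1) + pk (x, y - 1)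
    = 4 * pk (x, y) + (if (x, y) = (0, 0) then 2 * π else 0) := by
  unfold pk
  simp only
  rw [← intervalIntegral.integral_add (pkF_int _ _) (pkF_int _ _),
    ← intervalIntegral.integral_add ((pkF_int _ _).add (pkF_int _ _)) (pkF_int _ _),
    ← intervalIntegral.integral_add (((pkF_int _ _).add (pkF_int _ _)).add (pkF_int _ _)) (pkF_int _ _)]
  have key : (if (x, y) = ((0:ℤ), (0:ℤ)) then 2 * π else 0) =
      ∫ t in (0:ℝ)..π, (if y = 0 then 2 * cos (x * t) else 0) := by
    by_cases hy : y = 0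
    · simp only [hy, if_true]
      rw [intervalIntegral.integral_const_mul, pk_cos_int]
      by_cases hx : x = 0 <;> simp [hx]
    · simp [hy]
  rw [key, ← intervalIntegral.integral_const_mul, ← intervalIntegral.integral_add]
  · apply intervalIntegral.integral_congr_ae
    refine Filter.Eventually.of_forall fun t ht => ?_
    rw [Set.uIoc_of_le pi_pos.le] at ht
    have hD := (pkD_pos ht.1 ht.2).ne'
    have hcos : cos ((x + 1 : ℤ) * t) + cos ((x - 1 : ℤ) * t) = 2 * cos t * cos (x * t) := by
      push_cast
      rw [add_mul, sub_mul, one_mul, cos_add, cos_sub]; ring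
    have hCc : cos t = 2 - pkC t := by unfold pkC; ring
    have hz2 : pkZ t * pkZ t = 2 * pkC t * pkZ t - 1 := by
      unfold pkZ; nlinarith [pkD_sq t]
    unfold pkF
    clear key
    generalize cos ((x + 1 : ℤ) * t) = a1 at *
    generalize cos ((x - 1 : ℤ) * t) = a2 at *
    generalize cos ((x : ℤ) * t) = a3 at *
    by_cases hy : y = 0
    · subst hy
      simp only [if_true]
      have e1 : ((0:ℤ) + 1).natAbs = 1 := rfl
      have e2 : ((0:ℤ) - 1).natAbs = 1 := rfl
      have hz : pkZ t = pkC t - pkD t := rfl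
      rw [e1, e2]
      field_simp
      simp only [Int.natAbs_zero, pow_zero, one_mul]
      rw [hz]
      linear_combination (-1 : ℝ) * hcos - 2 * a3 * hCc
    · simp only [hy, if_false, add_zero]
      field_simp
      obtain ⟨k, hk⟩ : ∃ k : ℕ, y.natAbs = k + 1 := ⟨y.natAbs - 1, by omega⟩
      have : (pkZ t ^ (y+1).natAbs + pkZ t ^ (y-1).natAbs) = 2 * pkC t * pkZ t ^ y.natAbs := by
        rcases lt_or_gt_of_ne hy with h | h
        · rw [show (y+1).natAbs = k by omega, show (y-1).natAbs = k+2 by omega, hk]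
          linear_combination pkZ t ^ k * hz2
        · rw [show (y-1).natAbs = k by omega, show (y+1).natAbs = k+2 by omega, hk]
          linear_combination pkZ t ^ k * hz2
      linear_combination (-1 : ℝ) * pkZ t ^ y.natAbs * hcos - a3 * this - 2 * pkZ t ^ y.natAbs * a3 * hCc
  · exact (pkF_int _ _).const_mul _
  · apply Continuous.intervalIntegrable
    split_ifs <;> fun_prop


lemma pk_log {r : ℝ} (hr : 1 ≤ r) : ∫ t in (1/r)..π, t⁻¹ = log π + log r := by
  have : 0 < r := by linarith
  rw [integral_inv_of_pos (by positivity) pi_pos, div_div_eq_mul_div, div_one,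
    log_mul pi_pos.ne' this.ne']

lemma pkH_deriv (k : ℕ) {t : ℝ} (h0 : 0 < t) (h1 : t ≤ π) :
    HasDerivAt (fun t => pkZ t ^ k / pkD t)
      (-(pkZ t ^ k * sin t * (k / pkD t ^ 2 + pkC t / pkD t ^ 3))) t := by
  have hD := pkD_pos h0 h1
  have hC : HasDerivAt pkC (sin t) t := by
    unfold pkC; simpa using (hasDerivAt_cos t).const_sub 2
  have hDd : HasDerivAt pkD (pkC t * sin t / pkD t) t := by
    have hne : pkC t ^ 2 - 1 ≠ 0 := by rw [← pkD_sq]; positivity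
    have := ((hC.pow 2).sub_const 1).sqrt hne
    refine this.congr_deriv ?_
    change _ / (2 * pkD t) = _
    field_simp
    simp
    ring
  have hZ : HasDerivAt pkZ (-(sin t * pkZ t / pkD t)) t := by
    refine (hC.sub hDd).congr_deriv ?_
    unfold pkZ; field_simp; ring
  refine ((hZ.pow k).div hDd hD.ne').congr_deriv ?_
  rcases k with _ | k
  · simp; field_simp
  · simp only [Nat.add_sub_cancel, Nat.cast_add, Nat.cast_one, Pi.pow_apply]; field_simp; ring

lemma pk_osc (k : ℕ) (x : ℤ) (hx : x ≠ 0) {a : ℝ} (ha : 0 < a) (hap : a ≤ π) :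
    |∫ t in a..π, pkZ t ^ k / pkD t * cos (x * t)| ≤ π / (a * |(x:ℝ)|) := by
  have hx' : (x:ℝ) ≠ 0 := by exact_mod_cast hx
  set h' : ℝ → ℝ := fun t => -(pkZ t ^ k * sin t * (k / pkD t ^ 2 + pkC t / pkD t ^ 3)) with hh'
  have hmem : ∀ t ∈ Set.uIcc a π, 0 < t ∧ t ≤ π := by
    intro t ht; rw [Set.uIcc_of_le hap] at ht; exact ⟨lt_of_lt_of_le ha ht.1, ht.2⟩
  have hderiv : ∀ t ∈ Set.uIcc a π, HasDerivAt (fun t => pkZ t ^ k / pkD t) (h' t) t :=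
    fun t ht => pkH_deriv k (hmem t ht).1 (hmem t ht).2
  have hcont : ContinuousOn h' (Set.uIcc a π) := by
    have h1 : ∀ t ∈ Set.uIcc a π, pkD t ≠ 0 := fun t ht => (pkD_pos (hmem t ht).1 (hmem t ht).2).ne'
    have hDc : Continuous pkD := by unfold pkD pkC; fun_prop
    have hCc : Continuous pkC := by unfold pkC; fun_prop
    have hZc : Continuous pkZ := by unfold pkZ; fun_prop
    apply ContinuousOn.neg
    apply ContinuousOn.mul (by fun_prop)
    apply ContinuousOn.add
    · exact ContinuousOn.div (by fun_prop) (by fun_prop) (fun t ht => pow_ne_zero _ (h1 t ht))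
    · exact ContinuousOn.div (by fun_prop) (by fun_prop) (fun t ht => pow_ne_zero _ (h1 t ht))
  have hii : IntervalIntegrable h' volume a π := hcont.intervalIntegrable
  have hv : ∀ t ∈ Set.uIcc a π, HasDerivAt (fun t => sin (x * t) / x) (cos (x * t)) t := by
    intro t _
    have := ((hasDerivAt_id t).const_mul (x:ℝ)).sin.div_const (x:ℝ)
    refine this.congr_deriv ?_
    simp; field_simp
  have hparts := intervalIntegral.integral_mul_deriv_eq_deriv_mul hderiv hv hii
    (Continuous.intervalIntegrable (by fun_prop) _ _)
  rw [hparts]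
  have hneg : ∀ t ∈ Set.uIcc a π, h' t ≤ 0 := by
    intro t ht
    have := hmem t ht
    have h1 := pkD_pos this.1 this.2
    have h2 := sin_nonneg_of_nonneg_of_le_pi this.1.le this.2
    have h3 := pkZ_pos t
    have h4 := pkC_ge t
    simp only [hh']
    have : 0 ≤ pkZ t ^ k * sin t * (k / pkD t ^ 2 + pkC t / pkD t ^ 3) := by positivity
    linarith
  have hint : ∫ t in a..π, h' t = pkZ π ^ k / pkD π - pkZ a ^ k / pkD a :=
    intervalIntegral.integral_eq_sub_of_hasDerivAt hderiv hii
  have hb : |∫ t in a..π, h' t * (sin (x * t) / x)| ≤ ∫ t in a..π, -h' t * |(x:ℝ)|⁻¹ := by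
    rw [← Real.norm_eq_abs]
    apply intervalIntegral.norm_integral_le_of_norm_le hap
    · refine Filter.Eventually.of_forall fun t ht => ?_
      have ht' : t ∈ Set.uIcc a π := by rw [Set.uIcc_of_le hap]; exact ⟨ht.1.le, ht.2⟩
      rw [norm_mul, Real.norm_eq_abs, Real.norm_eq_abs, abs_of_nonpos (hneg t ht'), abs_div,
        div_eq_mul_inv]
      apply mul_le_mul_of_nonneg_left _ (by linarith [hneg t ht'])
      have := abs_sin_le_one (x * t)
      have h2 : 0 ≤ |(x:ℝ)|⁻¹ := by positivity
      nlinarith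
    · exact hii.neg.mul_const _
  rw [intervalIntegral.integral_mul_const, intervalIntegral.integral_neg, hint] at hb
  have hza : 0 ≤ pkZ a ^ k / pkD a := div_nonneg (pow_nonneg (pkZ_pos a).le _) (pkD_nonneg a)
  have hzp : 0 ≤ pkZ π ^ k / pkD π := div_nonneg (pow_nonneg (pkZ_pos π).le _) (pkD_nonneg π)
  have hza2 : pkZ a ^ k / pkD a ≤ π / (2 * a) := by
    have h1 := pkD_lower ha.le hap
    have h2 : pkZ a ^ k ≤ 1 := pow_le_one₀ (pkZ_pos a).le (pkZ_le_one a)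
    calc pkZ a ^ k / pkD a ≤ 1 / (2 / π * a) :=
          div_le_div₀ zero_le_one h2 (by positivity) h1
      _ = π / (2 * a) := by field_simp
  have hs0 : |sin (x * a) / x| ≤ |(x:ℝ)|⁻¹ := by
    rw [abs_div, div_eq_mul_inv]
    have := abs_sin_le_one (x * a)
    have h2 : 0 ≤ |(x:ℝ)|⁻¹ := by positivity
    nlinarith
  have hsp : sin (x * π) = 0 := sin_int_mul_pi x
  rw [hsp]
  simp only [zero_div, mul_zero, zero_sub]
  have hfin : π / (a * |(x:ℝ)|) = 2 * (π / (2 * a) * |(x:ℝ)|⁻¹) := by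
    have := abs_pos.2 hx'
    field_simp
  rw [hfin]
  have hxi : 0 ≤ |(x:ℝ)|⁻¹ := by positivity
  calc _ ≤ |pkZ a ^ k / pkD a * (sin (x * a) / x)| + |∫ t in a..π, h' t * (sin (x * t) / x)| := by
        rw [neg_sub_left, abs_neg, add_comm]; exact abs_add_le _ _
    _ ≤ pkZ a ^ k / pkD a * |(x:ℝ)|⁻¹ + pkZ a ^ k / pkD a * |(x:ℝ)|⁻¹ := by
        apply add_le_add
        · rw [abs_mul, abs_of_nonneg hza]
          exact mul_le_mul_of_nonneg_left hs0 hza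
        · refine hb.trans ?_
          nlinarith
    _ ≤ _ := by nlinarith

lemma pk_dec (k : ℕ) (x : ℤ) (hk : 0 < k) {a : ℝ} (ha : 0 < a) (hap : a ≤ π) :
    |∫ t in a..π, pkZ t ^ k / pkD t * cos (x * t)| ≤ π ^ 2 / (4 * (a * k)) := by
  have hk' : (0:ℝ) < k := by exact_mod_cast hk
  have hb : |∫ t in a..π, pkZ t ^ k / pkD t * cos (x * t)| ≤ ∫ t in a..π, π ^ 2 / (4 * k) * t ^ (-2 : ℤ) := by
    rw [← Real.norm_eq_abs]
    apply intervalIntegral.norm_integral_le_of_norm_le hap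
    · refine Filter.Eventually.of_forall fun t ht => ?_
      have ht0 : 0 < t := ha.trans ht.1
      have hD := pkD_pos ht0 ht.2
      have hDl := pkD_lower ht0.le ht.2
      rw [norm_mul, Real.norm_eq_abs, Real.norm_eq_abs, abs_of_nonneg (div_nonneg (pow_nonneg (pkZ_pos t).le _) hD.le)]
      have h1 : pkZ t ^ k ≤ (k * pkD t)⁻¹ := by
        calc pkZ t ^ k ≤ ((1 + pkD t)⁻¹) ^ k := pow_le_pow_left₀ (pkZ_pos t).le (pkZ_le t) _
          _ = ((1 + pkD t) ^ k)⁻¹ := by rw [inv_pow]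
          _ ≤ (k * pkD t)⁻¹ := by
            apply inv_anti₀ (by positivity)
            have := one_add_mul_le_pow (a := pkD t) (by linarith) k
            linarith
      have h2 : pkZ t ^ k / pkD t ≤ (k * pkD t)⁻¹ / pkD t := div_le_div_of_nonneg_right h1 hD.le
      have h3 : (k * pkD t)⁻¹ / pkD t ≤ π ^ 2 / (4 * k) * t ^ (-2 : ℤ) := by
        rw [zpow_neg, show (2:ℤ) = ((2:ℕ):ℤ) by rfl, zpow_natCast]
        have : (k * pkD t)⁻¹ / pkD t = 1 / (k * pkD t ^ 2) := by field_simp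
        rw [this]
        have h5 : π ^ 2 / (4 * k) * (t ^ 2)⁻¹ = 1 / (k * (2 / π * t) ^ 2) := by field_simp; norm_num
        rw [h5]
        gcongr
      have h4 : 0 ≤ pkZ t ^ k / pkD t := div_nonneg (pow_nonneg (pkZ_pos t).le _) hD.le
      have := abs_cos_le_one (x * t)
      nlinarith
    · apply IntervalIntegrable.const_mul
      apply ContinuousOn.intervalIntegrable
      intro t ht
      rw [Set.uIcc_of_le hap] at ht
      exact (continuousAt_zpow₀ t _ (Or.inl (by linarith [ht.1]))).continuousWithinAt
  refine hb.trans ?_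
  rw [intervalIntegral.integral_const_mul, integral_zpow]
  · norm_num
    have : π ^ 2 / (4 * (a * k)) = π ^ 2 / (4 * k) * a⁻¹ := by field_simp
    rw [this]
    apply mul_le_mul_of_nonneg_left _ (by positivity)
    rw [div_neg, div_one]
    linarith [inv_pos.2 pi_pos]
  · right
    constructor
    · norm_num
    · rw [Set.uIcc_of_le hap]; simp; intro h; linarith

/-- sup-norm on `ℤ²`, truncated below at 1 -/
def nrm (v : Vtx) : ℝ := max (max |(v.1:ℝ)| |(v.2:ℝ)|) 1

lemma one_le_nrm (v : Vtx) : 1 ≤ nrm v := le_max_right _ _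

lemma pk_zero : pk (0, 0) = 0 := by simp [pk, pkF]

theorem pk_asymp : ∃ C : ℝ, 0 < C ∧ ∀ v : Vtx, |pk v - log (nrm v)| ≤ C := by
  have hlp : 0 ≤ log π := log_nonneg (by linarith [pi_gt_three])
  have hCC : 0 < 1 * (π/2) + 1 + π + π ^ 2 + π * π + 1 + log π + 1 + 100 := by
    have : 0 < 1 * (π/2) + 1 + π + π ^ 2 + π * π + 1 := by positivity
    linarith
  refine ⟨1 * (π/2) + 1 + π + π ^ 2 + π * π + 1 + log π + 1 + 100, hCC, ?_⟩
  rintro ⟨x, y⟩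
  by_cases h0 : (x, y) = (0, 0)
  · rw [h0, pk_zero]
    have : log (nrm ((0, 0) : ℤ × ℤ)) = 0 := by simp [nrm]
    rw [this]; simpa using hCC.le
  set r := nrm (x, y) with hr
  have hr1 : 1 ≤ r := one_le_nrm _
  have hr0 : 0 < r := by linarith
  have hrx : |(x:ℝ)| ≤ r := le_trans (le_max_left _ _) (le_max_left _ _)
  have hry : |(y:ℝ)| ≤ r := le_trans (le_max_right _ _) (le_max_left _ _)
  have ha : 0 < 1 / r := by positivity
  have hap : 1 / r ≤ π := by
    rw [div_le_iff₀ hr0]; nlinarith [pi_gt_three]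
  have hi1 : IntervalIntegrable (pkF x y) volume 0 (1/r) :=
    (pkF_int x y).mono_set (by rw [Set.uIcc_of_le ha.le, Set.uIcc_of_le pi_pos.le]; exact Set.Icc_subset_Icc_right hap)
  have hi2 : IntervalIntegrable (pkF x y) volume (1/r) π :=
    (pkF_int x y).mono_set (by rw [Set.uIcc_of_le hap, Set.uIcc_of_le pi_pos.le]; exact Set.Icc_subset_Icc_left ha.le)
  have hsplit : pk (x, y) = (∫ t in (0:ℝ)..(1/r), pkF x y t) + ∫ t in (1/r)..π, pkF x y t :=
    (intervalIntegral.integral_add_adjacent_intervals hi1 hi2).symm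
  have hA : |∫ t in (0:ℝ)..(1/r), pkF x y t| ≤ π / 2 + 1 := by
    rw [← Real.norm_eq_abs]
    have := intervalIntegral.norm_integral_le_of_norm_le_const (a := 0) (b := 1/r) (f := pkF x y)
      (C := r * (π/2) + r) (by
        intro t ht
        rw [Set.uIoc_of_le ha.le] at ht
        refine (pkF_bound x y ht.1 (ht.2.trans hap)).trans ?_
        gcongr)
    refine this.trans (le_of_eq ?_)
    rw [sub_zero, abs_of_pos ha]; field_simp
  have hmem : ∀ t ∈ Set.uIcc (1/r) π, 0 < t ∧ t ≤ π := by
    intro t ht; rw [Set.uIcc_of_le hap] at ht; exact ⟨lt_of_lt_of_le ha ht.1, ht.2⟩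
  have h1 : ∀ t ∈ Set.uIcc (1/r) π, pkD t ≠ 0 := fun t ht => (pkD_pos (hmem t ht).1 (hmem t ht).2).ne'
  have hDc : Continuous pkD := by unfold pkD pkC; fun_prop
  have hZc : Continuous pkZ := by unfold pkZ pkC; fun_prop
  have hj1 : IntervalIntegrable (fun t => (pkD t)⁻¹ - t⁻¹) volume (1/r) π := by
    apply ContinuousOn.intervalIntegrable
    apply ContinuousOn.sub
    · exact hDc.continuousOn.inv₀ h1
    · exact continuousOn_id.inv₀ (fun t ht => (hmem t ht).1.ne')
  have hj2 : IntervalIntegrable (fun t => t⁻¹) volume (1/r) π := by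
    apply ContinuousOn.intervalIntegrable
    exact continuousOn_id.inv₀ (fun t ht => (hmem t ht).1.ne')
  have hj3 : IntervalIntegrable (fun t => pkZ t ^ y.natAbs / pkD t * cos (x * t)) volume (1/r) π := by
    apply ContinuousOn.intervalIntegrable
    apply ContinuousOn.mul
    · exact ContinuousOn.div (by fun_prop) (by fun_prop) h1
    · fun_prop
  have hB : ∫ t in (1/r)..π, pkF x y t = (∫ t in (1/r)..π, ((pkD t)⁻¹ - t⁻¹)) + (log π + log r)
      - ∫ t in (1/r)..π, pkZ t ^ y.natAbs / pkD t * cos (x * t) := by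
    rw [← pk_log hr1, ← intervalIntegral.integral_add hj1 hj2, ← intervalIntegral.integral_sub (hj1.add hj2) hj3]
    apply intervalIntegral.integral_congr
    intro t ht
    have := h1 t ht
    simp only [pkF]
    field_simp
    ring
  have hC : |∫ t in (1/r)..π, ((pkD t)⁻¹ - t⁻¹)| ≤ π * π := by
    rw [← Real.norm_eq_abs]
    have := intervalIntegral.norm_integral_le_of_norm_le_const (a := 1/r) (b := π) (f := fun t => (pkD t)⁻¹ - t⁻¹)
      (C := π) (by
        intro t ht
        rw [Set.uIoc_of_le hap] at ht
        have ht0 : 0 < t := ha.trans ht.1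
        have hD := pkD_pos ht0 ht.2
        have e1 := pkD_upper ht0.le
        have e2 := pkD_lower2 ht0
        have e3 := pkD_lower ht0.le ht.2
        have e4 : (pkD t)⁻¹ - t⁻¹ = (t - pkD t) / (pkD t * t) := by field_simp
        rw [e4, norm_div, Real.norm_eq_abs, Real.norm_eq_abs, abs_of_pos (mul_pos hD ht0),
          div_le_iff₀ (by positivity)]
        have e5 : |t - pkD t| ≤ t ^ 3 / 8 := by
          rw [abs_le]; constructor
          · linarith
          · have : 0 < t ^ 3 := by positivity
            linarith
        refine e5.trans ?_
        have e6 : π * (2 / π * t * t) ≤ π * (pkD t * t) := by gcongr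
        have e7 : π * (2 / π * t * t) = 2 * t ^ 2 := by field_simp
        have e8 : t ≤ 4 := ht.2.trans pi_le_four
        nlinarith [sq_nonneg t])
    refine this.trans ?_
    rw [abs_of_nonneg (by linarith)]
    have := pi_pos
    nlinarith
  have hE : |∫ t in (1/r)..π, pkZ t ^ y.natAbs / pkD t * cos (x * t)| ≤ π + π ^ 2 := by
    have hne : x ≠ 0 ∨ y ≠ 0 := by
      by_contra hh; push Not at hh; exact h0 (by rw [hh.1, hh.2])
    have hone : ∀ z : ℤ, z ≠ 0 → 1 ≤ |(z:ℝ)| := by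
      intro z hz
      exact_mod_cast Int.one_le_abs hz
    have hcase : (x ≠ 0 ∧ |(x:ℝ)| = r) ∨ (y ≠ 0 ∧ |(y:ℝ)| = r) := by
      have hr' : r = max (max |(x:ℝ)| |(y:ℝ)|) 1 := rfl
      have hm1 : (1:ℝ) ≤ max |(x:ℝ)| |(y:ℝ)| := by
        rcases hne with h | h
        · exact (hone x h).trans (le_max_left _ _)
        · exact (hone y h).trans (le_max_right _ _)
      rw [max_eq_left hm1] at hr'
      rcases le_total |(x:ℝ)| |(y:ℝ)| with h | h
      · right
        rw [max_eq_right h] at hr' hm1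
        refine ⟨?_, hr'.symm⟩
        rintro rfl; norm_num at hm1
      · left
        rw [max_eq_left h] at hr' hm1
        refine ⟨?_, hr'.symm⟩
        rintro rfl; norm_num at hm1
    rcases hcase with ⟨hx, hxr⟩ | ⟨hy, hyr⟩
    · have := pk_osc y.natAbs x hx ha hap
      rw [hxr, one_div_mul_cancel hr0.ne', div_one] at this
      have h := sq_nonneg π
      linarith
    · have := pk_dec y.natAbs x (by omega) ha hap
      have e : ((y.natAbs : ℕ) : ℝ) = r := by rw [← hyr, Nat.cast_natAbs]; simp
      rw [e, one_div_mul_cancel hr0.ne'] at this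
      have h := sq_nonneg π
      have h' := pi_pos
      linarith
  rw [hsplit, hB]
  rw [abs_le] at *
  constructor <;> nlinarith [hA.1, hA.2, hC.1, hC.2, hE.1, hE.2, sq_nonneg π]

end PotKernel

noncomputable def avg (f : Vtx → ℝ) (x : Vtx) : ℝ :=
  (f (x.1 + 1, x.2) + f (x.1 - 1, x.2) + f (x.1, x.2 + 1) + f (x.1, x.2 - 1)) / 4

lemma mem_intr {B : Finset Vtx} {x : Vtx} : x ∈ intr B ↔ x ∈ B ∧ (x.1 + 1, x.2) ∈ B ∧
    (x.1 - 1, x.2) ∈ B ∧ (x.1, x.2 + 1) ∈ B ∧ (x.1, x.2 - 1) ∈ B := by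
  unfold intr bdry
  simp only [Finset.mem_sdiff, Finset.mem_filter]
  tauto

lemma intr_subset (B : Finset Vtx) : intr B ⊆ B := fun _ hx => (mem_intr.1 hx).1

lemma max_principle {B : Finset Vtx} {f : Vtx → ℝ} {c : ℝ}
    (hsub : ∀ x ∈ intr B, f x ≤ avg f x) (hb : ∀ z ∈ B, z ∉ intr B → f z ≤ c) :
    ∀ x ∈ B, f x ≤ c := by
  by_contra! hcon
  obtain ⟨x0, hx0, hlt⟩ := hcon
  obtain ⟨x1, hx1, hmax⟩ := Finset.exists_max_image B f ⟨x0, hx0⟩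
  set S := B.filter (fun x => f x = f x1) with hS
  have hSne : S.Nonempty := ⟨x1, by simp [hS, hx1]⟩
  obtain ⟨y, hy, hymax⟩ := Finset.exists_max_image S (fun x => x.1) hSne
  have hyB : y ∈ B := (Finset.mem_filter.1 hy).1
  have hyf : f y = f x1 := (Finset.mem_filter.1 hy).2
  have hyi : y ∈ intr B := by
    by_contra h
    have := hb y hyB h
    have := hmax x0 hx0
    linarith
  have h1 := hsub y hyi
  obtain ⟨_, a1, a2, a3, a4⟩ := mem_intr.1 hyi
  have b1 := hmax _ a1
  have b2 := hmax _ a2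
  have b3 := hmax _ a3
  have b4 := hmax _ a4
  unfold avg at h1
  have : f (y.1 + 1, y.2) = f x1 := by linarith
  have := hymax (y.1 + 1, y.2) (by simp [hS, a1, this])
  simp at this

lemma min_principle {B : Finset Vtx} {f : Vtx → ℝ} {c : ℝ}
    (hsup : ∀ x ∈ intr B, avg f x ≤ f x) (hb : ∀ z ∈ B, z ∉ intr B → c ≤ f z) :
    ∀ x ∈ B, c ≤ f x := by
  intro x hx
  have := max_principle (B := B) (f := fun x => - f x) (c := -c) (fun x hx => by
    have := hsup x hx
    unfold avg at this ⊢; linarith) (fun z hz hz' => by linarith [hb z hz hz']) x hx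
  linarith

noncomputable def ext0 (S : Finset Vtx) (g : S → ℝ) (x : Vtx) : ℝ := if h : x ∈ S then g ⟨x, h⟩ else 0

lemma poisson_solve (B : Finset Vtx) (r : Vtx → ℝ) :
    ∃ f : Vtx → ℝ, (∀ x, x ∉ intr B → f x = 0) ∧ ∀ x ∈ intr B, f x = avg f x + r x := by
  let T : (intr B → ℝ) →ₗ[ℝ] (intr B → ℝ) :=
    { toFun := fun g x => g x - avg (ext0 (intr B) g) x
      map_add' := by
        intro g h; funext x
        have : ∀ y, ext0 (intr B) (g + h) y = ext0 (intr B) g y + ext0 (intr B) h y := by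
          intro y; unfold ext0; split_ifs <;> simp
        simp only [avg, this, Pi.add_apply]; ring
      map_smul' := by
        intro a g; funext x
        have : ∀ y, ext0 (intr B) (a • g) y = a * ext0 (intr B) g y := by
          intro y; unfold ext0; split_ifs <;> simp
        simp only [avg, this, Pi.smul_apply, smul_eq_mul, RingHom.id_apply]; ring }
  have hinj : Function.Injective T := by
    rw [← LinearMap.ker_eq_bot, LinearMap.ker_eq_bot']
    intro g hg
    have hz : ∀ x ∉ intr B, ext0 (intr B) g x = 0 := fun x hx => by simp [ext0, hx]
    have hh : ∀ x ∈ intr B, ext0 (intr B) g x = avg (ext0 (intr B) g) x := by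
      intro x hx
      have := congrFun hg ⟨x, hx⟩
      simp only [T, LinearMap.coe_mk, AddHom.coe_mk, Pi.zero_apply] at this
      simp only [ext0, hx, dif_pos] at this ⊢
      linarith
    have h1 := max_principle (B := B) (f := ext0 (intr B) g) (c := 0) (fun x hx => (hh x hx).le)
      (fun z _ hz' => (hz z hz').le)
    have h2 := min_principle (B := B) (f := ext0 (intr B) g) (c := 0) (fun x hx => (hh x hx).ge)
      (fun z _ hz' => (hz z hz').ge)
    funext x
    have h3 := h1 x (intr_subset B x.2)
    have h4 := h2 x (intr_subset B x.2)
    simp only [ext0, x.2, dif_pos] at h3 h4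
    exact le_antisymm h3 h4
  obtain ⟨g, hg⟩ := LinearMap.injective_iff_surjective.1 hinj (fun x => r x)
  refine ⟨ext0 (intr B) g, fun x hx => by simp [ext0, hx], fun x hx => ?_⟩
  have := congrFun hg ⟨x, hx⟩
  simp only [T, LinearMap.coe_mk, AddHom.coe_mk] at this
  rw [← this]
  simp [ext0, hx]

lemma green_exists (B : Finset Vtx) : ∃ G, IsGreenFn B G := by
  choose f hf1 hf2 using fun y : Vtx => poisson_solve B (fun x => (Real.pi / 2) * (if x = y then 1 else 0))
  refine ⟨fun x y => if y ∈ intr B then f y x else 0, ?_, ?_⟩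
  · rintro x y (h | h)
    · simp only; split_ifs; exacts [hf1 y x h, rfl]
    · simp [h]
  · intro y hy x hx
    simp only [hy, if_true]
    exact hf2 y x hx

noncomputable def Gr (B : Finset Vtx) : Vtx → Vtx → ℝ := (green_exists B).choose

lemma Gr_spec (B : Finset Vtx) : IsGreenFn B (Gr B) := (green_exists B).choose_spec

lemma green_unique {B : Finset Vtx} {G : Vtx → Vtx → ℝ} (hG : IsGreenFn B G) : G = Gr B := by
  have hG' := Gr_spec B
  funext x y
  by_cases hy : y ∈ intr B
  swap
  · rw [hG.1 x y (Or.inr hy), hG'.1 x y (Or.inr hy)]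
  by_cases hx : x ∈ intr B
  swap
  · rw [hG.1 x y (Or.inl hx), hG'.1 x y (Or.inl hx)]
  have hh : ∀ x ∈ intr B, G x y - Gr B x y = avg (fun x => G x y - Gr B x y) x := by
    intro x hx
    rw [hG.2 y hy x hx, hG'.2 y hy x hx]; unfold avg; ring
  have hz : ∀ z ∈ B, z ∉ intr B → G z y - Gr B z y = 0 := by
    intro z _ hz
    rw [hG.1 z y (Or.inl hz), hG'.1 z y (Or.inl hz)]; ring
  have h1 := max_principle (B := B) (f := fun x => G x y - Gr B x y) (c := 0) (fun x hx => (hh x hx).le)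
      (fun z hzB hz' => (hz z hzB hz').le) x (intr_subset B hx)
  have h2 := min_principle (B := B) (f := fun x => G x y - Gr B x y) (c := 0) (fun x hx => (hh x hx).ge)
      (fun z hzB hz' => (hz z hzB hz').ge) x (intr_subset B hx)
  linarith

lemma Gr_zero_left {B : Finset Vtx} {x y : Vtx} (h : x ∉ intr B) : Gr B x y = 0 :=
  (Gr_spec B).1 x y (Or.inl h)
lemma Gr_zero_right {B : Finset Vtx} {x y : Vtx} (h : y ∉ intr B) : Gr B x y = 0 :=
  (Gr_spec B).1 x y (Or.inr h)

lemma Gr_eq {B : Finset Vtx} {x y : Vtx} (hx : x ∈ intr B) :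
    Gr B x y = avg (fun z => Gr B z y) x + (Real.pi / 2) * (if x = y then 1 else 0) := by
  by_cases hy : y ∈ intr B
  · exact (Gr_spec B).2 y hy x hx
  · have : x ≠ y := fun h => hy (h ▸ hx)
    simp [avg, Gr_zero_right hy, this]

lemma Gr_nonneg (B : Finset Vtx) (x y : Vtx) : 0 ≤ Gr B x y := by
  by_cases hx : x ∈ intr B
  swap
  · rw [Gr_zero_left hx]
  refine min_principle (B := B) (f := fun x => Gr B x y) (c := 0) (fun x hx => ?_)
    (fun z _ hz => (Gr_zero_left hz).ge) x (intr_subset B hx)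
  rw [Gr_eq hx]
  have : 0 ≤ (Real.pi / 2) * (if x = y then (1:ℝ) else 0) := by
    have := Real.pi_pos; split_ifs <;> simp; positivity
  linarith

/-- discrete summation by parts -/
lemma sum_avg_symm {S : Finset Vtx} {f g : Vtx → ℝ} (hf : ∀ x ∉ S, f x = 0) (hg : ∀ x ∉ S, g x = 0) :
    ∑ x ∈ S, f x * avg g x = ∑ x ∈ S, g x * avg f x := by
  have key : ∀ e : Vtx, ∑ x ∈ S, f x * g (x + e) = ∑ x ∈ S, g x * f (x - e) := by
    intro e
    have q1 : ∑' x, f x * g (x + e) = ∑ x ∈ S, f x * g (x + e) :=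
      tsum_eq_sum (fun x hx => by simp [hf x hx])
    have q2 : ∑' x, g x * f (x - e) = ∑ x ∈ S, g x * f (x - e) :=
      tsum_eq_sum (fun x hx => by simp [hg x hx])
    rw [← q1, ← q2, ← (Equiv.addRight e).tsum_eq (fun x => g x * f (x - e))]
    apply tsum_congr; intro x; simp [mul_comm]
  have k1 := key (1, 0)
  have k2 := key (-1, 0)
  have k3 := key (0, 1)
  have k4 := key (0, -1)
  have e1 : ∀ (h : Vtx → ℝ) (x : Vtx), avg h x = (h (x + (1,0)) + h (x + (-1,0)) + h (x + (0,1)) + h (x + (0,-1))) / 4 := by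
    intro h ⟨a, b⟩; simp [avg, sub_eq_add_neg]
  have e2 : ∀ (h : Vtx → ℝ) (x : Vtx), avg h x = (h (x - (1,0)) + h (x - (-1,0)) + h (x - (0,1)) + h (x - (0,-1))) / 4 := by
    intro h ⟨a, b⟩; simp [avg]; ring
  simp only [e1 g, e2 f, mul_div_assoc', mul_add, ← Finset.sum_div, Finset.sum_add_distrib, k1, k2, k3, k4]

lemma Gr_symm (B : Finset Vtx) (x y : Vtx) : Gr B x y = Gr B y x := by
  by_cases hy : y ∈ intr B
  swap
  · rw [Gr_zero_left hy, Gr_zero_right hy]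
  by_cases hx : x ∈ intr B
  swap
  · rw [Gr_zero_left hx, Gr_zero_right hx]
  have h := sum_avg_symm (S := intr B) (f := fun z => Gr B z x) (g := fun z => Gr B z y)
    (fun z hz => Gr_zero_left hz) (fun z hz => Gr_zero_left hz)
  have e : ∀ a b, b ∈ intr B → ∑ z ∈ intr B, Gr B z a * avg (fun z => Gr B z b) z =
      ∑ z ∈ intr B, Gr B z a * Gr B z b - (Real.pi / 2) * Gr B b a := by
    intro a b hb
    have : ∀ z ∈ intr B, Gr B z a * avg (fun z => Gr B z b) z =
        Gr B z a * Gr B z b - (if z = b then (Real.pi / 2) * Gr B z a else 0) := by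
      intro z hz
      rw [Gr_eq (x := z) (y := b) hz]; split_ifs <;> ring
    rw [Finset.sum_congr rfl this, Finset.sum_sub_distrib, Finset.sum_ite_eq' _ b]
    simp [hb]
  rw [e x y hy, e y x hx] at h
  have h2 : ∑ z ∈ intr B, Gr B z x * Gr B z y = ∑ z ∈ intr B, Gr B z y * Gr B z x :=
    Finset.sum_congr rfl fun _ _ => mul_comm _ _
  have := Real.pi_pos
  have h3 : (Real.pi / 2) * Gr B y x = (Real.pi / 2) * Gr B x y := by linarith
  exact (mul_left_cancel₀ (by positivity) h3).symm

lemma avg_pk (x w : Vtx) : avg (fun z => pk (z - w)) x =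
    pk (x - w) + (Real.pi / 2) * (if x = w then 1 else 0) := by
  obtain ⟨a, b⟩ := x
  obtain ⟨c, d⟩ := w
  have := pk_harm (a - c) (b - d)
  simp only [avg, Prod.mk_sub_mk]
  rw [show a + 1 - c = a - c + 1 by ring, show a - 1 - c = a - c - 1 by ring,
    show b + 1 - d = b - d + 1 by ring, show b - 1 - d = b - d - 1 by ring, this]
  have : ((a - c, b - d) = ((0, 0) : ℤ × ℤ)) ↔ ((a, b) = (c, d)) := by
    simp [sub_eq_zero]
  simp only [this]
  split_ifs <;> ring

lemma nrm_symm (v w : Vtx) : nrm (v - w) = nrm (w - v) := by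
  simp only [nrm, Prod.fst_sub, Prod.snd_sub, Int.cast_sub, abs_sub_comm]

lemma nrm_le {v : Vtx} {r : ℝ} (hr : 1 ≤ r) (h1 : |(v.1:ℝ)| ≤ r) (h2 : |(v.2:ℝ)| ≤ r) : nrm v ≤ r :=
  max_le (max_le h1 h2) hr

lemma nrm_ge1 (v : Vtx) : |(v.1:ℝ)| ≤ nrm v := le_trans (le_max_left _ _) (le_max_left _ _)
lemma nrm_ge2 (v : Vtx) : |(v.2:ℝ)| ≤ nrm v := le_trans (le_max_right _ _) (le_max_left _ _)

lemma mem_VN {N : ℕ} {v : Vtx} : v ∈ VN N ↔ 0 ≤ v.1 ∧ v.1 ≤ N ∧ 0 ≤ v.2 ∧ v.2 ≤ N := by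
  unfold VN
  rw [Finset.mem_Icc, Prod.le_def, Prod.le_def]
  simp only
  tauto

/-- distance to the boundary of `V_N`, truncated below at 1 -/
noncomputable def dd (N : ℕ) (v : Vtx) : ℝ :=
  max 1 ((min (min v.1 (N - v.1)) (min v.2 (N - v.2)) : ℤ) : ℝ)

lemma one_le_dd (N : ℕ) (v : Vtx) : 1 ≤ dd N v := le_max_left _ _

lemma nbhd_subset (N : ℕ) (lam : ℝ) {v : Vtx} (hv : v ∈ VN N) : nbhd N lam v ⊆ VN N := by
  unfold nbhd
  split_ifs
  · exact fun _ h => h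
  · simpa using hv
  · exact Finset.filter_subset _ _

lemma self_mem_nbhd (N : ℕ) (lam : ℝ) {v : Vtx} (hv : v ∈ VN N) : v ∈ nbhd N lam v := by
  unfold nbhd
  split_ifs
  · exact hv
  · simp
  · simp [hv]; positivity

lemma nbhd_diff {N : ℕ} {lam : ℝ} {v z w : Vtx} (hv : v ∈ VN N)
    (hz : z ∈ nbhd N lam v) (hw : w ∈ nbhd N lam v) :
    |((z - w).1 : ℝ)| ≤ (N:ℝ) ^ (1 - lam) ∧ |((z - w).2 : ℝ)| ≤ (N:ℝ) ^ (1 - lam) := by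
  unfold nbhd at hz hw
  split_ifs at hz hw with h0 h1
  · rw [h0]; simp only [sub_zero, Real.rpow_one]
    rw [mem_VN] at hz hw
    simp only [Prod.fst_sub, Prod.snd_sub, Int.cast_sub, abs_le]
    have e1 : ((z.1 : ℤ) : ℝ) - w.1 = ((z.1 - w.1 : ℤ) : ℝ) := by push_cast; ring
    have e2 : ((z.2 : ℤ) : ℝ) - w.2 = ((z.2 - w.2 : ℤ) : ℝ) := by push_cast; ring
    have e3 : (N:ℝ) = ((N:ℤ):ℝ) := by simp
    rw [e1, e2, e3]
    refine ⟨⟨?_, ?_⟩, ?_, ?_⟩ <;> norm_cast <;> omega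
  · simp at hz hw; subst hz; subst hw; simp; positivity
  · simp only [Finset.mem_filter] at hz hw
    simp only [Prod.fst_sub, Prod.snd_sub, Int.cast_sub]
    obtain ⟨_, a1, a2⟩ := hz
    obtain ⟨_, b1, b2⟩ := hw
    rw [abs_le] at a1 a2 b1 b2
    constructor <;> rw [abs_le] <;> constructor <;> linarith

lemma nbhd_mem {N : ℕ} {lam : ℝ} {v z : Vtx} (hl : lam ≠ 1) (hz : z ∈ VN N)
    (h1 : |(z.1:ℝ) - v.1| ≤ (N:ℝ) ^ (1 - lam) / 2) (h2 : |(z.2:ℝ) - v.2| ≤ (N:ℝ) ^ (1 - lam) / 2) :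
    z ∈ nbhd N lam v := by
  unfold nbhd
  split_ifs
  · exact hz
  · simp [hz, h1, h2]

lemma gr_upper {B : Finset Vtx} {w : Vtx} {g : Vtx → ℝ} {K : ℝ}
    (hg : ∀ x ∈ intr B, avg g x = g x)
    (hb : ∀ z ∈ B, z ∉ intr B → pk (z - w) - g z ≤ K) :
    ∀ x ∈ B, Gr B x w ≤ K - pk (x - w) + g x := by
  intro x hx
  have := max_principle (B := B) (f := fun x => Gr B x w + pk (x - w) - g x) (c := K) (fun x hx => ?_)
    (fun z hz hz' => by rw [Gr_zero_left hz']; linarith [hb z hz hz']) x hx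
  · linarith
  · have h1 := Gr_eq (y := w) hx
    have h2 := avg_pk x w
    have h3 := hg x hx
    simp only [avg] at h1 h2 h3 ⊢
    linarith

lemma gr_lower {B : Finset Vtx} {w : Vtx} {K : ℝ}
    (hb : ∀ z ∈ B, z ∉ intr B → K ≤ pk (z - w)) :
    ∀ x ∈ B, K - pk (x - w) ≤ Gr B x w := by
  intro x hx
  have := min_principle (B := B) (f := fun x => Gr B x w + pk (x - w)) (c := K) (fun x hx => ?_)
    (fun z hz hz' => by rw [Gr_zero_left hz']; linarith [hb z hz hz']) x hx
  · linarith
  · have h1 := Gr_eq (y := w) hx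
    have h2 := avg_pk x w
    simp only [avg] at h1 h2 ⊢
    linarith

lemma refl_exists {N : ℕ} {v w : Vtx} (hv : v ∈ VN N) (hw : w ∈ VN N) :
    ∃ u : Vtx, u ∉ intr (VN N) ∧ (∀ x ∈ VN N, nrm (x - w) ≤ nrm (x - u)) ∧
      nrm (v - u) ≤ 2 * dd N v + nrm (v - w) := by
  have hv' := mem_VN.1 hv
  have hw' := mem_VN.1 hw
  have gen : ∀ u : Vtx, u ∉ intr (VN N) →
      (∀ x ∈ VN N, |x.1 - w.1| ≤ |x.1 - u.1| ∧ |x.2 - w.2| ≤ |x.2 - u.2|) →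
      (|v.1 - u.1| ≤ 2 * (min (min v.1 (N - v.1)) (min v.2 (N - v.2))) + |v.1 - w.1| ∧
        |v.2 - u.2| ≤ 2 * (min (min v.1 (N - v.1)) (min v.2 (N - v.2))) + |v.2 - w.2|) →
      ∃ u : Vtx, u ∉ intr (VN N) ∧ (∀ x ∈ VN N, nrm (x - w) ≤ nrm (x - u)) ∧
      nrm (v - u) ≤ 2 * dd N v + nrm (v - w) := by
    intro u hu h1 h2
    refine ⟨u, hu, fun x hx => ?_, ?_⟩
    · obtain ⟨a, b⟩ := h1 x hx
      unfold nrm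
      apply max_le_max (max_le_max _ _) le_rfl
      · exact_mod_cast a
      · exact_mod_cast b
    · have hd : ((min (min v.1 (N - v.1)) (min v.2 (N - v.2)) : ℤ) : ℝ) ≤ dd N v := le_max_right _ _
      have hd1 := one_le_dd N v
      have a : ((|v.1 - u.1| : ℤ) : ℝ) ≤ ((2 * (min (min v.1 (N - v.1)) (min v.2 (N - v.2))) + |v.1 - w.1| : ℤ) : ℝ) := by
        exact_mod_cast h2.1
      have b : ((|v.2 - u.2| : ℤ) : ℝ) ≤ ((2 * (min (min v.1 (N - v.1)) (min v.2 (N - v.2))) + |v.2 - w.2| : ℤ) : ℝ) := by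
        exact_mod_cast h2.2
      have c1 := nrm_ge1 (v - w)
      have c2 := nrm_ge2 (v - w)
      have c3 := one_le_nrm (v - w)
      rw [Int.cast_add, Int.cast_mul, Int.cast_abs, Int.cast_abs] at a b
      simp only [Prod.fst_sub, Prod.snd_sub] at c1 c2
      apply nrm_le (by linarith)
      · simp only [Prod.fst_sub]; push_cast at a hd ⊢; push_cast at c1; linarith
      · simp only [Prod.snd_sub]; push_cast at b hd ⊢; push_cast at c2; linarith
  have hni : ∀ u : Vtx, (u.1 ≤ 0 ∨ (N:ℤ) ≤ u.1 ∨ u.2 ≤ 0 ∨ (N:ℤ) ≤ u.2) → u ∉ intr (VN N) := by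
    intro u hu h
    rw [mem_intr] at h
    simp only [mem_VN] at h
    omega
  set D := min (min v.1 (N - v.1)) (min v.2 (N - v.2)) with hD
  have hcase : D = v.1 ∨ D = N - v.1 ∨ D = v.2 ∨ D = N - v.2 := by omega
  rcases hcase with h | h | h | h
  · apply gen (-w.1, w.2) (hni _ (by simp; omega))
    · intro x hx
      rw [mem_VN] at hx
      simp only [abs_eq_max_neg]; constructor <;> omega
    · simp only [abs_eq_max_neg]; constructor <;> omega
  · apply gen (2 * N - w.1, w.2) (hni _ (by simp; omega))
    · intro x hx
      rw [mem_VN] at hx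
      simp only [abs_eq_max_neg]; constructor <;> omega
    · simp only [abs_eq_max_neg]; constructor <;> omega
  · apply gen (w.1, - w.2) (hni _ (by simp; omega))
    · intro x hx
      rw [mem_VN] at hx
      simp only [abs_eq_max_neg]; constructor <;> omega
    · simp only [abs_eq_max_neg]; constructor <;> omega
  · apply gen (w.1, 2 * N - w.2) (hni _ (by simp; omega))
    · intro x hx
      rw [mem_VN] at hx
      simp only [abs_eq_max_neg]; constructor <;> omega
    · simp only [abs_eq_max_neg]; constructor <;> omega

lemma nrm_tri (u v w : Vtx) : nrm (u - w) ≤ nrm (u - v) + nrm (v - w) := by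
  have a1 := nrm_ge1 (u - v)
  have a2 := nrm_ge2 (u - v)
  have a3 := one_le_nrm (u - v)
  have b1 := nrm_ge1 (v - w)
  have b2 := nrm_ge2 (v - w)
  have b3 := one_le_nrm (v - w)
  simp only [Prod.fst_sub, Prod.snd_sub, Int.cast_sub] at *
  apply nrm_le (by linarith)
  · simp only [Prod.fst_sub, Int.cast_sub]
    calc |(u.1:ℝ) - w.1| ≤ |(u.1:ℝ) - v.1| + |(v.1:ℝ) - w.1| := abs_sub_le _ _ _
      _ ≤ _ := add_le_add a1 b1
  · simp only [Prod.snd_sub, Int.cast_sub]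
    calc |(u.2:ℝ) - w.2| ≤ |(u.2:ℝ) - v.2| + |(v.2:ℝ) - w.2| := abs_sub_le _ _ _
      _ ≤ _ := add_le_add a2 b2

lemma intr_mono {B B' : Finset Vtx} (h : B ⊆ B') : intr B ⊆ intr B' := by
  intro x hx
  rw [mem_intr] at *
  exact ⟨h hx.1, h hx.2.1, h hx.2.2.1, h hx.2.2.2.1, h hx.2.2.2.2⟩

/-- points well inside are in the interior -/
lemma mem_intr_nbhd {N : ℕ} {lam r : ℝ} {v z : Vtx} (hl : lam ≠ 1) (hr1 : r ≤ (N:ℝ) ^ (1 - lam) / 2)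
    (hr2 : r ≤ dd N v) (hr3 : 1 < r) (h1 : |(z.1:ℝ) - v.1| ≤ r - 1) (h2 : |(z.2:ℝ) - v.2| ≤ r - 1) :
    z ∈ intr (nbhd N lam v) := by
  have hd : r ≤ ((min (min v.1 (N - v.1)) (min v.2 (N - v.2)) : ℤ) : ℝ) := by
    unfold dd at hr2
    rcases le_max_iff.1 hr2 with h | h
    · linarith
    · exact h
  push_cast at hd
  simp only [le_min_iff] at hd
  obtain ⟨⟨d1, d2⟩, d3, d4⟩ := hd
  have key : ∀ u : Vtx, |(u.1:ℝ) - v.1| ≤ r → |(u.2:ℝ) - v.2| ≤ r → u ∈ nbhd N lam v := by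
    intro u hu1 hu2
    apply nbhd_mem hl _ (hu1.trans hr1) (hu2.trans hr1)
    rw [mem_VN]
    rw [abs_le] at hu1 hu2
    refine ⟨?_, ?_, ?_, ?_⟩
    · have : (0:ℝ) ≤ u.1 := by linarith
      exact_mod_cast this
    · have : (u.1:ℝ) ≤ N := by linarith
      exact_mod_cast this
    · have : (0:ℝ) ≤ u.2 := by linarith
      exact_mod_cast this
    · have : (u.2:ℝ) ≤ N := by linarith
      exact_mod_cast this
  rw [abs_le] at h1 h2
  rw [mem_intr]
  refine ⟨key _ ?_ ?_, key _ ?_ ?_, key _ ?_ ?_, key _ ?_ ?_, key _ ?_ ?_⟩ <;> rw [abs_le] <;>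
    push_cast <;> constructor <;> linarith

theorem green_est : ∃ C : ℝ, 0 < C ∧ ∀ N : ℕ, 2 ≤ N → ∀ lam ∈ Set.Icc (0:ℝ) 1, ∀ v ∈ VN N, ∀ w ∈ VN N,
    |Gr (nbhd N lam v) v w - max 0 (min ((1 - lam) * Real.log N) (Real.log (dd N v))
      - Real.log (nrm (v - w)))| ≤ C := by
  obtain ⟨C, hC, hpk⟩ := pk_asymp
  refine ⟨4 * C + 3 + Real.log 16, by have := Real.log_nonneg (show (1:ℝ) ≤ 16 by norm_num); linarith, ?_⟩
  intro N hN lam hlam v hv w hw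
  have hN0 : (0:ℝ) < N := by exact_mod_cast (by omega : 0 < N)
  have hN1 : (1:ℝ) ≤ N := by exact_mod_cast (by omega : 1 ≤ N)
  set B := nbhd N lam v with hB
  have hvB : v ∈ B := self_mem_nbhd N lam hv
  set ln := Real.log (nrm (v - w)) with hln
  have hln0 : 0 ≤ ln := Real.log_nonneg (one_le_nrm _)
  have hd1 := one_le_dd N v
  have hnw := one_le_nrm (v - w)
  have h16 : 0 ≤ Real.log 16 := Real.log_nonneg (by norm_num)
  have hpow : Real.log ((N:ℝ) ^ (1 - lam)) = (1 - lam) * Real.log N := Real.log_rpow hN0 _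
  have hpow1 : 1 ≤ (N:ℝ) ^ (1 - lam) := Real.one_le_rpow hN1 (by linarith [hlam.2])
  rw [abs_le]
  constructor
  · -- lower bound
    set r := min ((N:ℝ) ^ (1 - lam) / 2) (dd N v) with hr
    have hr0 : 0 < r := lt_min (by linarith) (by linarith)
    have hlogr : min ((1 - lam) * Real.log N) (Real.log (dd N v)) ≤ Real.log r + Real.log 2 := by
      rcases min_choice ((N:ℝ) ^ (1 - lam) / 2) (dd N v) with h | h
      · rw [hr, h, Real.log_div (by linarith) (by norm_num), hpow]
        exact (min_le_left _ _).trans (by linarith)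
      · rw [hr, h]
        exact (min_le_right _ _).trans (by linarith [Real.log_nonneg (show (1:ℝ) ≤ 2 by norm_num)])
    have h28 : Real.log 16 = Real.log 2 + Real.log 8 := by
      rw [← Real.log_mul (by norm_num) (by norm_num)]; norm_num
    have hl8 : Real.log 8 = Real.log 2 + Real.log 4 := by
      rw [← Real.log_mul (by norm_num) (by norm_num)]; norm_num
    have hl4 : 0 ≤ Real.log 4 := Real.log_nonneg (by norm_num)
    by_cases hcase : r / 8 < nrm (v - w)
    · have : Real.log r - Real.log 8 ≤ ln := by
        rw [← Real.log_div hr0.ne' (by norm_num)]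
        exact Real.log_le_log (by positivity) hcase.le
      have h3 : max 0 (min ((1 - lam) * Real.log N) (Real.log (dd N v)) - ln) ≤ Real.log 16 :=
        max_le h16 (by linarith)
      linarith [Gr_nonneg B v w]
    · push Not at hcase
      have hr8 : 8 ≤ r := by linarith
      have hl1 : lam ≠ 1 := by
        intro h
        have : r ≤ 1 / 2 := by
          refine (min_le_left _ _).trans ?_
          rw [h]; simp
        linarith
      have hin : ∀ z : Vtx, |(z.1:ℝ) - v.1| ≤ r - 1 → |(z.2:ℝ) - v.2| ≤ r - 1 → z ∈ intr B :=
        fun z h1 h2 => mem_intr_nbhd hl1 (min_le_left _ _) (min_le_right _ _) (by linarith) h1 h2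
      have hwB : w ∈ intr B := by
        have a1 := nrm_ge1 (w - v)
        have a2 := nrm_ge2 (w - v)
        rw [nrm_symm] at a1 a2
        simp only [Prod.fst_sub, Prod.snd_sub, Int.cast_sub] at a1 a2
        exact hin w (by linarith) (by linarith)
      have hz : ∀ z ∈ B, z ∉ intr B → Real.log r - Real.log 2 - C ≤ pk (z - w) := by
        intro z _ hz
        have h1 : r - 1 < nrm (z - v) := by
          by_contra hcon
          push Not at hcon
          have a1 := nrm_ge1 (z - v)
          have a2 := nrm_ge2 (z - v)
          simp only [Prod.fst_sub, Prod.snd_sub, Int.cast_sub] at a1 a2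
          exact hz (hin z (by linarith) (by linarith))
        have h2 := nrm_tri z w v
        rw [nrm_symm w v] at h2
        have h3 : r / 2 ≤ nrm (z - w) := by linarith
        have h4 := (abs_le.1 (hpk (z - w))).1
        have h5 := Real.log_le_log (by positivity) h3
        rw [Real.log_div hr0.ne' (by norm_num)] at h5
        linarith
      have := gr_lower hz v hvB
      have h5 := (abs_le.1 (hpk (v - w))).2
      have hG0 := Gr_nonneg B v w
      have h3 : max 0 (min ((1 - lam) * Real.log N) (Real.log (dd N v)) - ln) ≤ Gr B v w + 4 * C + 3 + Real.log 16 := by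
        apply max_le
        · linarith
        · linarith
      linarith
  · -- upper bound
    have hmax0 : 0 ≤ max 0 (min ((1 - lam) * Real.log N) (Real.log (dd N v)) - ln) := le_max_left _ _
    by_cases hwi : w ∈ intr B
    swap
    · rw [Gr_zero_right hwi]; linarith
    have hpv := (abs_le.1 (hpk (v - w))).1
    have u1 : Gr B v w ≤ (1 - lam) * Real.log N + 2 * C - ln := by
      have := gr_upper (B := B) (w := w) (g := fun _ => 0) (K := (1 - lam) * Real.log N + C)
        (fun x _ => by simp [avg]) (fun z hz _ => by
          have h1 := nbhd_diff hv hz (intr_subset _ hwi)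
          have h2 := Real.log_le_log (by linarith [one_le_nrm (z - w)]) (nrm_le hpow1 h1.1 h1.2)
          rw [hpow] at h2
          have := (abs_le.1 (hpk (z - w))).2
          linarith) v hvB
      linarith
    have u2 : Gr B v w ≤ 4 * C + 3 + max (Real.log (dd N v)) ln - ln := by
      obtain ⟨u, hu1, hu2, hu3⟩ := refl_exists hv hw
      have hBV : B ⊆ VN N := nbhd_subset N lam hv
      have := gr_upper (B := B) (w := w) (g := fun x => pk (x - u)) (K := 2 * C)
        (fun x hx => by
          rw [avg_pk, if_neg]; · ring
          rintro rfl
          exact hu1 (intr_mono hBV hx)) (fun z hz _ => by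
          have h2 := Real.log_le_log (by linarith [one_le_nrm (z - w)]) (hu2 z (hBV hz))
          have := (abs_le.1 (hpk (z - w))).2
          have := (abs_le.1 (hpk (z - u))).1
          linarith) v hvB
      have h4 := (abs_le.1 (hpk (v - u))).2
      have h5 : Real.log (nrm (v - u)) ≤ Real.log 3 + max (Real.log (dd N v)) ln := by
        rcases le_total (dd N v) (nrm (v - w)) with h | h
        · have : nrm (v - u) ≤ 3 * nrm (v - w) := by linarith
          have h6 := Real.log_le_log (by linarith [one_le_nrm (v - u)]) this
          rw [Real.log_mul (by norm_num) (by linarith)] at h6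
          exact h6.trans (by linarith [le_max_right (Real.log (dd N v)) ln])
        · have : nrm (v - u) ≤ 3 * dd N v := by linarith
          have h6 := Real.log_le_log (by linarith [one_le_nrm (v - u)]) this
          rw [Real.log_mul (by norm_num) (by linarith)] at h6
          exact h6.trans (by linarith [le_max_left (Real.log (dd N v)) ln])
      have h3 : Real.log 3 ≤ 3 := by
        have := Real.log_le_sub_one_of_pos (show (0:ℝ) < 3 by norm_num)
        linarith
      linarith
    rcases max_cases (Real.log (dd N v)) ln with h | h <;>
    rcases min_cases ((1 - lam) * Real.log N) (Real.log (dd N v)) with h' | h' <;>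
    rcases max_cases 0 (min ((1 - lam) * Real.log N) (Real.log (dd N v)) - ln) with h'' | h'' <;>
    linarith

/-- linear functional on fields -/
noncomputable def lin (N : ℕ) (c : Vtx → ℝ) (ω : FieldSp) : ℝ := ∑ v ∈ VN N, c v * ω v

/-- covariance form -/
noncomputable def QQ (N : ℕ) (c d : Vtx → ℝ) : ℝ :=
  ∑ v ∈ VN N, ∑ w ∈ VN N, c v * d w * Gr (VN N) v w

lemma QQ_comm (N : ℕ) (c d : Vtx → ℝ) : QQ N c d = QQ N d c := by
  unfold QQ
  rw [Finset.sum_comm]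
  refine Finset.sum_congr rfl fun v _ => Finset.sum_congr rfl fun w _ => ?_
  rw [Gr_symm]; ring

lemma QQ_add_left (N : ℕ) (c c' d : Vtx → ℝ) : QQ N (c + c') d = QQ N c d + QQ N c' d := by
  unfold QQ
  simp only [Pi.add_apply, add_mul, Finset.sum_add_distrib]

lemma QQ_smul_left (N : ℕ) (a : ℝ) (c d : Vtx → ℝ) : QQ N (a • c) d = a * QQ N c d := by
  unfold QQ
  simp only [Pi.smul_apply, smul_eq_mul, Finset.mul_sum, mul_assoc]

lemma QQ_add_right (N : ℕ) (c d d' : Vtx → ℝ) : QQ N c (d + d') = QQ N c d + QQ N c d' := by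
  rw [QQ_comm, QQ_add_left, QQ_comm N d, QQ_comm N d']

lemma QQ_smul_right (N : ℕ) (a : ℝ) (c d : Vtx → ℝ) : QQ N c (a • d) = a * QQ N c d := by
  rw [QQ_comm, QQ_smul_left, QQ_comm]

lemma QQ_sub_left (N : ℕ) (c c' d : Vtx → ℝ) : QQ N (c - c') d = QQ N c d - QQ N c' d := by
  have : c - c' = c + (-1 : ℝ) • c' := by ext; simp; ring
  rw [this, QQ_add_left, QQ_smul_left]; ring

lemma QQ_sub_right (N : ℕ) (c d d' : Vtx → ℝ) : QQ N c (d - d') = QQ N c d - QQ N c d' := by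
  rw [QQ_comm, QQ_sub_left, QQ_comm N d, QQ_comm N d']

lemma QQ_sum_left {ι : Type*} (N : ℕ) (s : Finset ι) (c : ι → Vtx → ℝ) (d : Vtx → ℝ) :
    QQ N (∑ i ∈ s, c i) d = ∑ i ∈ s, QQ N (c i) d := by
  induction s using Finset.induction_on with
  | empty => simp [QQ]
  | insert a s ha ih => rw [Finset.sum_insert ha, Finset.sum_insert ha, QQ_add_left, ih]

lemma QQ_sum_right {ι : Type*} (N : ℕ) (s : Finset ι) (c : ι → Vtx → ℝ) (d : Vtx → ℝ) :
    QQ N d (∑ i ∈ s, c i) = ∑ i ∈ s, QQ N d (c i) := by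
  rw [QQ_comm, QQ_sum_left]; exact Finset.sum_congr rfl fun _ _ => QQ_comm _ _ _

/-- positivity of the Dirichlet form -/
lemma dirichlet_nonneg {S : Finset Vtx} {f : Vtx → ℝ} (hf : ∀ x ∉ S, f x = 0) :
    ∑ x ∈ S, f x * avg f x ≤ ∑ x ∈ S, f x ^ 2 := by
  have key : ∀ e : Vtx, ∑ x ∈ S, f (x + e) ^ 2 ≤ ∑ x ∈ S, f x ^ 2 := by
    intro e
    have h1 : ∑ x ∈ S, f (x + e) ^ 2 = ∑ y ∈ S.map (Equiv.addRight e).toEmbedding, f y ^ 2 := by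
      rw [Finset.sum_map]; rfl
    rw [h1]
    set T := S.map (Equiv.addRight e).toEmbedding
    have h2 : ∑ y ∈ T, f y ^ 2 ≤ ∑ y ∈ T ∪ S, f y ^ 2 :=
      Finset.sum_le_sum_of_subset_of_nonneg Finset.subset_union_left (fun _ _ _ => sq_nonneg _)
    have h3 : ∑ y ∈ S, f y ^ 2 = ∑ y ∈ T ∪ S, f y ^ 2 :=
      Finset.sum_subset Finset.subset_union_right (fun x _ hx => by simp [hf x hx])
    rw [h3]; exact h2
  have k1 := key (1, 0)
  have k2 := key (-1, 0)
  have k3 := key (0, 1)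
  have k4 := key (0, -1)
  have e1 : ∀ (x : Vtx), f x * avg f x ≤ f x ^ 2 / 2 + (f (x + (1,0)) ^ 2 + f (x + (-1,0)) ^ 2
      + f (x + (0,1)) ^ 2 + f (x + (0,-1)) ^ 2) / 8 := by
    intro ⟨a, b⟩
    simp only [avg, sub_eq_add_neg, Prod.mk_add_mk, add_zero]
    nlinarith [sq_nonneg (f (a, b) - f (a + 1, b)), sq_nonneg (f (a, b) - f (a + -1, b)),
      sq_nonneg (f (a, b) - f (a, b + 1)), sq_nonneg (f (a, b) - f (a, b + -1))]
  refine (Finset.sum_le_sum fun x _ => e1 x).trans ?_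
  simp only [Finset.sum_add_distrib, ← Finset.sum_div]
  linarith

lemma QQ_nonneg (N : ℕ) (c : Vtx → ℝ) : 0 ≤ QQ N c c := by
  set S := intr (VN N) with hS
  set f : Vtx → ℝ := fun x => ∑ w ∈ VN N, c w * Gr (VN N) x w with hf
  have hf0 : ∀ x ∉ S, f x = 0 := fun x hx => Finset.sum_eq_zero fun w _ => by rw [Gr_zero_left hx]; ring
  have hD : ∀ x ∈ S, f x - avg f x = (Real.pi / 2) * c x := by
    intro x hx
    have : avg f x = ∑ w ∈ VN N, c w * avg (fun z => Gr (VN N) z w) x := by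
      simp only [avg, hf, mul_div_assoc', mul_add, ← Finset.sum_div, Finset.sum_add_distrib]
    rw [this, hf, ← Finset.sum_sub_distrib]
    have h2 : ∀ w ∈ VN N, c w * Gr (VN N) x w - c w * avg (fun z => Gr (VN N) z w) x =
        if x = w then (Real.pi / 2) * c w else 0 := by
      intro w _
      rw [Gr_eq (y := w) hx]; split_ifs <;> ring
    rw [Finset.sum_congr rfl h2, Finset.sum_ite_eq]
    simp [intr_subset _ hx]
  have h1 : QQ N c c = ∑ x ∈ VN N, c x * f x := by
    unfold QQ
    refine Finset.sum_congr rfl fun x _ => ?_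
    rw [hf, Finset.mul_sum]
    exact Finset.sum_congr rfl fun _ _ => by ring
  have h2 : ∑ x ∈ S, c x * f x = ∑ x ∈ VN N, c x * f x :=
    Finset.sum_subset (intr_subset _) fun x _ hx => by rw [hf0 x hx]; ring
  have h3 : (Real.pi / 2) * ∑ x ∈ S, c x * f x = ∑ x ∈ S, f x ^ 2 - ∑ x ∈ S, f x * avg f x := by
    rw [Finset.mul_sum, ← Finset.sum_sub_distrib]
    refine Finset.sum_congr rfl fun x hx => ?_
    rw [← mul_assoc, ← hD x hx]; ring
  have h4 := dirichlet_nonneg hf0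
  rw [h1, ← h2]
  have := Real.pi_pos
  by_contra hneg
  push Not at hneg
  nlinarith

lemma QQ_cs (N : ℕ) (c d : Vtx → ℝ) : QQ N c d ^ 2 ≤ QQ N c c * QQ N d d := by
  have h : ∀ t : ℝ, 0 ≤ QQ N d d * (t * t) + (2 * QQ N c d) * t + QQ N c c := by
    intro t
    have := QQ_nonneg N (c + t • d)
    rw [QQ_add_left, QQ_add_right, QQ_add_right, QQ_smul_left, QQ_smul_left, QQ_smul_right,
      QQ_smul_right, QQ_comm N d c] at this
    linarith
  have := discrim_le_zero h
  unfold discrim at this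
  nlinarith

/-- coefficients of the harmonic extension -/
noncomputable def cf (B : Finset Vtx) (v z : Vtx) : ℝ :=
  (if z = v then 1 else 0) - (2 / Real.pi) * (Gr B v z - avg (Gr B v) z)

noncomputable def dl (v z : Vtx) : ℝ := if z = v then 1 else 0

lemma Gr_eq' {B : Finset Vtx} {v z : Vtx} (hz : z ∈ intr B) :
    Gr B v z - avg (Gr B v) z = (Real.pi / 2) * (if z = v then 1 else 0) := by
  have h := Gr_eq (y := v) hz
  have e : (fun x => Gr B x v) = Gr B v := funext fun x => Gr_symm B x v
  rw [e, Gr_symm] at h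
  linarith

lemma cf_intr {B : Finset Vtx} {v z : Vtx} (hz : z ∈ intr B) : cf B v z = 0 := by
  unfold cf
  rw [Gr_eq' hz]
  have := Real.pi_pos
  split_ifs <;> field_simp <;> ring

/-- testing the coefficients against a function -/
lemma cf_test {N : ℕ} {B : Finset Vtx} {v : Vtx} (hv : v ∈ VN N) (hB : B ⊆ VN N) {g : Vtx → ℝ}
    (hg : ∀ x ∉ VN N, g x = 0) :
    ∑ z ∈ VN N, cf B v z * g z = g v - (2 / Real.pi) * ∑ z ∈ intr B, Gr B v z * (g z - avg g z) := by
  have hG : ∀ x ∉ VN N, Gr B v x = 0 := fun x hx => Gr_zero_right fun h => hx (hB (intr_subset _ h))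
  have h1 := sum_avg_symm hG hg
  have h2 : ∑ z ∈ intr B, Gr B v z * (g z - avg g z) = ∑ z ∈ VN N, Gr B v z * (g z - avg g z) :=
    Finset.sum_subset ((intr_subset _).trans hB) fun x _ hx => by rw [Gr_zero_right hx]; ring
  rw [h2]
  have h3 : ∀ z ∈ VN N, cf B v z * g z = (if z = v then g z else 0) -
      (2 / Real.pi) * (Gr B v z * g z - g z * avg (Gr B v) z) := by
    intro z _; unfold cf; split_ifs <;> ring
  rw [Finset.sum_congr rfl h3, Finset.sum_sub_distrib, Finset.sum_ite_eq', ← Finset.mul_sum,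
    Finset.sum_sub_distrib, ← h1]
  simp only [hv, if_true, mul_sub, Finset.sum_sub_distrib]

lemma QQ_dl {N : ℕ} (c : Vtx → ℝ) {w : Vtx} (hw : w ∈ VN N) :
    QQ N c (dl w) = ∑ z ∈ VN N, c z * Gr (VN N) z w := by
  unfold QQ dl
  refine Finset.sum_congr rfl fun z _ => ?_
  rw [Finset.sum_eq_single w]
  · simp
  · intro b _ hb; simp [hb]
  · intro h; exact absurd hw h

lemma QQ_cf_dl {N : ℕ} {B : Finset Vtx} {v w : Vtx} (hv : v ∈ VN N) (hB : B ⊆ VN N) (hw : w ∈ VN N) :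
    QQ N (cf B v) (dl w) = Gr (VN N) v w - Gr B v w := by
  rw [QQ_dl _ hw, cf_test hv hB (g := fun z => Gr (VN N) z w)
    (fun x hx => Gr_zero_left fun h => hx (intr_subset _ h))]
  have : ∀ z ∈ intr B, Gr B v z * (Gr (VN N) z w - avg (fun z => Gr (VN N) z w) z) =
      if z = w then (Real.pi / 2) * Gr B v z else 0 := by
    intro z hz
    rw [Gr_eq (y := w) (intr_mono hB hz)]; split_ifs <;> ring
  rw [Finset.sum_congr rfl this, Finset.sum_ite_eq']
  have hpi := Real.pi_pos
  split_ifs with h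
  · field_simp
  · rw [Gr_zero_right h]; ring

lemma QQ_dl_dl {N : ℕ} {v w : Vtx} (hv : v ∈ VN N) (hw : w ∈ VN N) :
    QQ N (dl v) (dl w) = Gr (VN N) v w := by
  rw [QQ_dl _ hw, Finset.sum_eq_single v]
  · simp [dl]
  · intro b _ hb; simp [dl, hb]
  · intro h; exact absurd hv h

lemma QQ_cf {N : ℕ} {B : Finset Vtx} {v : Vtx} (hv : v ∈ VN N) (hB : B ⊆ VN N) (c : Vtx → ℝ) :
    QQ N (cf B v) c = ∑ w ∈ VN N, c w * (Gr (VN N) v w - Gr B v w) := by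
  unfold QQ
  rw [Finset.sum_comm]
  refine Finset.sum_congr rfl fun w hw => ?_
  rw [← QQ_cf_dl hv hB hw, QQ_dl _ hw, Finset.mul_sum]
  exact Finset.sum_congr rfl fun _ _ => by ring

lemma QQ_cf_nested {N : ℕ} {B B' : Finset Vtx} {v w : Vtx} (hv : v ∈ VN N) (hw : w ∈ VN N)
    (hB : B ⊆ VN N) (hBB : B' ⊆ B) :
    QQ N (cf B v) (cf B' w) = Gr (VN N) v w - Gr B v w := by
  rw [QQ_cf hv hB, cf_test hw (hBB.trans hB) (g := fun x => Gr (VN N) v x - Gr B v x)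
    (fun x hx => by rw [Gr_zero_right fun h => hx (intr_subset _ h),
      Gr_zero_right fun h => hx (hB (intr_subset _ h))]; ring)]
  rw [Finset.sum_eq_zero]
  · ring
  · intro z hz
    have h1 := Gr_eq' (v := v) (intr_mono hBB hz)
    have h2 := Gr_eq' (v := v) (intr_mono hB (intr_mono hBB hz))
    have : avg (fun x => Gr (VN N) v x - Gr B v x) z = avg (Gr (VN N) v) z - avg (Gr B v) z := by
      unfold avg; ring
    rw [this, show Gr (VN N) v z - Gr B v z - (avg (Gr (VN N) v) z - avg (Gr B v) z) =
      (Gr (VN N) v z - avg (Gr (VN N) v) z) - (Gr B v z - avg (Gr B v) z) by ring, h1, h2]; ring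

lemma QQ_cf_disj {N : ℕ} {B B' : Finset Vtx} {v w : Vtx} (hv : v ∈ B) (hw : w ∈ B')
    (hB : B ⊆ VN N) (hB' : B' ⊆ VN N) (hd : Disjoint B B') :
    QQ N (cf B v) (cf B' w) = Gr (VN N) v w := by
  rw [QQ_cf (hB hv) hB, cf_test (hB' hw) hB' (g := fun x => Gr (VN N) v x - Gr B v x)
    (fun x hx => by rw [Gr_zero_right fun h => hx (intr_subset _ h),
      Gr_zero_right fun h => hx (hB (intr_subset _ h))]; ring)]
  have hz0 : ∀ z ∈ B', Gr B v z = 0 := fun z hz =>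
    Gr_zero_right fun h => Finset.disjoint_left.1 hd (intr_subset _ h) hz
  rw [hz0 w hw, Finset.sum_eq_zero]
  · ring
  · intro z hz
    have hz' := mem_intr.1 hz
    have h2 := Gr_eq' (v := v) (intr_mono hB' hz)
    have : avg (fun x => Gr (VN N) v x - Gr B v x) z = avg (Gr (VN N) v) z := by
      simp only [avg]; rw [hz0 _ hz'.2.1, hz0 _ hz'.2.2.1, hz0 _ hz'.2.2.2.1, hz0 _ hz'.2.2.2.2]; ring
    rw [this, hz0 z hz'.1, sub_zero, h2, if_neg]
    · ring
    · rintro rfl; exact Finset.disjoint_left.1 hd hv hz'.1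

open MeasureTheory ProbabilityTheory

/-- centered Gaussian law with given covariance -/
def CG {V : Type*} (μ : Measure (V → ℝ)) (C : V → V → ℝ) : Prop :=
  IsProbabilityMeasure μ ∧ (∀ L : (V → ℝ) →L[ℝ] ℝ, ∃ s, μ.map L = gaussianReal 0 s) ∧
    ∀ v w, ∫ x, x v * x w ∂μ = C v w

lemma lin_meas (N : ℕ) (c : Vtx → ℝ) : Measurable (lin N c) := by
  unfold lin; fun_prop

lemma gff_lin {N : ℕ} {P : Measure FieldSp} (h : IsGFF N P) (c : Vtx → ℝ) :
    P.map (lin N c) = gaussianReal 0 (QQ N c c).toNNReal := by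
  obtain ⟨_, G, hG, h⟩ := h
  rw [green_unique hG] at h
  exact h c

lemma gff_sq {N : ℕ} {P : Measure FieldSp} (h : IsGFF N P) (c : Vtx → ℝ) :
    MemLp (lin N c) 2 P ∧ ∫ ω, lin N c ω ∂P = 0 ∧ ∫ ω, lin N c ω ^ 2 ∂P = QQ N c c := by
  have hm := gff_lin h c
  have h1 : MemLp (id ∘ lin N c) 2 P := by
    rw [← memLp_map_measure_iff (by fun_prop) (lin_meas N c).aemeasurable, hm]
    exact memLp_id_gaussianReal 2
  have h2 : ∫ ω, lin N c ω ∂P = 0 := by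
    rw [← integral_map (φ := lin N c) (f := fun x => x) (lin_meas N c).aemeasurable (by fun_prop), hm]
    exact integral_id_gaussianReal
  refine ⟨h1, h2, ?_⟩
  have hv := variance_id_gaussianReal (μ := 0) (v := (QQ N c c).toNNReal)
  rw [Real.coe_toNNReal _ (QQ_nonneg N c), variance_of_integral_eq_zero (by fun_prop) (by simp)] at hv
  rw [← integral_map (φ := lin N c) (f := fun x => x^2) (lin_meas N c).aemeasurable (by fun_prop), hm]
  exact hv

lemma lin_add (N : ℕ) (c d : Vtx → ℝ) (ω : FieldSp) : lin N (c + d) ω = lin N c ω + lin N d ω := by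
  simp [lin, add_mul, Finset.sum_add_distrib]
lemma lin_smul (N : ℕ) (a : ℝ) (c : Vtx → ℝ) (ω : FieldSp) : lin N (a • c) ω = a * lin N c ω := by
  simp [lin, mul_assoc, Finset.mul_sum]
lemma lin_sub (N : ℕ) (c d : Vtx → ℝ) (ω : FieldSp) : lin N (c - d) ω = lin N c ω - lin N d ω := by
  simp [lin, sub_mul, Finset.sum_sub_distrib]
lemma lin_sum {ι : Type*} (N : ℕ) (s : Finset ι) (c : ι → Vtx → ℝ) (ω : FieldSp) :
    lin N (∑ i ∈ s, c i) ω = ∑ i ∈ s, lin N (c i) ω := by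
  simp only [lin, Finset.sum_apply, Finset.sum_mul]; rw [Finset.sum_comm]
lemma lin_dl {N : ℕ} {v : Vtx} (hv : v ∈ VN N) (ω : FieldSp) : lin N (dl v) ω = ω v := by
  simp [lin, dl, hv]

lemma gff_cov {N : ℕ} {P : Measure FieldSp} (h : IsGFF N P) (c d : Vtx → ℝ) :
    ∫ ω, lin N c ω * lin N d ω ∂P = QQ N c d := by
  have hc := gff_sq h c
  have hd := gff_sq h d
  have hcd := gff_sq h (c + d)
  have e : ∀ ω, lin N c ω * lin N d ω =
      (lin N (c+d) ω ^ 2 - lin N c ω ^ 2 - lin N d ω ^ 2) / 2 := by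
    intro ω; rw [lin_add]; ring
  simp_rw [e]
  have hs : Integrable (fun ω => lin N (c+d) ω ^ 2 - lin N c ω ^ 2) P :=
    hcd.1.integrable_sq.sub hc.1.integrable_sq
  rw [integral_div, integral_sub hs hd.1.integrable_sq,
    integral_sub hcd.1.integrable_sq hc.1.integrable_sq, hc.2.2, hd.2.2, hcd.2.2]
  rw [QQ_add_left, QQ_add_right, QQ_add_right, QQ_comm N d c]; ring

lemma lin_fam_meas {ι : Type*} (N : ℕ) (c : ι → Vtx → ℝ) :
    Measurable (fun ω (i : ι) => lin N (c i) ω) :=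
  measurable_pi_lambda _ fun i => lin_meas N (c i)

lemma gff_fam {ι : Type*} [Fintype ι] {N : ℕ} {P : Measure FieldSp} (h : IsGFF N P)
    (c : ι → Vtx → ℝ) : CG (P.map (fun ω (i : ι) => lin N (c i) ω)) (fun i j => QQ N (c i) (c j)) := by
  have hP := h.1
  refine ⟨Measure.isProbabilityMeasure_map (lin_fam_meas N c).aemeasurable, fun L => ?_, fun v w => ?_⟩
  · rw [Measure.map_map (by fun_prop) (lin_fam_meas N c)]
    refine ⟨(QQ N (∑ i, L (Pi.single i 1) • c i) (∑ i, L (Pi.single i 1) • c i)).toNNReal, ?_⟩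
    · have : (⇑L ∘ fun ω (i : ι) => lin N (c i) ω) = lin N (∑ i, L (Pi.single i 1) • c i) := by
        funext ω
        simp only [Function.comp, lin_sum, lin_smul]
        conv_lhs => rw [show (fun i => lin N (c i) ω) = ∑ i, (lin N (c i) ω) • (Pi.single i (1:ℝ) : ι → ℝ) by
          ext j; simp [Finset.sum_apply, Pi.single_apply]]
        rw [map_sum]
        simp [mul_comm]
      rw [this, gff_lin h]
  · rw [integral_map (lin_fam_meas N c).aemeasurable]
    · exact gff_cov h _ _
    · exact ((measurable_pi_apply v).mul (measurable_pi_apply w)).aestronglyMeasurable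

lemma CG.gauss {V : Type*} [Fintype V] {μ : Measure (V → ℝ)} {C : V → V → ℝ} (h : CG μ C) :
    IsGaussian μ :=
  isGaussian_of_map_eq_gaussianReal fun L => ⟨0, h.2.1 L⟩

lemma CG.dual_zero {V : Type*} [Fintype V] {μ : Measure (V → ℝ)} {C : V → V → ℝ} (h : CG μ C)
    (L : (V → ℝ) →L[ℝ] ℝ) : ∫ x, L x ∂μ = 0 := by
  obtain ⟨s, hs⟩ := h.2.1 L
  rw [← integral_map (φ := L) (f := fun x => x) (by fun_prop) (by fun_prop), hs]
  exact integral_id_gaussianReal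

lemma cf_meas {N : ℕ} {lam : ℝ} {v : Vtx} :
    Measurable[scaleAlg N lam v] (lin N (cf (nbhd N lam v) v)) := by
  have : ∀ w ∈ VN N, Measurable[scaleAlg N lam v]
      (fun ω : FieldSp => cf (nbhd N lam v) v w * ω w) := by
    intro w hw
    by_cases hw' : w ∈ intr (nbhd N lam v)
    · simp only [cf_intr hw', zero_mul]; exact measurable_const
    · have h1 : MeasurableSpace.comap (fun ω : FieldSp => ω w) inferInstance ≤ scaleAlg N lam v :=
        le_iSup₂_of_le (f := fun w _ => MeasurableSpace.comap (fun ω : FieldSp => ω w) inferInstance)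
          w ⟨hw, hw'⟩ le_rfl
      have h2 : Measurable[scaleAlg N lam v] (fun ω : FieldSp => ω w) :=
        measurable_iff_comap_le.2 h1
      exact h2.const_mul _
  unfold lin
  exact Finset.measurable_sum _ fun w hw => this w hw

lemma scaleAlg_le (N : ℕ) (lam : ℝ) (v : Vtx) :
    scaleAlg N lam v ≤ (inferInstance : MeasurableSpace FieldSp) :=
  iSup₂_le fun w _ => measurable_iff_comap_le.1 (measurable_pi_apply w)

lemma phi_eq {N : ℕ} {P : Measure FieldSp} (h : IsGFF N P) {v : Vtx} (hv : v ∈ VN N) (lam : ℝ) :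
    phiScale N P v lam =ᵐ[P] lin N (cf (nbhd N lam v) v) := by
  have hP := h.1
  set B := nbhd N lam v with hBdef
  have hvB : v ∈ B := self_mem_nbhd N lam hv
  have hB : B ⊆ VN N := nbhd_subset N lam hv
  let W := {w : Vtx // w ∈ VN N ∧ w ∉ intr B}
  have hWf : Finite W := Set.Finite.subset (VN N).finite_toSet (t := {w | w ∈ VN N ∧ w ∉ intr B})
    fun w hw => hw.1
  have := Fintype.ofFinite W
  -- joint family
  let r : Vtx → ℝ := dl v - cf B v
  have hG : HasGaussianLaw (fun ω => (fun (_ : Unit) => lin N r ω, fun (w : W) => lin N (dl w.1) ω)) P := by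
    have h1 := gff_fam h (fun i : Unit ⊕ W => Sum.elim (fun _ => r) (fun w => dl w.1) i)
    have h2 := h1.gauss
    have h3 : HasGaussianLaw (fun ω (i : Unit ⊕ W) =>
      lin N (Sum.elim (fun _ => r) (fun w => dl w.1) i) ω) P := ⟨h2⟩
    let L : ((Unit ⊕ W) → ℝ) →L[ℝ] (Unit → ℝ) × (W → ℝ) :=
      (ContinuousLinearMap.pi fun u => ContinuousLinearMap.proj (Sum.inl u)).prod
      (ContinuousLinearMap.pi fun w => ContinuousLinearMap.proj (Sum.inr w))
    exact h3.map_fun L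
  have hind := HasGaussianLaw.indepFun_of_covariance_eval (X := fun _ ω => lin N r ω)
    (Y := fun (w : W) ω => lin N (dl w.1) ω) hG (by
    intro _ w
    rw [covariance_eq_sub (gff_sq h _).1 (gff_sq h _).1, (gff_sq h r).2.1, zero_mul, sub_zero]
    have := gff_cov h r (dl w.1)
    simp only [Pi.mul_apply]
    rw [this, QQ_sub_left, QQ_dl_dl hv w.2.1, QQ_cf_dl hv hB w.2.1, Gr_zero_right w.2.2]; ring)
  have hind' : Indep (MeasurableSpace.comap (lin N r) inferInstance) (scaleAlg N lam v) P := by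
    have h1 : IndepFun (lin N r) (fun ω (w : W) => lin N (dl w.1) ω) P :=
      hind.comp (φ := fun x : Unit → ℝ => x ()) (ψ := id) (measurable_pi_apply _) measurable_id
    rw [IndepFun_iff_Indep] at h1
    refine indep_of_indep_of_le_right h1 ?_
    refine iSup₂_le fun w hw => ?_
    have : (fun ω : FieldSp => ω w) = (fun x : W → ℝ => x ⟨w, hw⟩) ∘
        (fun ω (w : W) => lin N (dl w.1) ω) := by
      funext ω; simp [lin_dl hw.1]
    rw [this, ← MeasurableSpace.comap_comp]
    exact MeasurableSpace.comap_mono (measurable_iff_comap_le.1 (measurable_pi_apply _))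
  have hce := condExp_indep_eq (f := lin N r) (μ := P)
    (measurable_iff_comap_le.1 (lin_meas N r)) (scaleAlg_le N lam v)
    (comap_measurable _).stronglyMeasurable hind'
  have hi1 := (gff_sq h r).1.integrable (by norm_num)
  have hi2 := (gff_sq h (cf B v)).1.integrable (by norm_num)
  have hsum : (fun ω : FieldSp => ω v) = lin N r + lin N (cf B v) := by
    funext ω; simp [r, lin_sub, lin_dl hv]
  unfold phiScale
  rw [hsum]
  have h4 : P[lin N (cf B v) | scaleAlg N lam v] = lin N (cf B v) :=
    condExp_of_stronglyMeasurable (scaleAlg_le N lam v) cf_meas.stronglyMeasurable hi2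
  filter_upwards [condExp_add hi1 hi2 (scaleAlg N lam v), hce] with ω h5 h6
  rw [h5, Pi.add_apply, h6, h4, (gff_sq h r).2.1, zero_add]

/-- coefficients of psi -/
noncomputable def gg (N M : ℕ) (sigv lamv : ℕ → ℝ) (v : Vtx) : Vtx → ℝ :=
  ∑ i ∈ Finset.Icc 1 M, sigv i • (cf (nbhd N (lamv i) v) v - cf (nbhd N (lamv (i-1)) v) v)

lemma psi_eq {N : ℕ} {P : Measure FieldSp} (h : IsGFF N P) {v : Vtx} (hv : v ∈ VN N)
    (M : ℕ) (sigv lamv : ℕ → ℝ) :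
    psiFld N M sigv lamv P v =ᵐ[P] lin N (gg N M sigv lamv v) := by
  have h1 : ∀ i : ℕ, ∀ᵐ ω ∂P, phiScale N P v (lamv i) ω = lin N (cf (nbhd N (lamv i) v) v) ω :=
    fun i => phi_eq h hv (lamv i)
  filter_upwards [ae_all_iff.2 h1] with ω hω
  simp only [psiFld, gg, lin_sum, lin_smul, lin_sub, hω]

lemma psi_all {N : ℕ} {P : Measure FieldSp} (h : IsGFF N P) (M : ℕ) (sigv lamv : ℕ → ℝ) :
    ∀ᵐ ω ∂P, ∀ v ∈ VN N, psiFld N M sigv lamv P v ω = lin N (gg N M sigv lamv v) ω := by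
  refine (ae_ball_iff (S := (VN N : Set Vtx)) (Finset.countable_toSet _)).2 ?_
  exact fun v hv => psi_eq h hv M sigv lamv

lemma nbhd_dist {N : ℕ} {lam : ℝ} {v z : Vtx} (hl : lam ≠ 0) (hz : z ∈ nbhd N lam v) :
    |(z.1:ℝ) - v.1| ≤ (N:ℝ) ^ (1 - lam) / 2 ∧ |(z.2:ℝ) - v.2| ≤ (N:ℝ) ^ (1 - lam) / 2 := by
  unfold nbhd at hz
  rw [if_neg hl] at hz
  split_ifs at hz with h
  · rw [Finset.mem_singleton] at hz
    subst hz; simp; positivity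
  · rw [Finset.mem_filter] at hz; exact hz.2

lemma nbhd_sub {N : ℕ} {lam mu d : ℝ} {v w : Vtx} (hw : w ∈ VN N) (hl : lam ≠ 1) (hm : mu ≠ 0)
    (h1 : |(w.1:ℝ) - v.1| ≤ d) (h2 : |(w.2:ℝ) - v.2| ≤ d)
    (hd : (N:ℝ) ^ (1 - mu) / 2 + d ≤ (N:ℝ) ^ (1 - lam) / 2) : nbhd N mu w ⊆ nbhd N lam v := by
  intro z hz
  have := nbhd_dist hm hz
  refine nbhd_mem hl (nbhd_subset N mu hw hz) ?_ ?_
  · calc |(z.1:ℝ) - v.1| ≤ |(z.1:ℝ) - w.1| + |(w.1:ℝ) - v.1| := abs_sub_le _ _ _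
      _ ≤ _ := by linarith
  · calc |(z.2:ℝ) - v.2| ≤ |(z.2:ℝ) - w.2| + |(w.2:ℝ) - v.2| := abs_sub_le _ _ _
      _ ≤ _ := by linarith

lemma nbhd_mono {N : ℕ} (hN : 1 ≤ N) {lam lam' : ℝ} {v : Vtx} (hv : v ∈ VN N) (h0 : 0 ≤ lam) (h : lam ≤ lam')
    (h1 : lam' ≤ 1) : nbhd N lam' v ⊆ nbhd N lam v := by
  have hN1 : (1:ℝ) ≤ N := by exact_mod_cast hN
  by_cases hl0 : lam = 0
  · intro z hz
    have := nbhd_subset N lam' hv hz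
    rw [hl0]; unfold nbhd; simpa using this
  by_cases hl1 : lam = 1
  · rw [show lam' = 1 by linarith, hl1]
  have : 0 < lam := lt_of_le_of_ne h0 (Ne.symm hl0)
  refine nbhd_sub (d := 0) hv hl1 (by linarith) (by simp) (by simp) ?_
  have := Real.rpow_le_rpow_of_exponent_le hN1 (show 1 - lam' ≤ 1 - lam by linarith)
  linarith

noncomputable def kk (N : ℕ) (v : Vtx) (lam : ℝ) (w : Vtx) (mu : ℝ) : ℝ :=
  QQ N (cf (nbhd N lam v) v) (cf (nbhd N mu w) w)

lemma kk_comm (N : ℕ) (v : Vtx) (lam : ℝ) (w : Vtx) (mu : ℝ) : kk N v lam w mu = kk N w mu v lam :=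
  QQ_comm _ _ _

lemma nbhd_zero (N : ℕ) (v : Vtx) : nbhd N 0 v = VN N := by simp [nbhd]

lemma dd_le {N : ℕ} (hN : 1 ≤ N) {v : Vtx} (hv : v ∈ VN N) : dd N v ≤ N := by
  have := mem_VN.1 hv
  refine max_le (by exact_mod_cast hN) ?_
  have : (min (min v.1 (N - v.1)) (min v.2 (N - v.2))) ≤ (N:ℤ) := by omega
  exact_mod_cast this

lemma nrm_le_N {N : ℕ} (hN : 1 ≤ N) {v w : Vtx} (hv : v ∈ VN N) (hw : w ∈ VN N) : nrm (v - w) ≤ N := by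
  have hv' := mem_VN.1 hv
  have hw' := mem_VN.1 hw
  refine nrm_le (by exact_mod_cast hN) ?_ ?_
  · have : |v.1 - w.1| ≤ (N:ℤ) := by simp only [abs_eq_max_neg]; omega
    simpa using (by exact_mod_cast this : |((v.1 - w.1 : ℤ):ℝ)| ≤ N)
  · have : |v.2 - w.2| ≤ (N:ℤ) := by simp only [abs_eq_max_neg]; omega
    simpa using (by exact_mod_cast this : |((v.2 - w.2 : ℤ):ℝ)| ≤ N)

lemma nrm_self (v : Vtx) : nrm (v - v) = 1 := by simp [nrm]

lemma target_id (δ l n : ℝ) : max 0 (δ - n) - max 0 (min l δ - n) = max 0 (δ - max l n) := by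
  grind

section
variable {C : ℝ} (hC : 0 < C) (hgr : ∀ N : ℕ, 2 ≤ N → ∀ lam ∈ Set.Icc (0:ℝ) 1, ∀ v ∈ VN N, ∀ w ∈ VN N,
    |Gr (nbhd N lam v) v w - max 0 (min ((1 - lam) * Real.log N) (Real.log (dd N v))
      - Real.log (nrm (v - w)))| ≤ C)
include hC hgr

lemma gr_VN {N : ℕ} (hN : 2 ≤ N) {v w : Vtx} (hv : v ∈ VN N) (hw : w ∈ VN N) :
    |Gr (VN N) v w - max 0 (Real.log (dd N v) - Real.log (nrm (v - w)))| ≤ C := by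
  have := hgr N hN 0 (by simp) v hv w hw
  rw [nbhd_zero, sub_zero, one_mul, min_eq_right] at this
  · exact this
  · exact Real.log_le_log (by linarith [one_le_dd N v]) (dd_le (by omega) hv)

lemma kk_var {N : ℕ} (hN : 2 ≤ N) {lam : ℝ} (hl : lam ∈ Set.Icc (0:ℝ) 1) {v : Vtx} (hv : v ∈ VN N) :
    kk N v lam v lam ≤ Real.log N + 2 * C := by
  have h1 := hgr N hN lam hl v hv v hv
  have h2 := gr_VN hC hgr hN hv hv
  have h3 : Real.log (dd N v) ≤ Real.log N := Real.log_le_log (by linarith [one_le_dd N v]) (dd_le (by omega) hv)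
  have h4 : 0 ≤ Real.log (dd N v) := Real.log_nonneg (one_le_dd N v)
  unfold kk
  rw [QQ_cf_nested hv hv (nbhd_subset N lam hv) (fun _ h => h)]
  rw [nrm_self, Real.log_one, sub_zero] at h1 h2
  rw [max_eq_right h4] at h2
  rw [abs_le] at h1 h2
  have := le_max_left 0 (min ((1 - lam) * Real.log N) (Real.log (dd N v)))
  linarith

lemma kk_incr {N : ℕ} (hN : 2 ≤ N) {lam lam' : ℝ} (h0 : 0 ≤ lam) (h : lam ≤ lam') (h1 : lam' ≤ 1)
    {v : Vtx} (hv : v ∈ VN N) :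
    QQ N (cf (nbhd N lam' v) v - cf (nbhd N lam v) v) (cf (nbhd N lam' v) v - cf (nbhd N lam v) v)
      ≤ (lam' - lam) * Real.log N + 2 * C := by
  have e1 := hgr N hN lam ⟨h0, by linarith⟩ v hv v hv
  have e2 := hgr N hN lam' ⟨by linarith, h1⟩ v hv v hv
  have hL : 0 ≤ Real.log N := Real.log_nonneg (by exact_mod_cast (by omega : 1 ≤ N))
  rw [QQ_sub_left, QQ_sub_right, QQ_sub_right, QQ_comm N (cf (nbhd N lam' v) v) (cf (nbhd N lam v) v),
    QQ_cf_nested hv hv (nbhd_subset N lam hv) (fun _ h => h),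
    QQ_cf_nested hv hv (nbhd_subset N lam hv) (nbhd_mono (by omega) hv h0 h h1),
    QQ_cf_nested hv hv (nbhd_subset N lam' hv) (fun _ h => h)]
  rw [nrm_self, Real.log_one, sub_zero, abs_le] at e1 e2
  have h4 : 0 ≤ Real.log (dd N v) := Real.log_nonneg (one_le_dd N v)
  have h5 : (1 - lam') * Real.log N ≤ (1 - lam) * Real.log N := by nlinarith
  have h6 : 0 ≤ (1 - lam') * Real.log N := by nlinarith
  rw [max_eq_right (le_min (by linarith) h4)] at e1
  rw [max_eq_right (le_min h6 h4)] at e2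
  have : min ((1 - lam) * Real.log N) (Real.log (dd N v)) -
      min ((1 - lam') * Real.log N) (Real.log (dd N v)) ≤ (lam' - lam) * Real.log N := by
    rcases le_total ((1 - lam') * Real.log N) (Real.log (dd N v)) with h | h
    · rw [min_eq_left h]; have := min_le_left ((1 - lam) * Real.log N) (Real.log (dd N v)); linarith
    · rw [min_eq_right h]; have := min_le_right ((1 - lam) * Real.log N) (Real.log (dd N v))
      nlinarith
  linarith

lemma kk_pert {N : ℕ} (hN : 2 ≤ N) {lam lam' mu : ℝ} (h0 : 0 ≤ lam) (h : lam ≤ lam') (h1 : lam' ≤ 1)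
    (hm : mu ∈ Set.Icc (0:ℝ) 1) {v w : Vtx} (hv : v ∈ VN N) (hw : w ∈ VN N) :
    |kk N v lam' w mu - kk N v lam w mu| ≤
      Real.sqrt (((lam' - lam) * Real.log N + 2 * C) * (Real.log N + 2 * C)) := by
  have hL : 0 ≤ Real.log N := Real.log_nonneg (by exact_mod_cast (by omega : 1 ≤ N))
  apply Real.abs_le_sqrt
  unfold kk
  rw [← QQ_sub_left]
  refine (QQ_cs _ _ _).trans (mul_le_mul (kk_incr hC hgr hN h0 h h1 hv) (kk_var hC hgr hN hm hw)
    (QQ_nonneg _ _) ?_)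
  nlinarith

lemma kk_nested {N : ℕ} (hN : 2 ≤ N) {lam mu : ℝ} (h0 : 0 ≤ lam) (h : lam ≤ mu) (h1 : mu ≤ 1)
    {v w : Vtx} (hv : v ∈ VN N) (hw : w ∈ VN N) (hs : nbhd N mu w ⊆ nbhd N lam v) :
    |kk N v lam w mu - max 0 (Real.log (dd N v) - max (max ((1 - lam) * Real.log N) ((1 - mu) * Real.log N))
      (Real.log (nrm (v - w))))| ≤ 2 * C := by
  have hL : 0 ≤ Real.log N := Real.log_nonneg (by exact_mod_cast (by omega : 1 ≤ N))
  rw [max_eq_left (show (1 - mu) * Real.log N ≤ (1 - lam) * Real.log N by nlinarith), ← target_id]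
  unfold kk
  rw [QQ_cf_nested hv hw (nbhd_subset N lam hv) hs]
  have e1 := hgr N hN lam ⟨h0, by linarith⟩ v hv w hw
  have e2 := gr_VN hC hgr hN hv hw
  rw [abs_le] at *
  constructor <;> linarith

lemma kk_disj {N : ℕ} (hN : 2 ≤ N) {lam mu : ℝ} {v w : Vtx} (hv : v ∈ VN N) (hw : w ∈ VN N)
    (hs : Disjoint (nbhd N lam v) (nbhd N mu w)) (hl : (1 - lam) * Real.log N ≤ Real.log (nrm (v - w)))
    (hm : (1 - mu) * Real.log N ≤ Real.log (nrm (v - w))) :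
    |kk N v lam w mu - max 0 (Real.log (dd N v) - max (max ((1 - lam) * Real.log N) ((1 - mu) * Real.log N))
      (Real.log (nrm (v - w))))| ≤ 2 * C := by
  rw [max_eq_right (max_le hl hm)]
  unfold kk
  rw [QQ_cf_disj (self_mem_nbhd N lam hv) (self_mem_nbhd N mu hw) (nbhd_subset N lam hv)
    (nbhd_subset N mu hw) hs]
  have e2 := gr_VN hC hgr hN hv hw
  linarith

omit hC hgr in
lemma T_lip (δ x y n x' y' e : ℝ) (hx : |x' - x| ≤ e) (hy : |y' - y| ≤ e) :
    |max 0 (δ - max (max x y) n) - max 0 (δ - max (max x' y') n)| ≤ e := by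
  have h1 := abs_max_sub_max_le_max x y x' y'
  have h2 := abs_max_sub_max_le_max (max x y) n (max x' y') n
  have h3 := abs_max_sub_max_le_max 0 (δ - max (max x y) n) 0 (δ - max (max x' y') n)
  have e0 : 0 ≤ e := (abs_nonneg _).trans hx
  have h1' : |max x y - max x' y'| ≤ e := h1.trans (max_le (by rw [abs_sub_comm]; exact hx) (by rw [abs_sub_comm]; exact hy))
  have h2' : |max (max x y) n - max (max x' y') n| ≤ e := h2.trans (max_le h1' (by simpa))
  refine h3.trans (max_le (by simpa) ?_)
  rw [show δ - max (max x y) n - (δ - max (max x' y') n) = -(max (max x y) n - max (max x' y') n) by ring,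
    abs_neg]
  exact h2'

lemma kk_est_aux {N : ℕ} (hN : 2 ≤ N) {ε : ℝ} (hε : 0 < ε) (hε1 : ε ≤ 1) (hNe : 3 ≤ (N:ℝ) ^ ε)
    (hCe : 2 * C ≤ ε * Real.log N) {lam mu : ℝ} (h0 : 0 ≤ lam) (h : lam ≤ mu) (h1 : mu ≤ 1)
    {v w : Vtx} (hv : v ∈ VN N) (hw : w ∈ VN N) :
    |kk N v lam w mu - max 0 (Real.log (dd N v) - max (max ((1 - lam) * Real.log N) ((1 - mu) * Real.log N))
      (Real.log (nrm (v - w))))| ≤ 9 * Real.sqrt ε * Real.log N := by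
  set L := Real.log N with hLdef
  have hN1 : (1:ℝ) < N := by exact_mod_cast (by omega : 1 < N)
  have hN0 : (0:ℝ) < N := by linarith
  have hL : 0 < L := Real.log_pos hN1
  have hse : ε ≤ Real.sqrt ε := by
    rw [Real.le_sqrt hε.le hε.le]; nlinarith
  have key : ∀ t : ℝ, 0 ≤ t → t ≤ 2 * ε →
      Real.sqrt ((t * L + 2 * C) * (L + 2 * C)) ≤ 3 * Real.sqrt ε * L := by
    intro t ht0 ht
    rw [Real.sqrt_le_left (by positivity)]
    have h1 : t * L + 2 * C ≤ 3 * ε * L := by nlinarith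
    have h2 : L + 2 * C ≤ 2 * L := by nlinarith
    calc (t * L + 2 * C) * (L + 2 * C) ≤ (3 * ε * L) * (2 * L) :=
          mul_le_mul h1 h2 (by positivity) (by positivity)
      _ ≤ (3 * Real.sqrt ε * L) ^ 2 := by
          rw [mul_pow, mul_pow, Real.sq_sqrt hε.le]; nlinarith [mul_pos hε (pow_pos hL 2)]
  -- reduction
  suffices H : ∃ lam' mu', lam ≤ lam' ∧ lam' ≤ 1 ∧ lam' ≤ lam + 2 * ε ∧ mu ≤ mu' ∧ mu' ≤ 1 ∧
      mu' ≤ mu + 2 * ε ∧ |kk N v lam' w mu' - max 0 (Real.log (dd N v) -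
        max (max ((1 - lam') * L) ((1 - mu') * L)) (Real.log (nrm (v - w))))| ≤ 2 * C by
    obtain ⟨lam', mu', a1, a2, a3, b1, b2, b3, H⟩ := H
    have p1 := (kk_pert hC hgr hN h0 a1 a2 (mu := mu) ⟨by linarith, h1⟩ hv hw).trans
      (key _ (by linarith) (by linarith))
    have p2 := (kk_pert hC hgr hN (by linarith) b1 b2 (mu := lam') ⟨by linarith, a2⟩ hw hv).trans
      (key _ (by linarith) (by linarith))
    rw [kk_comm N w, kk_comm N w] at p2
    have p3 := T_lip (Real.log (dd N v)) ((1 - lam') * L) ((1 - mu') * L) (Real.log (nrm (v - w)))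
      ((1 - lam) * L) ((1 - mu) * L) (2 * ε * L) (by rw [abs_le]; constructor <;> nlinarith)
      (by rw [abs_le]; constructor <;> nlinarith)
    have hq : ε * L ≤ Real.sqrt ε * L := by nlinarith
    rw [abs_le] at *
    constructor <;> linarith
  -- the geometric part
  set n := nrm (v - w) with hn
  have hn1 : 1 ≤ n := one_le_nrm _
  have hnN : n ≤ N := nrm_le_N (by omega) hv hw
  have hd1 : |(w.1:ℝ) - v.1| ≤ n := by
    have := nrm_ge1 (v - w); simp only [Prod.fst_sub, Int.cast_sub] at this; rwa [abs_sub_comm]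
  have hd2 : |(w.2:ℝ) - v.2| ≤ n := by
    have := nrm_ge2 (v - w); simp only [Prod.snd_sub, Int.cast_sub] at this; rwa [abs_sub_comm]
  set b := 1 - Real.log n / L with hb
  have hbL : (1 - b) * L = Real.log n := by rw [hb]; field_simp; ring
  have hln : 0 ≤ Real.log n := Real.log_nonneg hn1
  have hlnL : Real.log n ≤ L := Real.log_le_log (by linarith) hnN
  have hb0 : 0 ≤ b := by rw [hb]; have := (div_le_one hL).2 hlnL; linarith
  have hb1 : b ≤ 1 := by rw [hb]; have : 0 ≤ Real.log n / L := by positivity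
                         linarith
  have hnb : n = (N:ℝ) ^ (1 - b) := by
    rw [Real.rpow_def_of_pos hN0, mul_comm, hbL, Real.exp_log (by linarith)]
  by_cases hcase : lam + ε ≤ b
  · refine ⟨lam, max mu (lam + ε), le_rfl, by linarith, by linarith, le_max_left _ _,
      max_le h1 (by linarith), max_le (by linarith) (by linarith), ?_⟩
    refine kk_nested hC hgr hN h0 (h.trans (le_max_left _ _)) (max_le h1 (by linarith)) hv hw ?_
    have hm' : lam + ε ≤ max mu (lam + ε) := le_max_right _ _
    refine nbhd_sub hw (by linarith) (by linarith) hd1 hd2 ?_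
    have e1 : (N:ℝ) ^ (1 - max mu (lam + ε)) ≤ (N:ℝ) ^ (1 - lam - ε) :=
      Real.rpow_le_rpow_of_exponent_le hN1.le (by linarith)
    have e2 : n ≤ (N:ℝ) ^ (1 - lam - ε) := by
      rw [hnb]; exact Real.rpow_le_rpow_of_exponent_le hN1.le (by linarith)
    have e3 : (N:ℝ) ^ (1 - lam) = (N:ℝ) ^ (1 - lam - ε) * (N:ℝ) ^ ε := by
      rw [← Real.rpow_add hN0]; congr 1; ring
    have e4 : 0 < (N:ℝ) ^ (1 - lam - ε) := Real.rpow_pos_of_pos hN0 _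
    rw [e3]; nlinarith
  · push Not at hcase
    refine ⟨max lam (min (b + ε) 1), max mu (min (b + ε) 1), le_max_left _ _,
      max_le (by linarith) (min_le_right _ _),
      max_le (by linarith) ((min_le_left _ _).trans (by linarith)), le_max_left _ _,
      max_le (by linarith) (min_le_right _ _),
      max_le (by linarith) ((min_le_left _ _).trans (by linarith)), ?_⟩
    have hA : ∀ x, x ≤ 1 → (1 - max x (min (b + ε) 1)) * L ≤ Real.log n := by
      intro x hx
      rw [← hbL]
      refine mul_le_mul_of_nonneg_right ?_ hL.le
      have : b ≤ min (b + ε) 1 := le_min (by linarith) hb1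
      have := le_max_right x (min (b + ε) 1)
      linarith
    by_cases hbe : 1 ≤ b + ε
    · rw [min_eq_right hbe, max_eq_right (h.trans h1), max_eq_right h1]
      by_cases hvw : v = w
      · refine kk_nested hC hgr hN (by norm_num) le_rfl le_rfl hv hw ?_
        rw [hvw]
      · refine kk_disj hC hgr hN hv hw ?_ (by simpa using hln) (by simpa using hln)
        simp [nbhd, hvw, Ne.symm hvw]
    · push Not at hbe
      refine kk_disj hC hgr hN hv hw ?_ (hA _ (h.trans h1)) (hA _ h1)
      rw [min_eq_left hbe.le, Finset.disjoint_left]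
      intro z hz1 hz2
      have g1 := nbhd_dist (by have := le_max_right lam (b+ε); linarith) hz1
      have g2 := nbhd_dist (by have := le_max_right mu (b+ε); linarith) hz2
      have e1 : (N:ℝ) ^ (1 - max lam (b + ε)) ≤ (N:ℝ) ^ (1 - b - ε) :=
        Real.rpow_le_rpow_of_exponent_le hN1.le (by have := le_max_right lam (b+ε); linarith)
      have e2 : (N:ℝ) ^ (1 - max mu (b + ε)) ≤ (N:ℝ) ^ (1 - b - ε) :=
        Real.rpow_le_rpow_of_exponent_le hN1.le (by have := le_max_right mu (b+ε); linarith)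
      have e3 : n = (N:ℝ) ^ (1 - b - ε) * (N:ℝ) ^ ε := by
        rw [hnb, ← Real.rpow_add hN0]; congr 1; ring
      have e4 : 1 ≤ (N:ℝ) ^ (1 - b - ε) := Real.one_le_rpow hN1.le (by linarith)
      have e5 : n ≤ (N:ℝ) ^ (1 - b - ε) := by
        refine nrm_le e4 ?_ ?_
        · simp only [Prod.fst_sub, Int.cast_sub]
          calc |(v.1:ℝ) - w.1| ≤ |(v.1:ℝ) - z.1| + |(z.1:ℝ) - w.1| := abs_sub_le _ _ _
            _ ≤ _ := by rw [abs_sub_comm (v.1:ℝ)]; linarith [g1.1, g2.1]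
        · simp only [Prod.snd_sub, Int.cast_sub]
          calc |(v.2:ℝ) - w.2| ≤ |(v.2:ℝ) - z.2| + |(z.2:ℝ) - w.2| := abs_sub_le _ _ _
            _ ≤ _ := by rw [abs_sub_comm (v.2:ℝ)]; linarith [g1.2, g2.2]
      nlinarith
end

lemma lam_mono {M : ℕ} {lamv : ℕ → ℝ} (h : ∀ i, i < M → lamv i < lamv (i + 1)) :
    ∀ j i, i ≤ j → j ≤ M → lamv i ≤ lamv j := by
  intro j
  induction j with
  | zero => intro i hi _; rw [Nat.le_zero.1 hi]
  | succ j ih =>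
    intro i hi hj
    rcases Nat.lt_or_ge i (j+1) with h1 | h1
    · exact (ih i (by omega) (by omega)).trans (h j (by omega)).le
    · rw [le_antisymm hi h1]

/-- explicit speed function -/
noncomputable def Jf (M : ℕ) (sigv lamv : ℕ → ℝ) (s : ℝ) : ℝ :=
  ∑ i ∈ Finset.Icc 1 M, sigv i ^ 2 * (min (lamv i) s - min (lamv (i-1)) s)

lemma kk_est : ∀ ε : ℝ, 0 < ε → ∃ N₀ : ℕ, 2 ≤ N₀ ∧ ∀ N ≥ N₀, ∀ κ ρ : ℝ, ∀ v ∈ VN N, ∀ w ∈ VN N,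
    |Real.log (dd N v) - (1 - ρ) * Real.log N| ≤ κ * Real.log N →
    |Real.log (dd N w) - (1 - ρ) * Real.log N| ≤ κ * Real.log N →
    ∀ lam ∈ Set.Icc (0:ℝ) 1, ∀ mu ∈ Set.Icc (0:ℝ) 1,
    |kk N v lam w mu - Real.log N * max 0 (min (min lam mu) (1 - Real.log (nrm (v - w)) / Real.log N) - ρ)|
      ≤ (ε + κ) * Real.log N := by
  intro ε hε
  obtain ⟨C, hC, hgr⟩ := green_est
  obtain ⟨e, he, he1, hee⟩ : ∃ e : ℝ, 0 < e ∧ e ≤ 1 ∧ 9 * Real.sqrt e ≤ ε := by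
    refine ⟨min 1 ((ε/9)^2), by positivity, min_le_left _ _, ?_⟩
    have : Real.sqrt (min 1 ((ε/9)^2)) ≤ ε / 9 := by
      rw [Real.sqrt_le_left (by positivity)]; exact min_le_right _ _
    linarith
  have t1 : Tendsto (fun N : ℕ => (N:ℝ) ^ e) atTop atTop :=
    (tendsto_rpow_atTop he).comp tendsto_natCast_atTop_atTop
  have t2 : Tendsto (fun N : ℕ => e * Real.log N) atTop atTop :=
    (Real.tendsto_log_atTop.comp tendsto_natCast_atTop_atTop).const_mul_atTop he
  obtain ⟨N₁, hN₁⟩ := eventually_atTop.1 ((t1.eventually_ge_atTop 3).and (t2.eventually_ge_atTop (2 * C)))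
  refine ⟨max N₁ 2, le_max_right _ _, fun N hN κ ρ v hv w hw hdv hdw lam hl mu hm => ?_⟩
  have hN2 : 2 ≤ N := (le_max_right _ _).trans hN
  have hN1 := hN₁ N ((le_max_left _ _).trans hN)
  have hL : 0 < Real.log N := Real.log_pos (by exact_mod_cast (by omega : 1 < N))
  -- general form
  have gen : ∀ v ∈ VN N, ∀ w ∈ VN N, |Real.log (dd N v) - (1 - ρ) * Real.log N| ≤ κ * Real.log N →
      ∀ lam ∈ Set.Icc (0:ℝ) 1, ∀ mu ∈ Set.Icc (0:ℝ) 1, lam ≤ mu →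
      |kk N v lam w mu - Real.log N * max 0 (min (min lam mu) (1 - Real.log (nrm (v - w)) / Real.log N) - ρ)|
      ≤ (ε + κ) * Real.log N := by
    intro v hv w hw hdv lam hl mu hm hlm
    have h1 := kk_est_aux hC hgr hN2 he he1 hN1.1 hN1.2 hl.1 hlm hm.2 hv hw
    have h2 : 9 * Real.sqrt e * Real.log N ≤ ε * Real.log N := by nlinarith
    have h3 : Real.log N * max 0 (min (min lam mu) (1 - Real.log (nrm (v - w)) / Real.log N) - ρ) =
        max 0 ((1 - ρ) * Real.log N - max (max ((1 - lam) * Real.log N) ((1 - mu) * Real.log N))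
          (Real.log (nrm (v - w)))) := by
      set b := Real.log (nrm (v - w)) / Real.log N with hb
      have : Real.log (nrm (v - w)) = b * Real.log N := by rw [hb]; field_simp
      have e1 : max (max ((1 - lam) * Real.log N) ((1 - mu) * Real.log N)) (b * Real.log N) =
          max (1 - lam) b * Real.log N := by
        rw [max_eq_left (show (1 - mu) * Real.log N ≤ (1 - lam) * Real.log N by nlinarith),
          max_mul_of_nonneg _ _ hL.le]
      rw [this, min_eq_left hlm, e1, ← sub_mul, mul_comm, max_mul_of_nonneg _ _ hL.le, zero_mul]
      congr 2
      grind
    rw [h3]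
    have h4 := abs_max_sub_max_le_max 0 (Real.log (dd N v) - max (max ((1 - lam) * Real.log N)
      ((1 - mu) * Real.log N)) (Real.log (nrm (v - w)))) 0 ((1 - ρ) * Real.log N -
        max (max ((1 - lam) * Real.log N) ((1 - mu) * Real.log N)) (Real.log (nrm (v - w))))
    rw [sub_sub_sub_cancel_right, sub_self, abs_zero, max_eq_right (a := (0:ℝ)) (b := |_|) (abs_nonneg _)] at h4
    replace h4 := h4.trans hdv
    rw [abs_le] at *
    constructor <;> linarith
  rcases le_total lam mu with h | h
  · exact gen v hv w hw hdv lam hl mu hm h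
  · have := gen w hw v hv hdw mu hm lam hl h
    rwa [kk_comm, min_comm mu lam, nrm_symm] at this

lemma hh_id (x b ρ : ℝ) : max 0 (min x b - ρ) = min x (max b ρ) - min x ρ := by grind

lemma cov_est {M : ℕ} {sigv lamv : ℕ → ℝ} (hp : ScaleParams M sigv lamv) :
    ∃ S : ℝ, 0 < S ∧ ∀ ε : ℝ, 0 < ε → ∃ N₀ : ℕ, 2 ≤ N₀ ∧ ∀ N ≥ N₀, ∀ κ ρ : ℝ, ∀ v ∈ VN N, ∀ w ∈ VN N,
    |Real.log (dd N v) - (1 - ρ) * Real.log N| ≤ κ * Real.log N →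
    |Real.log (dd N w) - (1 - ρ) * Real.log N| ≤ κ * Real.log N →
    |QQ N (gg N M sigv lamv v) (gg N M sigv lamv w) - Real.log N *
      (Jf M sigv lamv (max (1 - Real.log (nrm (v - w)) / Real.log N) ρ) - Jf M sigv lamv ρ)|
      ≤ (ε + S * κ) * Real.log N := by
  obtain ⟨hM, hpos, hl0, hlM, hinc⟩ := hp
  have hmono := lam_mono hinc
  have hmem : ∀ i ≤ M, lamv i ∈ Set.Icc (0:ℝ) 1 := fun i hi =>
    ⟨hl0 ▸ hmono i 0 (by omega) hi, hlM ▸ hmono M i hi le_rfl⟩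
  set S0 := ∑ i ∈ Finset.Icc 1 M, sigv i with hS0
  have hS0p : 0 < S0 := Finset.sum_pos hpos ⟨1, by simp; omega⟩
  refine ⟨4 * S0 ^ 2, by positivity, fun ε hε => ?_⟩
  obtain ⟨N₀, hN2, hN₀⟩ := kk_est (ε / (4 * S0 ^ 2)) (by positivity)
  refine ⟨N₀, hN2, fun N hN κ ρ v hv w hw hdv hdw => ?_⟩
  have hk := hN₀ N hN κ ρ v hv w hw hdv hdw
  set L := Real.log N
  set b := 1 - Real.log (nrm (v - w)) / L
  set T : ℝ → ℝ → ℝ := fun x y => L * max 0 (min (min x y) b - ρ) with hT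
  set E := (ε / (4 * S0 ^ 2) + κ) * L with hE
  have h1 : QQ N (gg N M sigv lamv v) (gg N M sigv lamv w) =
      ∑ i ∈ Finset.Icc 1 M, ∑ j ∈ Finset.Icc 1 M, sigv i * sigv j *
        (kk N v (lamv i) w (lamv j) - kk N v (lamv i) w (lamv (j-1))
          - (kk N v (lamv (i-1)) w (lamv j) - kk N v (lamv (i-1)) w (lamv (j-1)))) := by
    unfold gg kk
    rw [QQ_sum_left]
    refine Finset.sum_congr rfl fun i _ => ?_
    rw [QQ_sum_right]
    refine Finset.sum_congr rfl fun j _ => ?_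
    rw [QQ_smul_left, QQ_smul_right, QQ_sub_left, QQ_sub_right, QQ_sub_right]
    ring
  have h2 : L * (Jf M sigv lamv (max b ρ) - Jf M sigv lamv ρ) =
      ∑ i ∈ Finset.Icc 1 M, ∑ j ∈ Finset.Icc 1 M, sigv i * sigv j *
        (T (lamv i) (lamv j) - T (lamv i) (lamv (j-1))
          - (T (lamv (i-1)) (lamv j) - T (lamv (i-1)) (lamv (j-1)))) := by
    unfold Jf
    rw [← Finset.sum_sub_distrib, Finset.mul_sum]
    refine Finset.sum_congr rfl fun i hi => ?_
    rw [Finset.mem_Icc] at hi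
    rw [Finset.sum_eq_single i]
    · have : lamv (i-1) ≤ lamv i := hmono i (i-1) (by omega) hi.2
      simp only [hT, min_self, min_eq_left this, min_eq_right this, hh_id]
      ring
    · intro j hj hij
      rw [Finset.mem_Icc] at hj
      rcases Nat.lt_or_gt_of_ne hij with h | h
      · have a1 : lamv j ≤ lamv i := hmono i j (by omega) hi.2
        have a2 : lamv (j-1) ≤ lamv i := hmono i (j-1) (by omega) hi.2
        have a3 : lamv j ≤ lamv (i-1) := hmono (i-1) j (by omega) (by omega)
        have a4 : lamv (j-1) ≤ lamv (i-1) := hmono (i-1) (j-1) (by omega) (by omega)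
        simp only [hT, min_eq_right a1, min_eq_right a2, min_eq_right a3, min_eq_right a4]; ring
      · have a1 : lamv i ≤ lamv j := hmono j i (by omega) hj.2
        have a2 : lamv (i-1) ≤ lamv j := hmono j (i-1) (by omega) hj.2
        have a3 : lamv i ≤ lamv (j-1) := hmono (j-1) i (by omega) (by omega)
        have a4 : lamv (i-1) ≤ lamv (j-1) := hmono (j-1) (i-1) (by omega) (by omega)
        simp only [hT, min_eq_left a1, min_eq_left a2, min_eq_left a3, min_eq_left a4]; ring
    · intro h; exact absurd (Finset.mem_Icc.2 hi) h
  have hEE : (ε + 4 * S0 ^ 2 * κ) * L = ∑ i ∈ Finset.Icc 1 M, ∑ j ∈ Finset.Icc 1 M, sigv i * sigv j * (4 * E) := by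
    simp_rw [← Finset.sum_mul, ← Finset.mul_sum, ← Finset.sum_mul]
    rw [← hS0, hE]; field_simp
  rw [h1, h2, hEE, ← Finset.sum_sub_distrib]
  refine (Finset.abs_sum_le_sum_abs _ _).trans (Finset.sum_le_sum fun i hi => ?_)
  rw [← Finset.sum_sub_distrib]
  refine (Finset.abs_sum_le_sum_abs _ _).trans (Finset.sum_le_sum fun j hj => ?_)
  have hsi := hpos i hi
  have hsj := hpos j hj
  rw [Finset.mem_Icc] at hi hj
  rw [← mul_sub, abs_mul, abs_of_pos (mul_pos hsi hsj)]
  refine mul_le_mul_of_nonneg_left ?_ (mul_pos hsi hsj).le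
  have k1 := hk _ (hmem i hi.2) _ (hmem j hj.2)
  have k2 := hk _ (hmem i hi.2) _ (hmem (j-1) (by omega))
  have k3 := hk _ (hmem (i-1) (by omega)) _ (hmem j hj.2)
  have k4 := hk _ (hmem (i-1) (by omega)) _ (hmem (j-1) (by omega))
  simp only [hT]
  rw [abs_le] at *
  constructor <;> linarith

lemma exp_tay (y : ℝ) (n : ℕ) :
    |Real.exp y - ∑ m ∈ Finset.range n, y ^ m / m.factorial| ≤ |y| ^ n * Real.exp |y| := by
  have := Complex.norm_exp_sub_sum_le_norm_mul_exp (y:ℂ) n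
  have h2 : Complex.exp y - ∑ m ∈ Finset.range n, (y:ℂ) ^ m / m.factorial =
    ((Real.exp y - ∑ m ∈ Finset.range n, y ^ m / m.factorial : ℝ) : ℂ) := by push_cast; rfl
  rw [h2, Complex.norm_real, Real.norm_eq_abs, Complex.norm_real, Real.norm_eq_abs] at this
  exact this

lemma mvt01 {f f' : ℝ → ℝ} {B : ℝ} (h : ∀ t ∈ Set.Icc (0:ℝ) 1, HasDerivAt f (f' t) t)
    (hB : ∀ t ∈ Set.Icc (0:ℝ) 1, |f' t| ≤ B) {t : ℝ} (ht : t ∈ Set.Icc (0:ℝ) 1) :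
    |f t - f 0| ≤ B := by
  have hB0 : 0 ≤ B := (abs_nonneg _).trans (hB 0 (by simp))
  have := norm_image_sub_le_of_norm_deriv_le_segment' (f := f) (f' := f') (a := 0) (b := 1) (C := B)
    (fun x hx => (h x hx).hasDerivWithinAt) (fun x hx => hB x ⟨hx.1, hx.2.le⟩) t ht
  rw [Real.norm_eq_abs] at this
  nlinarith [ht.2, ht.1]

lemma rpow_tay {r s : ℝ} (hr : 0 < r) (hs : s ≤ 3) :
    |r ^ s - 1 - s * (r - 1) - s * (s - 1) / 2 * (r - 1) ^ 2| ≤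
      |s * (s - 1) * (s - 2)| * |r - 1| ^ 3 * max 1 (r ^ (s - 3)) := by
  set δ := r - 1 with hδ
  have hpos : ∀ t ∈ Set.Icc (0:ℝ) 1, 0 < 1 + t * δ := by
    intro t ht
    have : 1 + t * δ = (1 - t) + t * r := by rw [hδ]; ring
    rw [this]
    rcases lt_or_ge t 1 with h | h
    · have := mul_nonneg ht.1 hr.le; linarith
    · have : t = 1 := le_antisymm ht.2 h
      rw [this]; simpa
  have hd : ∀ e : ℝ, ∀ t ∈ Set.Icc (0:ℝ) 1,
      HasDerivAt (fun t => (1 + t * δ) ^ e) (e * δ * (1 + t * δ) ^ (e - 1)) t := by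
    intro e t ht
    have h1 : HasDerivAt (fun t : ℝ => 1 + t * δ) δ t := by
      simpa using ((hasDerivAt_id t).mul_const δ).const_add 1
    convert! h1.rpow_const (p := e) (Or.inl (hpos t ht).ne') using 1
    ring
  set B := |s * (s - 1) * (s - 2)| * |δ| ^ 3 * max 1 (r ^ (s - 3)) with hBdef
  have h3 : ∀ t ∈ Set.Icc (0:ℝ) 1, |s * (s-1) * (s-2) * δ^3 * (1 + t * δ) ^ (s - 3)| ≤ B := by
    intro t ht
    rw [abs_mul, abs_mul, abs_pow, hBdef]
    refine mul_le_mul_of_nonneg_left ?_ (by positivity)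
    rw [abs_of_pos (Real.rpow_pos_of_pos (hpos t ht) _)]
    rcases le_total 1 r with h | h
    · refine le_max_of_le_left ?_
      refine Real.rpow_le_one_of_one_le_of_nonpos ?_ (by linarith)
      have : 0 ≤ t * δ := mul_nonneg ht.1 (by linarith)
      linarith
    · refine le_max_of_le_right ?_
      refine Real.rpow_le_rpow_of_nonpos hr ?_ (by linarith)
      have : r = 1 + δ := by rw [hδ]; ring
      nlinarith [ht.2]
  have h2 : ∀ t ∈ Set.Icc (0:ℝ) 1, |s * (s-1) * δ^2 * (1 + t * δ) ^ (s - 2) - s * (s-1) * δ^2| ≤ B := by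
    intro t ht
    have := mvt01 (f := fun t => s * (s-1) * δ^2 * (1 + t * δ) ^ (s - 2))
      (f' := fun t => s * (s-1) * (s-2) * δ^3 * (1 + t * δ) ^ (s - 3)) (fun t ht => by
        convert! (hd (s-2) t ht).const_mul (s * (s-1) * δ^2) using 1
        rw [show s - 2 - 1 = s - 3 by ring]; ring) h3 ht
    simpa using this
  have h1 : ∀ t ∈ Set.Icc (0:ℝ) 1, |s * δ * (1 + t * δ) ^ (s - 1) - s * δ - s * (s-1) * δ^2 * t| ≤ B := by
    intro t ht
    have := mvt01 (f := fun t => s * δ * (1 + t * δ) ^ (s - 1) - s * (s-1) * δ^2 * t)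
      (f' := fun t => s * (s-1) * δ^2 * (1 + t * δ) ^ (s - 2) - s * (s-1) * δ^2) (fun t ht => by
        convert! ((hd (s-1) t ht).const_mul (s * δ)).sub ((hasDerivAt_id t).const_mul (s * (s-1) * δ^2)) using 1
        rw [show s - 1 - 1 = s - 2 by ring]; ring) h2 ht
    simp only [zero_mul, add_zero, Real.one_rpow, mul_zero, mul_one, sub_zero] at this
    rw [show s * δ * (1 + t * δ) ^ (s - 1) - s * δ - s * (s-1) * δ^2 * t =
      s * δ * (1 + t * δ) ^ (s - 1) - s * (s - 1) * δ ^ 2 * t - s * δ by ring]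
    exact this
  have := mvt01 (f := fun t => (1 + t * δ) ^ s - s * δ * t - s * (s-1) * δ^2 * t^2 / 2)
      (f' := fun t => s * δ * (1 + t * δ) ^ (s - 1) - s * δ - s * (s-1) * δ^2 * t) (fun t ht => by
        convert! ((hd s t ht).sub ((hasDerivAt_id t).const_mul (s * δ))).sub
          ((((hasDerivAt_id t).pow 2).const_mul (s * (s-1) * δ^2)).div_const 2) using 1
        simp; ring) h1 (t := 1) (by simp)
  simp only [zero_mul, add_zero, Real.one_rpow, mul_zero, mul_one, sub_zero, one_mul, one_pow] at this
  rw [show 1 + δ = r by rw [hδ]; ring] at this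
  refine le_trans (le_of_eq ?_) this
  congr 1; norm_num; ring

/-- pointwise expansion -/
lemma pt_exp {V : Type*} [Fintype V] {p x : V → ℝ} (hp : ∀ v, 0 ≤ p v) (hp1 : ∑ v, p v = 1)
    {β s a : ℝ} (hβ : 0 ≤ β) (hs : s ≤ 1) (ha : 0 ≤ a) (hx : ∀ v, |x v| ≤ a) :
    (∑ v, p v * Real.exp (β * x v)) ^ s ≤ Real.exp (|s| * (β * a)) ∧
    |(∑ v, p v * Real.exp (β * x v)) ^ s - 1 - s * β * ∑ v, p v * x v
      - β ^ 2 / 2 * (s * ∑ v, p v * x v ^ 2 + s * (s - 1) * (∑ v, p v * x v) ^ 2)| ≤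
      (|s| + |s * (s - 1)| + |s * (s - 1) * (s - 2)|) * ((β * a) ^ 3 * Real.exp ((6 + |s|) * (β * a))) := by
  set b := β * a with hb
  have hb0 : 0 ≤ b := mul_nonneg hβ ha
  set r := ∑ v, p v * Real.exp (β * x v) with hr
  set m1 := ∑ v, p v * x v with hm1
  set m2 := ∑ v, p v * x v ^ 2 with hm2
  have hbx : ∀ v, |β * x v| ≤ b := fun v => by
    rw [abs_mul, abs_of_nonneg hβ]; exact mul_le_mul_of_nonneg_left (hx v) hβ
  have hwt : ∀ (f : V → ℝ) (B : ℝ), (∀ v, |f v| ≤ B) → |∑ v, p v * f v| ≤ B := by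
    intro f B hf
    calc |∑ v, p v * f v| ≤ ∑ v, |p v * f v| := Finset.abs_sum_le_sum_abs _ _
      _ ≤ ∑ v, p v * B := Finset.sum_le_sum fun v _ => by
          rw [abs_mul, abs_of_nonneg (hp v)]; exact mul_le_mul_of_nonneg_left (hf v) (hp v)
      _ = B := by rw [← Finset.sum_mul, hp1, one_mul]
  have hT : ∀ n v, |Real.exp (β * x v) - ∑ m ∈ Finset.range n, (β * x v) ^ m / m.factorial| ≤
      b ^ n * Real.exp b := fun n v => (exp_tay _ n).trans
    (mul_le_mul (pow_le_pow_left₀ (abs_nonneg _) (hbx v) n) (Real.exp_le_exp.2 (hbx v)) (by positivity) (by positivity))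
  have d1 : |r - 1| ≤ b * Real.exp b := by
    have := hwt _ _ (hT 1)
    simp only [mul_sub, Finset.sum_sub_distrib] at this
    simpa [hp1] using this
  have d2 : |r - 1 - β * m1| ≤ b ^ 2 * Real.exp b := by
    have := hwt _ _ (hT 2)
    simp only [mul_sub, Finset.sum_sub_distrib, Finset.sum_range_succ] at this
    simp only [mul_add, Finset.sum_add_distrib] at this
    refine le_trans (le_of_eq ?_) this
    congr 1
    simp [hp1, hm1, Finset.mul_sum, mul_left_comm]; ring
  have d3 : |r - 1 - β * m1 - β ^ 2 * m2 / 2| ≤ b ^ 3 * Real.exp b := by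
    have := hwt _ _ (hT 3)
    simp only [mul_sub, Finset.sum_sub_distrib, Finset.sum_range_succ] at this
    simp only [mul_add, Finset.sum_add_distrib] at this
    refine le_trans (le_of_eq ?_) this
    congr 1
    have e : ∑ v, p v * ((β * x v) ^ 2 / (Nat.factorial 2 : ℝ)) = β ^ 2 * m2 / 2 := by
      rw [hm2, Finset.mul_sum, Finset.sum_div]
      refine Finset.sum_congr rfl fun v _ => ?_
      norm_num; ring
    rw [e]
    simp [hp1, hm1, Finset.mul_sum, mul_left_comm]; ring
  have hm1a : |β * m1| ≤ b := by
    have := hwt x a hx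
    rw [abs_mul, abs_of_nonneg hβ]; exact mul_le_mul_of_nonneg_left this hβ
  have hrl : Real.exp (-b) ≤ r := by
    calc Real.exp (-b) = ∑ v, p v * Real.exp (-b) := by rw [← Finset.sum_mul, hp1, one_mul]
      _ ≤ r := Finset.sum_le_sum fun v _ => mul_le_mul_of_nonneg_left
          (Real.exp_le_exp.2 (by have := (abs_le.1 (hbx v)).1; linarith)) (hp v)
  have hru : r ≤ Real.exp b := by
    calc r ≤ ∑ v, p v * Real.exp b := Finset.sum_le_sum fun v _ => mul_le_mul_of_nonneg_left
          (Real.exp_le_exp.2 (by have := (abs_le.1 (hbx v)).2; linarith)) (hp v)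
      _ = _ := by rw [← Finset.sum_mul, hp1, one_mul]
  have hr0 : 0 < r := (Real.exp_pos _).trans_le hrl
  have hlog : |Real.log r| ≤ b := by
    rw [abs_le]
    constructor
    · have := Real.log_le_log (Real.exp_pos _) hrl; rwa [Real.log_exp] at this
    · have := Real.log_le_log hr0 hru; rwa [Real.log_exp] at this
  have hrp : ∀ e : ℝ, r ^ e ≤ Real.exp (|e| * b) := by
    intro e
    rw [Real.rpow_def_of_pos hr0, Real.exp_le_exp]
    calc Real.log r * e ≤ |Real.log r * e| := le_abs_self _
      _ = |e| * |Real.log r| := by rw [abs_mul, mul_comm]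
      _ ≤ _ := mul_le_mul_of_nonneg_left hlog (abs_nonneg _)
  refine ⟨hrp s, ?_⟩
  set X := b ^ 3 * Real.exp ((6 + |s|) * b) with hX
  have hsn := abs_nonneg s
  have q1 : |s * (r - 1 - β * m1 - β ^ 2 * m2 / 2)| ≤ |s| * X := by
    rw [abs_mul]
    refine mul_le_mul_of_nonneg_left (d3.trans ?_) hsn
    exact mul_le_mul_of_nonneg_left (Real.exp_le_exp.2 (by nlinarith)) (by positivity)
  have q2 : |s * (s - 1) / 2 * ((r - 1) ^ 2 - (β * m1) ^ 2)| ≤ |s * (s - 1)| * X := by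
    rw [abs_mul, abs_div, abs_of_pos (by norm_num : (0:ℝ) < 2)]
    have : |(r - 1) ^ 2 - (β * m1) ^ 2| ≤ 2 * X := by
      rw [show (r - 1) ^ 2 - (β * m1) ^ 2 = (r - 1 - β * m1) * (r - 1 + β * m1) by ring, abs_mul]
      have e1 : |r - 1 + β * m1| ≤ 2 * b * Real.exp b := by
        refine (abs_add_le _ _).trans ?_
        have : b ≤ b * Real.exp b := le_mul_of_one_le_right hb0 (Real.one_le_exp hb0)
        linarith
      calc |r - 1 - β * m1| * |r - 1 + β * m1| ≤ (b ^ 2 * Real.exp b) * (2 * b * Real.exp b) :=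
            mul_le_mul d2 e1 (abs_nonneg _) (by positivity)
        _ = 2 * (b ^ 3 * Real.exp (b + b)) := by rw [Real.exp_add]; ring
        _ ≤ 2 * X := by
            refine mul_le_mul_of_nonneg_left ?_ (by norm_num)
            exact mul_le_mul_of_nonneg_left (Real.exp_le_exp.2 (by nlinarith)) (by positivity)
    calc _ ≤ |s * (s - 1)| / 2 * (2 * X) := mul_le_mul_of_nonneg_left this (by positivity)
      _ = _ := by ring
  have q3 : |r ^ s - 1 - s * (r - 1) - s * (s - 1) / 2 * (r - 1) ^ 2| ≤ |s * (s - 1) * (s - 2)| * X := by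
    refine (rpow_tay hr0 (by linarith)).trans ?_
    rw [mul_assoc]
    refine mul_le_mul_of_nonneg_left ?_ (abs_nonneg _)
    have e1 : |r - 1| ^ 3 ≤ b ^ 3 * Real.exp (3 * b) := by
      calc |r - 1| ^ 3 ≤ (b * Real.exp b) ^ 3 := pow_le_pow_left₀ (abs_nonneg _) d1 3
        _ = _ := by rw [mul_pow, ← Real.exp_nat_mul]; norm_num
    have e2 : max 1 (r ^ (s - 3)) ≤ Real.exp ((3 + |s|) * b) := by
      refine max_le (Real.one_le_exp (by positivity)) ((hrp _).trans (Real.exp_le_exp.2 ?_))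
      refine mul_le_mul_of_nonneg_right ?_ hb0
      have := abs_sub s 3; rw [abs_of_pos (by norm_num : (0:ℝ) < 3)] at this; linarith
    calc _ ≤ (b ^ 3 * Real.exp (3 * b)) * Real.exp ((3 + |s|) * b) :=
          mul_le_mul e1 e2 (by positivity) (by positivity)
      _ = X := by rw [hX, mul_assoc, ← Real.exp_add]; congr 2; ring
  have : r ^ s - 1 - s * β * m1 - β ^ 2 / 2 * (s * m2 + s * (s - 1) * m1 ^ 2) =
      (r ^ s - 1 - s * (r - 1) - s * (s - 1) / 2 * (r - 1) ^ 2) +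
      s * (s - 1) / 2 * ((r - 1) ^ 2 - (β * m1) ^ 2) + s * (r - 1 - β * m1 - β ^ 2 * m2 / 2) := by ring
  rw [this]
  refine (abs_add_le _ _).trans ?_
  have := abs_add_le (r ^ s - 1 - s * (r - 1) - s * (s - 1) / 2 * (r - 1) ^ 2)
    (s * (s - 1) / 2 * ((r - 1) ^ 2 - (β * m1) ^ 2))
  linarith

lemma CG.int_exp {V : Type*} [Fintype V] {μ : Measure (V → ℝ)} {C : V → V → ℝ} (h : CG μ C) (c : ℝ) :
    Integrable (fun x => ‖x‖ ^ 3 * Real.exp (c * ‖x‖)) μ := by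
  have := h.gauss
  obtain ⟨D, hD, hi⟩ := IsGaussian.exists_integrable_exp_sq μ
  refine (hi.const_mul (6 * Real.exp ((c+1)^2 / (4 * D)))).mono' (by fun_prop) (ae_of_all _ fun x => ?_)
  rw [Real.norm_of_nonneg (by positivity)]
  set t := ‖x‖
  have ht : 0 ≤ t := norm_nonneg x
  have h1 : t ^ 3 ≤ 6 * Real.exp t := by
    have := Real.pow_div_factorial_le_exp t ht 3
    rw [div_le_iff₀ (by positivity)] at this
    refine this.trans (le_of_eq ?_); rw [mul_comm]; norm_num [Nat.factorial]
  calc t ^ 3 * Real.exp (c * t) ≤ 6 * Real.exp t * Real.exp (c * t) :=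
        mul_le_mul_of_nonneg_right h1 (Real.exp_pos _).le
    _ = 6 * Real.exp (t + c * t) := by rw [Real.exp_add]; ring
    _ ≤ 6 * Real.exp ((c+1)^2 / (4 * D) + D * t ^ 2) := by
        refine mul_le_mul_of_nonneg_left (Real.exp_le_exp.2 ?_) (by norm_num)
        have : (c+1)^2 / (4 * D) + D * t ^ 2 - (t + c * t) = (D * t - (c+1)/2)^2 / D := by
          field_simp; ring
        have h2 : 0 ≤ (D * t - (c+1)/2)^2 / D := by positivity
        linarith
    _ = _ := by rw [Real.exp_add]; ring

/-- expansion of the expectation -/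
lemma CG.exp_est {V : Type*} [Fintype V] {μ : Measure (V → ℝ)} {C : V → V → ℝ} (h : CG μ C)
    {β s : ℝ} (hβ : 0 ≤ β) (hs : s ≤ 1) : ∃ K, 0 ≤ K ∧ ∀ p : V → ℝ, (∀ v, 0 ≤ p v) → ∑ v, p v = 1 →
      ∀ η, 0 ≤ η → η ≤ 1 → Integrable (fun x => (∑ v, p v * Real.exp (β * (η * x v))) ^ s) μ ∧
        |∫ x, (∑ v, p v * Real.exp (β * (η * x v))) ^ s ∂μ - 1 - β ^ 2 * η ^ 2 / 2 *
          ∑ v, ∑ w, p v * p w * (s * C v v - s * (1 - s) * C v w)| ≤ K * η ^ 3 := by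
  have hg := h.gauss
  have hpr := h.1
  set c0 := |s| + |s * (s - 1)| + |s * (s - 1) * (s - 2)|
  have hc0 : 0 ≤ c0 := by positivity
  refine ⟨c0 * β ^ 3 * ∫ x, ‖x‖ ^ 3 * Real.exp ((6 + |s|) * β * ‖x‖) ∂μ, by
    have : 0 ≤ ∫ x, ‖x‖ ^ 3 * Real.exp ((6 + |s|) * β * ‖x‖) ∂μ :=
      integral_nonneg fun x => by positivity
    positivity, ?_⟩
  intro p hp hp1 η hη hη1
  have hpt := fun x : V → ℝ => pt_exp (x := fun v => η * x v) hp hp1 hβ hs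
    (a := η * ‖x‖) (by positivity) (fun v => by
      rw [abs_mul, abs_of_nonneg hη]; exact mul_le_mul_of_nonneg_left (norm_le_pi_norm x v) hη)
  have hco : ∀ v, Integrable (fun x : V → ℝ => x v) μ := fun v =>
    (ContinuousLinearMap.proj (R := ℝ) (φ := fun _ : V => ℝ) v).integrable_comp (IsGaussian.integrable_id (μ := μ))
  have hL2 : ∀ v, MemLp (fun x : V → ℝ => x v) 2 μ := fun v =>
    (ContinuousLinearMap.proj (R := ℝ) (φ := fun _ : V => ℝ) v).comp_memLp' (IsGaussian.memLp_two_id (μ := μ))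
  have hco2 : ∀ v w, Integrable (fun x : V → ℝ => x v * x w) μ := fun v w =>
    (hL2 v).integrable_mul (hL2 w)
  have hmean : ∀ v, ∫ x, x v ∂μ = 0 := fun v =>
    h.dual_zero (ContinuousLinearMap.proj (R := ℝ) (φ := fun _ : V => ℝ) v)
  have hmeas : Measurable (fun x : V → ℝ => (∑ v, p v * Real.exp (β * (η * x v))) ^ s) := by fun_prop
  set T : (V → ℝ) → ℝ := fun x => s * β * η * ∑ v, p v * x v + β ^ 2 * η ^ 2 / 2 *
      ∑ v, ∑ w, p v * p w * (s * (x v * x v) - s * (1 - s) * (x v * x w)) with hT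
  have hTi1 : Integrable (fun x : V → ℝ => ∑ v, p v * x v) μ :=
    integrable_finsetSum _ fun v _ => (hco v).const_mul _
  have hTi2' : ∀ v w, Integrable (fun x : V → ℝ => p v * p w * (s * (x v * x v) - s * (1 - s) * (x v * x w))) μ :=
    fun v w => (((hco2 v v).const_mul _).sub ((hco2 v w).const_mul _)).const_mul _
  have hTi2 : Integrable (fun x : V → ℝ => ∑ v, ∑ w, p v * p w * (s * (x v * x v) - s * (1 - s) * (x v * x w))) μ :=
    integrable_finsetSum _ fun v _ => integrable_finsetSum _ fun w _ => hTi2' v w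
  have hTi : Integrable T μ := (hTi1.const_mul _).add (hTi2.const_mul _)
  have hTint : ∫ x, T x ∂μ = β ^ 2 * η ^ 2 / 2 *
      ∑ v, ∑ w, p v * p w * (s * C v v - s * (1 - s) * C v w) := by
    rw [hT, integral_add (hTi1.const_mul _) (hTi2.const_mul _), integral_const_mul, integral_const_mul,
      integral_finsetSum _ (fun v _ => (hco v).const_mul _),
      integral_finsetSum _ (fun v _ => integrable_finsetSum _ fun w _ => hTi2' v w)]
    simp_rw [integral_const_mul, hmean]
    have : ∀ v, ∫ x, ∑ w, p v * p w * (s * (x v * x v) - s * (1 - s) * (x v * x w)) ∂μ =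
        ∑ w, p v * p w * (s * C v v - s * (1 - s) * C v w) := by
      intro v
      rw [integral_finsetSum _ (fun w _ => hTi2' v w)]
      refine Finset.sum_congr rfl fun w _ => ?_
      rw [integral_const_mul, integral_sub ((hco2 v v).const_mul _) ((hco2 v w).const_mul _),
        integral_const_mul, integral_const_mul, h.2.2, h.2.2]
    simp_rw [this]; simp
  have hdiff : ∀ x, |(∑ v, p v * Real.exp (β * (η * x v))) ^ s - 1 - T x| ≤
      c0 * β ^ 3 * η ^ 3 * (‖x‖ ^ 3 * Real.exp ((6 + |s|) * β * ‖x‖)) := by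
    intro x
    have h2 := (hpt x).2
    have e : (∑ v, p v * Real.exp (β * (η * x v))) ^ s - 1 - T x =
       (∑ v, p v * Real.exp (β * (η * x v))) ^ s - 1 - s * β * ∑ v, p v * (η * x v)
      - β ^ 2 / 2 * (s * ∑ v, p v * (η * x v) ^ 2 + s * (s - 1) * (∑ v, p v * (η * x v)) ^ 2) := by
      have e1 : ∑ v, p v * (η * x v) = η * ∑ v, p v * x v := by
        rw [Finset.mul_sum]; exact Finset.sum_congr rfl fun v _ => by ring
      have e2 : ∑ v, p v * (η * x v) ^ 2 = η ^ 2 * ∑ v, p v * (x v * x v) := by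
        rw [Finset.mul_sum]; exact Finset.sum_congr rfl fun v _ => by ring
      have e3 : ∑ v, ∑ w, p v * p w * (s * (x v * x v) - s * (1 - s) * (x v * x w)) =
          s * ∑ v, p v * (x v * x v) - s * (1 - s) * (∑ v, p v * x v) ^ 2 := by
        rw [sq, Finset.sum_mul_sum, Finset.mul_sum, Finset.mul_sum, ← Finset.sum_sub_distrib]
        refine Finset.sum_congr rfl fun v _ => ?_
        calc _ = ∑ w, (s * p v * (x v * x v) * p w - s * (1-s) * (p v * x v * (p w * x w))) :=
              Finset.sum_congr rfl fun w _ => by ring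
          _ = _ := by rw [Finset.sum_sub_distrib, ← Finset.mul_sum, ← Finset.mul_sum, hp1]; ring
      simp only [hT]; rw [e1, e2, e3]; ring
    rw [e]
    refine h2.trans ?_
    rw [show c0 * β ^ 3 * η ^ 3 * (‖x‖ ^ 3 * Real.exp ((6 + |s|) * β * ‖x‖)) =
      c0 * ((β * (η * ‖x‖)) ^ 3 * Real.exp ((6 + |s|) * β * ‖x‖)) by ring]
    refine mul_le_mul_of_nonneg_left (mul_le_mul_of_nonneg_left (Real.exp_le_exp.2 ?_) (by positivity)) hc0
    have : η * ‖x‖ ≤ ‖x‖ := mul_le_of_le_one_left (norm_nonneg _) hη1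
    have h6 : 0 ≤ (6 + |s|) * β := by positivity
    nlinarith
  have hDi : Integrable (fun x => (∑ v, p v * Real.exp (β * (η * x v))) ^ s - 1 - T x) μ :=
    ((h.int_exp ((6 + |s|) * β)).const_mul (c0 * β ^ 3 * η ^ 3)).mono'
      ((hmeas.sub_const 1).aestronglyMeasurable.sub hTi.1) (ae_of_all _ hdiff)
  have hFi : Integrable (fun x => (∑ v, p v * Real.exp (β * (η * x v))) ^ s) μ := by
    have := (hDi.add hTi).add (integrable_const (1:ℝ))
    refine this.congr (ae_of_all _ fun x => ?_)
    simp
  refine ⟨hFi, ?_⟩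
  rw [← hTint]
  have : ∫ x, (∑ v, p v * Real.exp (β * (η * x v))) ^ s ∂μ - 1 - ∫ x, T x ∂μ =
      ∫ x, ((∑ v, p v * Real.exp (β * (η * x v))) ^ s - 1 - T x) ∂μ := by
    have a := integral_sub (hFi.sub (integrable_const (1:ℝ))) hTi
    have b := integral_sub hFi (integrable_const (1:ℝ))
    simp only [Pi.sub_apply, integral_const, probReal_univ, smul_eq_mul, mul_one] at a b
    rw [a, b]
  rw [this, ← Real.norm_eq_abs]
  calc _ ≤ ∫ x, c0 * β ^ 3 * η ^ 3 * (‖x‖ ^ 3 * Real.exp ((6 + |s|) * β * ‖x‖)) ∂μ :=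
        norm_integral_le_of_norm_le ((h.int_exp _).const_mul _) (ae_of_all _ hdiff)
    _ = _ := by rw [integral_const_mul]; ring

/-- one step comparison -/
lemma one_step {V : Type*} [Fintype V] {μ ν : Measure (V → ℝ)} {C D : V → V → ℝ} (h : CG μ C)
    (h' : CG ν D) {β s κ : ℝ} (hβ : 0 ≤ β) (hs : s ≤ 1) (hκ : 0 ≤ κ)
    (hc : ∀ v w, s * ((C v v - D v v) - (1 - s) * (C v w - D v w)) ≤ κ) :
    ∃ K, 0 ≤ K ∧ ∃ h0, 0 < h0 ∧ ∀ p : V → ℝ, (∀ v, 0 ≤ p v) → ∑ v, p v = 1 → ∀ η, 0 ≤ η → η ≤ h0 →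
      ∫⁻ x, ENNReal.ofReal ((∑ v, p v * Real.exp (β * (η * x v))) ^ s) ∂μ ≤
        ENNReal.ofReal (1 + β ^ 2 * κ / 2 * η ^ 2 + K * η ^ 3) *
        ∫⁻ x, ENNReal.ofReal ((∑ v, p v * Real.exp (β * (η * x v))) ^ s) ∂ν := by
  obtain ⟨K1, hK1, e1⟩ := h.exp_est hβ hs
  obtain ⟨K2, hK2, e2⟩ := h'.exp_est hβ hs
  set B := ∑ v, ∑ w, |s * D v v - s * (1 - s) * D v w| with hB
  have hB0 : 0 ≤ B := Finset.sum_nonneg fun v _ => Finset.sum_nonneg fun w _ => abs_nonneg _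
  set K3 := β ^ 2 / 2 * B + K2 with hK3
  have hK30 : 0 ≤ K3 := by positivity
  set A := β ^ 2 * κ / 2 with hA
  have hA0 : 0 ≤ A := by positivity
  refine ⟨2 * (K1 + K2) + 2 * A * K3, by positivity, 1 / (1 + 2 * K3), by positivity, ?_⟩
  intro p hp hp1 η hη hη0
  have hη1 : η ≤ 1 := hη0.trans (by rw [div_le_one (by positivity)]; linarith)
  have hηK : η * (2 * K3) ≤ 1 := by
    rw [le_div_iff₀ (by positivity)] at hη0; nlinarith
  obtain ⟨i1, a1⟩ := e1 p hp hp1 η hη hη1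
  obtain ⟨i2, a2⟩ := e2 p hp hp1 η hη hη1
  have hn : ∀ x : V → ℝ, 0 ≤ (∑ v, p v * Real.exp (β * (η * x v))) ^ s := fun x =>
    Real.rpow_nonneg (Finset.sum_nonneg fun v _ => mul_nonneg (hp v) (Real.exp_pos _).le) _
  rw [← ofReal_integral_eq_lintegral_ofReal i1 (ae_of_all _ hn),
    ← ofReal_integral_eq_lintegral_ofReal i2 (ae_of_all _ hn), ← ENNReal.ofReal_mul (by positivity)]
  refine ENNReal.ofReal_le_ofReal ?_
  set I1 := ∫ x, (∑ v, p v * Real.exp (β * (η * x v))) ^ s ∂μ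
  set I2 := ∫ x, (∑ v, p v * Real.exp (β * (η * x v))) ^ s ∂ν
  set Q1 := ∑ v, ∑ w, p v * p w * (s * C v v - s * (1 - s) * C v w)
  set Q2 := ∑ v, ∑ w, p v * p w * (s * D v v - s * (1 - s) * D v w) with hQ2
  have hple : ∀ v, p v ≤ 1 := fun v => hp1 ▸ Finset.single_le_sum (fun w _ => hp w) (Finset.mem_univ v)
  have hQ : Q1 - Q2 ≤ κ := by
    calc Q1 - Q2 = ∑ v, ∑ w, p v * p w * (s * ((C v v - D v v) - (1 - s) * (C v w - D v w))) := by
          rw [← Finset.sum_sub_distrib]; refine Finset.sum_congr rfl fun v _ => ?_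
          rw [← Finset.sum_sub_distrib]; refine Finset.sum_congr rfl fun w _ => ?_
          ring
      _ ≤ ∑ v, ∑ w, p v * p w * κ := Finset.sum_le_sum fun v _ => Finset.sum_le_sum fun w _ =>
          mul_le_mul_of_nonneg_left (hc v w) (mul_nonneg (hp v) (hp w))
      _ = κ := by simp_rw [← Finset.sum_mul, ← Finset.mul_sum, hp1]; simp [hp1]
  have hQ2b : -B ≤ Q2 := by
    rw [hB, hQ2, ← Finset.sum_neg_distrib]
    refine Finset.sum_le_sum fun v _ => ?_
    rw [← Finset.sum_neg_distrib]
    refine Finset.sum_le_sum fun w _ => ?_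
    have h1 : p v * p w ≤ 1 := mul_le_one₀ (hple v) (hp w) (hple w)
    have h0 : 0 ≤ p v * p w := mul_nonneg (hp v) (hp w)
    have := neg_abs_le (s * D v v - s * (1 - s) * D v w)
    have h3 := abs_nonneg (s * D v v - s * (1 - s) * D v w)
    nlinarith
  have b1 := (abs_le.1 a1).2
  have b2 := (abs_le.1 a2).1
  have hη3 : η ^ 3 ≤ η ^ 2 := pow_le_pow_of_le_one hη hη1 (by norm_num)
  have hβη : 0 ≤ β ^ 2 * η ^ 2 / 2 := by positivity
  have c1 : I1 ≤ I2 + A * η ^ 2 + (K1 + K2) * η ^ 3 := by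
    have := mul_le_mul_of_nonneg_left hQ hβη
    nlinarith
  have c2 : 1 - K3 * η ^ 2 ≤ I2 := by
    have := mul_le_mul_of_nonneg_left hQ2b hβη
    have h4 := mul_le_mul_of_nonneg_left hη3 hK2
    nlinarith
  have c3 : K3 * η ^ 2 ≤ 1 / 2 := by nlinarith
  set R := A * η ^ 2 + (2 * (K1 + K2) + 2 * A * K3) * η ^ 3 with hR
  have hR0 : 0 ≤ R := by positivity
  have c4 : R * (1 - K3 * η ^ 2) ≤ R * I2 := mul_le_mul_of_nonneg_left c2 hR0
  have h4 : A * K3 * η ^ 4 ≤ A * K3 * η ^ 3 :=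
    mul_le_mul_of_nonneg_left (pow_le_pow_of_le_one hη hη1 (by norm_num)) (by positivity)
  have h5 : (2 * (K1 + K2) + 2 * A * K3) * η ^ 3 * (K3 * η ^ 2) ≤ (2 * (K1 + K2) + 2 * A * K3) * η ^ 3 * (1 / 2) :=
    mul_le_mul_of_nonneg_left c3 (by positivity)
  have : (1 + A * η ^ 2 + (2 * (K1 + K2) + 2 * A * K3) * η ^ 3) * I2 = I2 + R * I2 := by rw [hR]; ring
  rw [this]
  have : R * (1 - K3 * η ^ 2) = A * η ^ 2 + (2 * (K1 + K2) + 2 * A * K3) * η ^ 3 - A * K3 * η ^ 4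
     - (2 * (K1 + K2) + 2 * A * K3) * η ^ 3 * (K3 * η ^ 2) := by rw [hR]; ring
  linarith

noncomputable def sc {V : Type*} (t : ℝ) (μ : Measure (V → ℝ)) : Measure (V → ℝ) :=
  μ.map (fun x => √t • x)

lemma sc_prob {V : Type*} [Fintype V] (t : ℝ) (μ : Measure (V → ℝ)) [IsProbabilityMeasure μ] :
    IsProbabilityMeasure (sc t μ) := Measure.isProbabilityMeasure_map (by fun_prop)

lemma sc_add {V : Type*} [Fintype V] {μ : Measure (V → ℝ)} {C : V → V → ℝ} (h : CG μ C) {t u : ℝ}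
    (ht : 0 ≤ t) (hu : 0 ≤ u) : sc (t + u) μ = Measure.conv (sc t μ) (sc u μ) := by
  have := h.1
  have h1 := sc_prob (t + u) μ
  have h2 := sc_prob t μ
  have h3 := sc_prob u μ
  refine Measure.ext_of_charFunDual ?_
  ext L
  obtain ⟨s, hs⟩ := h.2.1 L
  have key : ∀ t : ℝ, 0 ≤ t → charFunDual (sc t μ) L = Complex.exp (- (t * s / 2 : ℝ)) := by
    intro t ht
    rw [charFunDual_eq_charFun_map_one, sc, Measure.map_map (by fun_prop) (by fun_prop)]
    have : (⇑L ∘ fun x => √t • x) = (fun r : ℝ => √t * r) ∘ L := by ext x; simp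
    rw [this, ← Measure.map_map (by fun_prop) (by fun_prop), hs, gaussianReal_map_const_mul,
      charFun_gaussianReal]
    simp [Real.sq_sqrt ht]
  rw [charFunDual_conv, key _ (add_nonneg ht hu), key _ ht, key _ hu, ← Complex.exp_add]
  congr 1; push_cast; ring

/-- Gaussian comparison -/
lemma gauss_comp {V : Type*} [Fintype V] [Nonempty V] {μ ν : Measure (V → ℝ)} {C D : V → V → ℝ} (h : CG μ C)
    (h' : CG ν D) {β s κ : ℝ} (hβ : 0 ≤ β) (hs : s ≤ 1) (hκ : 0 ≤ κ)
    (hc : ∀ v w, s * ((C v v - D v v) - (1 - s) * (C v w - D v w)) ≤ κ) :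
    ∫⁻ x, ENNReal.ofReal ((∑ v, Real.exp (β * x v)) ^ s) ∂μ ≤
      ENNReal.ofReal (Real.exp (β ^ 2 * κ / 2)) * ∫⁻ x, ENNReal.ofReal ((∑ v, Real.exp (β * x v)) ^ s) ∂ν := by
  have hm := h.1
  have hn := h'.1
  obtain ⟨K, hK, h0, hh0, hst⟩ := one_step h h' hβ hs hκ hc
  set A := β ^ 2 * κ / 2
  have hA : 0 ≤ A := by positivity
  set F : (V → ℝ) → ENNReal := fun x => ENNReal.ofReal ((∑ v, Real.exp (β * x v)) ^ s) with hF
  have hFm : Measurable F := by fun_prop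
  have hpm := fun t => sc_prob t μ
  have hpn := fun t => sc_prob t ν
  have step1 : ∀ t, 0 ≤ t → √t ≤ h0 → ∀ z, ∫⁻ x, F (z + x) ∂(sc t μ) ≤
      ENNReal.ofReal (1 + A * t + K * √t ^ 3) * ∫⁻ x, F (z + x) ∂(sc t ν) := by
    intro t ht hth z
    have hU : 0 < ∑ v, Real.exp (β * z v) := Finset.sum_pos (fun v _ => Real.exp_pos _) Finset.univ_nonempty
    set U := ∑ v, Real.exp (β * z v)
    have hfac : ∀ x : V → ℝ, F (z + √t • x) = ENNReal.ofReal (U ^ s) * ENNReal.ofReal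
        ((∑ v, (Real.exp (β * z v) / U) * Real.exp (β * (√t * x v))) ^ s) := by
      intro x
      rw [hF, ← ENNReal.ofReal_mul (by positivity), ← Real.mul_rpow hU.le (Finset.sum_nonneg fun v _ => by positivity),
        Finset.mul_sum]
      simp only [Pi.add_apply, Pi.smul_apply, smul_eq_mul]
      congr 3 with v
      rw [mul_add, Real.exp_add]; field_simp
    have hmz : Measurable fun x => F (z + x) := by fun_prop
    rw [sc, sc, lintegral_map hmz (by fun_prop), lintegral_map hmz (by fun_prop)]
    simp_rw [hfac]
    rw [lintegral_const_mul _ (by fun_prop), lintegral_const_mul _ (by fun_prop)]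
    have := hst (fun v => Real.exp (β * z v) / U) (fun v => by positivity)
      (by rw [← Finset.sum_div]; exact div_self hU.ne') (√t) (Real.sqrt_nonneg _) hth
    rw [Real.sq_sqrt ht] at this
    calc _ ≤ ENNReal.ofReal (U ^ s) * _ := mul_le_mul_right this _
      _ = _ := by ring
  set g : ℝ → ℝ → ENNReal := fun t u => ∫⁻ x, F x ∂(Measure.conv (sc t μ) (sc u ν)) with hg
  have step2 : ∀ t u h, 0 ≤ t → 0 ≤ u → 0 ≤ h → √h ≤ h0 →
      g (t + h) u ≤ ENNReal.ofReal (1 + A * h + K * √h ^ 3) * g t (u + h) := by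
    intro t u r ht hu hr hrh
    simp only [hg]
    rw [sc_add h ht hr, sc_add h' hu hr, ← Measure.conv_assoc (sc t μ), Measure.conv_assoc (sc t μ) (sc r μ),
      Measure.conv_comm (sc r μ), ← Measure.conv_assoc, Measure.lintegral_conv hFm, Measure.lintegral_conv hFm,
      ← lintegral_const_mul' _ _ ENNReal.ofReal_ne_top]
    exact lintegral_mono fun z => step1 r hr hrh z
  have step3 : ∀ r, 0 ≤ r → √r ≤ h0 → ∀ n k : ℕ, k ≤ n →
      g (k * r) ((n - k) * r) ≤ ENNReal.ofReal (1 + A * r + K * √r ^ 3) ^ k * g 0 (n * r) := by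
    intro r hr hrh n k
    induction k with
    | zero => intro _; simp
    | succ k ih =>
      intro hk
      have hk' : (k:ℝ) + 1 ≤ n := by exact_mod_cast hk
      have := step2 (k * r) ((n - (k+1)) * r) r (by positivity) (mul_nonneg (by linarith) hr) hr hrh
      rw [show (k:ℝ) * r + r = ((k+1 : ℕ):ℝ) * r by push_cast; ring,
        show ((n:ℝ) - (k+1)) * r + r = (n - k) * r by ring] at this
      rw [show ((n:ℝ) - ((k+1:ℕ):ℝ)) * r = (n - (k+1)) * r by push_cast; ring]
      refine this.trans ?_
      rw [pow_succ (ENNReal.ofReal _) k, mul_comm (_ ^ k), mul_assoc]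
      exact mul_le_mul_right (ih (by omega)) _
  have z0 : ∀ ρ : Measure (V → ℝ), IsProbabilityMeasure ρ → sc 0 ρ = Measure.dirac 0 := by
    intro ρ hρ
    rw [sc]; simp
  have o1 : ∀ ρ : Measure (V → ℝ), sc 1 ρ = ρ := by
    intro ρ; rw [sc]; simp
  have g1 : g 1 0 = ∫⁻ x, F x ∂μ := by
    simp only [hg]; rw [z0 ν hn, o1, Measure.conv_dirac_zero]
  have g0 : g 0 1 = ∫⁻ x, F x ∂ν := by
    simp only [hg]; rw [z0 μ hm, o1, Measure.dirac_zero_conv]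
  rw [← g1, ← g0]
  have hlim : Tendsto (fun n : ℕ => ENNReal.ofReal (Real.exp (A + K * √(1 / ((n:ℝ))))) * g 0 1) atTop
      (nhds (ENNReal.ofReal (Real.exp A) * g 0 1)) := by
    refine ENNReal.Tendsto.mul_const ?_ (Or.inl (by simp [Real.exp_pos]))
    refine ENNReal.tendsto_ofReal ((Real.continuous_exp.tendsto _).comp ?_)
    have : Tendsto (fun n : ℕ => √(1 / ((n:ℝ)))) atTop (nhds 0) := by
      have := (Real.continuous_sqrt.tendsto 0).comp tendsto_one_div_atTop_nhds_zero_nat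
      rw [Real.sqrt_zero] at this; exact this
    simpa using (this.const_mul K).const_add A
  have hsm : ∀ᶠ n : ℕ in atTop, √(1 / ((n:ℝ))) ≤ h0 := by
    have := (Real.continuous_sqrt.tendsto 0).comp tendsto_one_div_atTop_nhds_zero_nat
    rw [Real.sqrt_zero] at this
    exact this.eventually_le_const hh0
  refine ge_of_tendsto hlim ?_
  filter_upwards [hsm, eventually_ge_atTop 1] with n h1 h2
  have hn0 : (0:ℝ) < n := by exact_mod_cast h2
  have h3 := step3 (1 / n) (by positivity) h1 n n le_rfl
  rw [mul_one_div_cancel hn0.ne', sub_self, zero_mul] at h3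
  refine h3.trans (mul_le_mul_left ?_ _)
  rw [← ENNReal.ofReal_pow (by positivity)]
  refine ENNReal.ofReal_le_ofReal ?_
  calc (1 + A * (1 / n) + K * √(1 / n) ^ 3) ^ n ≤ (Real.exp (A * (1 / n) + K * √(1 / n) ^ 3)) ^ n := by
        refine pow_le_pow_left₀ (by positivity) ?_ n
        have := Real.add_one_le_exp (A * (1 / n) + K * √(1 / n) ^ 3); linarith
    _ = Real.exp (A + K * √(1 / n)) := by
        rw [← Real.exp_nat_mul]; congr 1
        have : √(1 / (n:ℝ)) ^ 3 = 1 / n * √(1/n) := by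
          rw [pow_succ, Real.sq_sqrt (by positivity)]
        rw [this]; field_simp
    _ ≤ _ := le_rfl

noncomputable def MM {V : Type*} [Fintype V] (β s : ℝ) (μ : Measure (V → ℝ)) : ENNReal :=
  ∫⁻ x, ENNReal.ofReal ((∑ v, Real.exp (β * x v)) ^ s) ∂μ

lemma CG_of {V : Type*} [Fintype V] {μ : Measure (V → ℝ)} [IsGaussian μ] {C : V → V → ℝ}
    (h0 : ∀ v, ∫ x, x v ∂μ = 0) (h1 : ∀ v w, ∫ x, x v * x w ∂μ = C v w) : CG μ C := by
  refine ⟨inferInstance, fun L => ⟨(variance L μ).toNNReal, ?_⟩, h1⟩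
  have : ∫ x, L x ∂μ = 0 := by
    have e : ∀ x : V → ℝ, L x = ∑ v, x v * L (Pi.single v 1) := by
      intro x
      have hx : x = ∑ v, x v • (Pi.single v (1:ℝ) : V → ℝ) := by
        ext j; simp [Finset.sum_apply, Pi.single_apply]
      calc L x = L (∑ v, x v • (Pi.single v (1:ℝ) : V → ℝ)) := by rw [← hx]
        _ = _ := by simp only [map_sum, map_smul, smul_eq_mul]
    rw [integral_congr_ae (ae_of_all _ e), integral_finsetSum]
    · simp_rw [integral_mul_const, h0]; simp
    · exact fun v _ => ((ContinuousLinearMap.proj (R := ℝ) (φ := fun _ : V => ℝ) v).integrable_comp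
        (IsGaussian.integrable_id (μ := μ))).mul_const _
  rw [IsGaussian.map_eq_gaussianReal L, this]

lemma sf_of_prob {E : Type*} [MeasurableSpace E] (μ : Measure E) (_ : IsProbabilityMeasure μ) : SFinite μ := inferInstance

lemma pi_gauss {I E : Type*} [Fintype I] [NormedAddCommGroup E] [NormedSpace ℝ E] [MeasurableSpace E] [BorelSpace E]
    [SecondCountableTopology E] [CompleteSpace E] (ν : Measure E) [IsGaussian ν] :
    IsGaussian (Measure.pi (fun _ : I => ν)) := by
  have h := iIndepFun.hasGaussianLaw (P := Measure.pi (fun _ : I => ν)) (X := fun i (ω : I → E) => ω i)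
    (fun i => ⟨by rw [(measurePreserving_eval (fun _ : I => ν) i).map_eq]; infer_instance⟩)
    (iIndepFun_pi (X := fun _ : I => id) (fun _ => aemeasurable_id))
  have := h.isGaussian_map
  simpa using this

lemma pi_int {I E : Type*} [Fintype I] [MeasurableSpace E] (ν : Measure E) [IsProbabilityMeasure ν]
    {f : E → ℝ} (hf : Measurable f) (i : I) : ∫ ω : I → E, f (ω i) ∂(Measure.pi fun _ => ν) = ∫ x, f x ∂ν := by
  conv_rhs => rw [← (measurePreserving_eval (fun _ : I => ν) i).map_eq,
    integral_map (measurable_pi_apply i).aemeasurable hf.aestronglyMeasurable]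

lemma pi_lint {I E : Type*} [Fintype I] [MeasurableSpace E] (ν : Measure E) [IsProbabilityMeasure ν]
    {f : E → ENNReal} (hf : Measurable f) (i : I) :
    ∫⁻ ω : I → E, f (ω i) ∂(Measure.pi fun _ => ν) = ∫⁻ x, f x ∂ν := by
  conv_rhs => rw [← (measurePreserving_eval (fun _ : I => ν) i).map_eq, lintegral_map hf (measurable_pi_apply i)]

lemma pi_int2 {I E : Type*} [Fintype I] [MeasurableSpace E] (ν : Measure E) [IsProbabilityMeasure ν]
    {f g : E → ℝ} (hf : Measurable f) (hg : Measurable g) (i j : I) :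
    ∫ ω : I → E, f (ω i) * g (ω j) ∂(Measure.pi fun _ => ν) =
      if i = j then ∫ x, f x * g x ∂ν else (∫ x, f x ∂ν) * ∫ x, g x ∂ν := by
  split_ifs with h
  · subst h; exact pi_int ν (f := fun x => f x * g x) (by fun_prop) i
  · have hi := (iIndepFun_pi (μ := fun _ : I => ν) (X := fun _ : I => id) (fun _ => aemeasurable_id)).indepFun h
    have := (hi.comp hf hg).integral_fun_mul_eq_mul_integral
      (hf.comp (measurable_pi_apply i)).aestronglyMeasurable (hg.comp (measurable_pi_apply j)).aestronglyMeasurable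
    simp only [Function.comp, id] at this
    rw [this, pi_int ν hf, pi_int ν hg]

lemma sum_rpow_le' {I : Type*} (S : Finset I) (f : I → ℝ) (hf : ∀ i, 0 ≤ f i) {p : ℝ} (hp : 0 < p) (hp1 : p ≤ 1) :
    (∑ i ∈ S, f i) ^ p ≤ ∑ i ∈ S, f i ^ p := by
  induction S using Finset.induction_on with
  | empty => simp [Real.zero_rpow hp.ne']
  | insert a S ha ih =>
    rw [Finset.sum_insert ha, Finset.sum_insert ha]
    exact (Real.rpow_add_le_add_rpow (hf a) (Finset.sum_nonneg fun i _ => hf i) hp.le hp1).trans (by linarith)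

lemma lexp_gauss (a : NNReal) (t : ℝ) : ∫⁻ x, ENNReal.ofReal (Real.exp (t * x)) ∂(gaussianReal 0 a) =
    ENNReal.ofReal (Real.exp (t ^ 2 * a / 2)) := by
  rw [← ofReal_integral_eq_lintegral_ofReal (integrable_exp_mul_gaussianReal t) (ae_of_all _ fun x => (Real.exp_pos _).le)]
  have := congrFun (mgf_fun_id_gaussianReal (μ := 0) (v := a)) t
  rw [mgf] at this
  rw [this]; congr 2; ring

lemma tree_step {I W : Type*} [Fintype I] [Fintype W] [Nonempty I] [Nonempty W] {ν : Measure (W → ℝ)} {D : W → W → ℝ}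
    (h : CG ν D) (a : NNReal) : ∃ τ : Measure (I × W → ℝ),
      CG τ (fun v w => if v.1 = w.1 then a + D v.2 w.2 else 0) ∧
      (∀ β P, 0 < P → P ≤ 1 → MM β P τ ≤ Fintype.card I * ENNReal.ofReal (Real.exp (β ^ 2 * P ^ 2 * a / 2)) * MM β P ν) ∧
      (∀ β, MM β (-1) τ ≤ MM β (-1) (Measure.pi (fun _ : I => gaussianReal 0 a)) * MM β (-1) ν) := by
  have hg := h.gauss
  set μ1 := Measure.pi (fun _ : I => gaussianReal 0 a) with hμ1
  set μ2 := Measure.pi (fun _ : I => ν) with hμ2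
  have g1 : IsGaussian μ1 := pi_gauss _
  have g2 : IsGaussian μ2 := pi_gauss _
  have p1 : IsProbabilityMeasure μ1 := by rw [hμ1]; infer_instance
  have p2 : IsProbabilityMeasure μ2 := by rw [hμ2]; infer_instance
  have s2 : SFinite μ2 := sf_of_prob μ2 p2
  let T : ((I → ℝ) × (I → W → ℝ)) →L[ℝ] (I × W → ℝ) := ContinuousLinearMap.pi fun v =>
    (ContinuousLinearMap.proj (R := ℝ) (φ := fun _ : I => ℝ) v.1).comp (ContinuousLinearMap.fst ℝ _ _) +
    ((ContinuousLinearMap.proj (R := ℝ) (φ := fun _ : W => ℝ) v.2).comp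
      (ContinuousLinearMap.proj (R := ℝ) (φ := fun _ : I => W → ℝ) v.1)).comp (ContinuousLinearMap.snd ℝ _ _)
  have hT : ∀ z v, T z v = z.1 v.1 + z.2 v.1 v.2 := fun z v => rfl
  have hTm : Measurable T := T.continuous.measurable
  have hGT : IsGaussian ((μ1.prod μ2).map T) := inferInstance
  have hma : ∀ i, ∫ x, x i ∂μ1 = 0 := fun i => by
    rw [hμ1, pi_int _ (f := fun x => x) measurable_id i]; exact integral_id_gaussianReal
  have hmb : ∀ i w, ∫ y, y i w ∂μ2 = 0 := fun i w => by
    rw [hμ2, pi_int ν (f := fun x : W → ℝ => x w) (by fun_prop) i]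
    exact h.dual_zero (ContinuousLinearMap.proj (R := ℝ) (φ := fun _ : W => ℝ) w)
  have hL1 : ∀ i, MemLp (fun x : I → ℝ => x i) 2 μ1 := fun i =>
    (ContinuousLinearMap.proj (R := ℝ) (φ := fun _ : I => ℝ) i).comp_memLp' (IsGaussian.memLp_two_id (μ := μ1))
  have hL2 : ∀ i w, MemLp (fun y : I → W → ℝ => y i w) 2 μ2 := fun i w =>
    ((ContinuousLinearMap.proj (R := ℝ) (φ := fun _ : W => ℝ) w).comp
      (ContinuousLinearMap.proj (R := ℝ) (φ := fun _ : I => W → ℝ) i)).comp_memLp' (IsGaussian.memLp_two_id (μ := μ2))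
  have hI1 := fun i => (hL1 i).integrable (by norm_num)
  have hI2 := fun i w => (hL2 i w).integrable (by norm_num)
  refine ⟨(μ1.prod μ2).map T, CG_of (fun v => ?_) (fun v w => ?_), ?_, ?_⟩
  · rw [integral_map hTm.aemeasurable (measurable_pi_apply v).aestronglyMeasurable]
    simp_rw [hT]
    have e1 := (hI1 v.1).comp_fst μ2
    have e2 := (hI2 v.1 v.2).comp_snd μ1
    rw [integral_add e1 e2, integral_fun_fst (μ := μ1) (ν := μ2) (fun x => x v.1), integral_fun_snd (μ := μ1) (ν := μ2) (fun y => y v.1 v.2), hma, hmb]; simp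
  · rw [integral_map (f := fun x : I × W → ℝ => x v * x w) hTm.aemeasurable (Measurable.aestronglyMeasurable (by fun_prop))]
    simp_rw [hT]
    have e1 : Integrable (fun z : (I → ℝ) × (I → W → ℝ) => z.1 v.1 * z.1 w.1) (μ1.prod μ2) :=
      ((hL1 v.1).integrable_mul (hL1 w.1)).comp_fst μ2
    have e2 := (hI1 v.1).mul_prod (hI2 w.1 w.2)
    have e3 := (hI1 w.1).mul_prod (hI2 v.1 v.2)
    have e4 : Integrable (fun z : (I → ℝ) × (I → W → ℝ) => z.2 v.1 v.2 * z.2 w.1 w.2) (μ1.prod μ2) :=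
      ((hL2 v.1 v.2).integrable_mul (hL2 w.1 w.2)).comp_snd μ1
    have : ∀ z : (I → ℝ) × (I → W → ℝ), (z.1 v.1 + z.2 v.1 v.2) * (z.1 w.1 + z.2 w.1 w.2) =
      (z.1 v.1 * z.1 w.1 + z.1 v.1 * z.2 w.1 w.2) + (z.1 w.1 * z.2 v.1 v.2 + z.2 v.1 v.2 * z.2 w.1 w.2) := by
      intro z; ring
    simp_rw [this]
    rw [integral_add (f := fun z : (I → ℝ) × (I → W → ℝ) => z.1 v.1 * z.1 w.1 + z.1 v.1 * z.2 w.1 w.2)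
      (g := fun z => z.1 w.1 * z.2 v.1 v.2 + z.2 v.1 v.2 * z.2 w.1 w.2) (e1.add e2) (e3.add e4), integral_add e1 e2, integral_add e3 e4,
      integral_prod_mul (μ := μ1) (ν := μ2) (fun x => x v.1) (fun y => y w.1 w.2),
      integral_prod_mul (μ := μ1) (ν := μ2) (fun x => x w.1) (fun y => y v.1 v.2), hma, hma]
    have f1 : ∫ z, z.1 v.1 * z.1 w.1 ∂(μ1.prod μ2) = if v.1 = w.1 then (a:ℝ) else 0 := by
      rw [integral_fun_fst (μ := μ1) (ν := μ2) (fun x => x v.1 * x w.1), hμ1,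
        pi_int2 _ (f := fun x => x) (g := fun x => x) measurable_id measurable_id]
      have hv := variance_id_gaussianReal (μ := 0) (v := a)
      rw [variance_of_integral_eq_zero (by fun_prop) (by simp)] at hv
      simp only [id] at hv
      simp only [integral_id_gaussianReal, ← sq, hv]; simp
    have f2 : ∫ z, z.2 v.1 v.2 * z.2 w.1 w.2 ∂(μ1.prod μ2) = if v.1 = w.1 then D v.2 w.2 else 0 := by
      rw [integral_fun_snd (μ := μ1) (ν := μ2) (fun x => x v.1 v.2 * x w.1 w.2), hμ2,
        pi_int2 ν (f := fun x : W → ℝ => x v.2) (g := fun x => x w.2) (by fun_prop) (by fun_prop), h.2.2]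
      have := h.dual_zero (ContinuousLinearMap.proj (R := ℝ) (φ := fun _ : W => ℝ) v.2)
      simp only [ContinuousLinearMap.proj_apply] at this
      simp [this]
    rw [f1, f2]
    split_ifs <;> simp
  · intro β P hP hP1
    rw [MM, lintegral_map (by fun_prop) hTm]
    have hz : ∀ z : (I → ℝ) × (I → W → ℝ), ENNReal.ofReal ((∑ v, Real.exp (β * T z v)) ^ P) ≤
        ∑ i, ENNReal.ofReal (Real.exp (β * P * z.1 i)) * ENNReal.ofReal ((∑ w, Real.exp (β * z.2 i w)) ^ P) := by
      intro z
      simp_rw [← ENNReal.ofReal_mul (Real.exp_pos _).le]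
      rw [← ENNReal.ofReal_sum_of_nonneg (fun i _ => by positivity)]
      refine ENNReal.ofReal_le_ofReal ?_
      rw [Fintype.sum_prod_type]
      refine (sum_rpow_le' _ _ (fun i => by positivity) hP hP1).trans (Finset.sum_le_sum fun i _ => le_of_eq ?_)
      simp_rw [hT, mul_add, Real.exp_add, ← Finset.mul_sum]
      rw [Real.mul_rpow (by positivity) (by positivity), ← Real.exp_mul]
      congr 2; ring
    refine (lintegral_mono hz).trans ?_
    rw [lintegral_finsetSum _ (fun i _ => by fun_prop)]
    have : ∀ i : I, ∫⁻ z, ENNReal.ofReal (Real.exp (β * P * z.1 i)) * ENNReal.ofReal ((∑ w, Real.exp (β * z.2 i w)) ^ P)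
        ∂(μ1.prod μ2) = ENNReal.ofReal (Real.exp (β ^ 2 * P ^ 2 * a / 2)) * MM β P ν := by
      intro i
      rw [lintegral_prod_mul (μ := μ1) (ν := μ2) (f := fun x => ENNReal.ofReal (Real.exp (β * P * x i)))
        (g := fun y => ENNReal.ofReal ((∑ w, Real.exp (β * y i w)) ^ P)) (Measurable.aemeasurable (by fun_prop)) (Measurable.aemeasurable (by fun_prop)), hμ1, hμ2,
        pi_lint _ (f := fun x => ENNReal.ofReal (Real.exp (β * P * x))) (by fun_prop),
        pi_lint _ (f := fun y : W → ℝ => ENNReal.ofReal ((∑ w, Real.exp (β * y w)) ^ P)) (by fun_prop), lexp_gauss, MM]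
      congr 4; ring
    simp_rw [this]
    simp [mul_assoc]
  · intro β
    rw [MM, lintegral_map (by fun_prop) hTm]
    have hz : ∀ z : (I → ℝ) × (I → W → ℝ), ENNReal.ofReal ((∑ v, Real.exp (β * T z v)) ^ (-1:ℝ)) ≤
        ∑ i, ENNReal.ofReal ((∑ j, Real.exp (β * z.1 j)) ^ (-1:ℝ) * (Real.exp (β * z.1 i) / ∑ j, Real.exp (β * z.1 j))) *
          ENNReal.ofReal ((∑ w, Real.exp (β * z.2 i w)) ^ (-1:ℝ)) := by
      intro z
      have hS : 0 < ∑ j, Real.exp (β * z.1 j) := Finset.sum_pos (fun v _ => Real.exp_pos _) Finset.univ_nonempty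
      have hR : ∀ i, 0 < ∑ w, Real.exp (β * z.2 i w) := fun i =>
        Finset.sum_pos (fun v _ => Real.exp_pos _) Finset.univ_nonempty
      set S := ∑ j, Real.exp (β * z.1 j) with hSd
      simp_rw [← ENNReal.ofReal_mul (show 0 ≤ S ^ (-1:ℝ) * (Real.exp (β * z.1 _) / S) by positivity)]
      rw [← ENNReal.ofReal_sum_of_nonneg (fun i _ => by have := hR i; positivity)]
      refine ENNReal.ofReal_le_ofReal ?_
      rw [Fintype.sum_prod_type]
      simp_rw [hT, mul_add, Real.exp_add, ← Finset.mul_sum, Real.rpow_neg_one]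
      have hJ := (convexOn_zpow (𝕜 := ℝ) (-1)).map_sum_le (t := Finset.univ) (w := fun i => Real.exp (β * z.1 i) / S)
        (p := fun i => ∑ w, Real.exp (β * z.2 i w)) (fun i _ => by positivity)
        (by rw [← Finset.sum_div]; exact div_self hS.ne') (fun i _ => hR i)
      simp only [smul_eq_mul, zpow_neg_one] at hJ
      have e : ∑ i, Real.exp (β * z.1 i) * ∑ w, Real.exp (β * z.2 i w) =
          S * ∑ i, Real.exp (β * z.1 i) / S * ∑ w, Real.exp (β * z.2 i w) := by
        rw [Finset.mul_sum]; refine Finset.sum_congr rfl fun i _ => ?_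
        field_simp
      rw [e, mul_inv]
      refine (mul_le_mul_of_nonneg_left hJ (by positivity)).trans (le_of_eq ?_)
      rw [Finset.mul_sum]; refine Finset.sum_congr rfl fun i _ => by ring
    refine (lintegral_mono hz).trans ?_
    rw [lintegral_finsetSum _ (fun i _ => by fun_prop)]
    have : ∀ i : I, ∫⁻ z, ENNReal.ofReal ((∑ j, Real.exp (β * z.1 j)) ^ (-1:ℝ) * (Real.exp (β * z.1 i) / ∑ j, Real.exp (β * z.1 j))) *
          ENNReal.ofReal ((∑ w, Real.exp (β * z.2 i w)) ^ (-1:ℝ)) ∂(μ1.prod μ2) =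
        (∫⁻ x, ENNReal.ofReal ((∑ j, Real.exp (β * x j)) ^ (-1:ℝ) * (Real.exp (β * x i) / ∑ j, Real.exp (β * x j))) ∂μ1) *
          MM β (-1) ν := by
      intro i
      rw [lintegral_prod_mul (μ := μ1) (ν := μ2) (f := fun x => ENNReal.ofReal ((∑ j, Real.exp (β * x j)) ^ (-1:ℝ) * (Real.exp (β * x i) / ∑ j, Real.exp (β * x j))))
        (g := fun y => ENNReal.ofReal ((∑ w, Real.exp (β * y i w)) ^ (-1:ℝ))) (Measurable.aemeasurable (by fun_prop)) (Measurable.aemeasurable (by fun_prop)), hμ2,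
        pi_lint _ (f := fun y : W → ℝ => ENNReal.ofReal ((∑ w, Real.exp (β * y w)) ^ (-1:ℝ))) (by fun_prop), MM]
    simp_rw [this]
    rw [← Finset.sum_mul, ← lintegral_finsetSum _ (fun i _ => by fun_prop)]
    refine le_of_eq ?_
    congr 1
    rw [MM]
    refine lintegral_congr fun x => ?_
    have hS : 0 < ∑ j, Real.exp (β * x j) := Finset.sum_pos (fun v _ => Real.exp_pos _) Finset.univ_nonempty
    rw [← ENNReal.ofReal_sum_of_nonneg (fun i _ => by positivity), ← Finset.mul_sum, ← Finset.sum_div, div_self hS.ne', mul_one]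

lemma MM_jensen {V : Type*} [Fintype V] {μ : Measure (V → ℝ)} [IsProbabilityMeasure μ] {β p P B : ℝ}
    (hp : 0 < p) (hpP : p ≤ P) (h : MM β P μ ≤ ENNReal.ofReal (Real.exp (P * B))) :
    MM β p μ ≤ ENNReal.ofReal (Real.exp (p * B)) := by
  have hP := hp.trans_le hpP
  have := eLpNorm'_le_eLpNorm'_of_exponent_le hp hpP μ (f := fun x => ∑ v, Real.exp (β * x v))
    (Measurable.aestronglyMeasurable (by fun_prop))
  have e : ∀ q : ℝ, 0 < q → ∫⁻ x, ‖∑ v, Real.exp (β * x v)‖ₑ ^ q ∂μ = MM β q μ := by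
    intro q hq
    refine lintegral_congr fun x => ?_
    rw [Real.enorm_of_nonneg (by positivity), ENNReal.ofReal_rpow_of_nonneg (by positivity) hq.le]
  rw [eLpNorm', eLpNorm', e p hp, e P hP] at this
  have h2 := this.trans (ENNReal.rpow_le_rpow h (by positivity))
  rw [ENNReal.ofReal_rpow_of_pos (Real.exp_pos _), ← Real.exp_mul,
    show P * B * (1 / P) = B by field_simp] at h2
  have h3 := ENNReal.rpow_le_rpow h2 hp.le
  rw [← ENNReal.rpow_mul, ENNReal.ofReal_rpow_of_pos (Real.exp_pos _), ← Real.exp_mul,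
    one_div_mul_cancel hp.ne', ENNReal.rpow_one, mul_comm] at h3
  exact h3

def bx (S : ℕ) (v : Vtx) : Prop := 0 ≤ v.1 ∧ v.1 < S ∧ 0 ≤ v.2 ∧ v.2 < S

lemma bx_nrm {S : ℕ} (hS : 1 ≤ S) {v w : Vtx} (hv : bx S v) (hw : bx S w) : nrm (v - w) ≤ S := by
  obtain ⟨h1, h2, h3, h4⟩ := hv
  obtain ⟨k1, k2, k3, k4⟩ := hw
  refine nrm_le (by exact_mod_cast hS) ?_ ?_
  · have : |(v - w).1| ≤ (S:ℤ) := by simp only [abs_eq_max_neg, Prod.fst_sub]; omega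
    exact_mod_cast this
  · have : |(v - w).2| ≤ (S:ℤ) := by simp only [abs_eq_max_neg, Prod.snd_sub]; omega
    exact_mod_cast this

lemma CG.base : CG (Measure.dirac (0 : Unit → ℝ)) (fun _ _ => 0) := by
  refine ⟨inferInstance, fun L => ⟨0, ?_⟩, fun v w => by simp⟩
  rw [Measure.map_dirac' (f := L) L.continuous.measurable]; simp

lemma MM_base (β s : ℝ) : MM β s (Measure.dirac (0 : Unit → ℝ)) = 1 := by
  simp [MM]

lemma dg_eq {q S x y : ℕ} (hx : x < S * (q + 1)) (hy : y < S * (q + 1))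
    (h : Fin.ofNat (q + 1) (x / S) = Fin.ofNat (q + 1) (y / S)) : x / S = y / S := by
  have h1 := congrArg Fin.val h
  simp only [Fin.ofNat] at h1
  rwa [Nat.mod_eq_of_lt (Nat.div_lt_of_lt_mul hx), Nat.mod_eq_of_lt (Nat.div_lt_of_lt_mul hy)] at h1

theorem tree_up (S : ℕ → ℕ) (hS0 : S 0 = 1) (hS : Monotone S) (a : ℕ → NNReal) (F : ℝ → ℝ) (hFm : Monotone F)
    (P : ℕ → ℝ) (hP : ∀ k, 0 < P k) (hP1 : ∀ k, P k ≤ 1) (hPm : Antitone P) (β : ℝ) (n : ℕ)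
    (hF : ∀ k ≤ n, F (S k) ≤ ∑ j ∈ Finset.range k, (a j : ℝ)) :
    ∃ (W : Type) (_ : Fintype W) (_ : Nonempty W) (ν : Measure (W → ℝ)) (D : W → W → ℝ) (ι : Vtx → W), CG ν D ∧
      (∀ w, D w w = ∑ j ∈ Finset.range n, (a j : ℝ)) ∧
      (∀ v w, bx (S n) v → bx (S n) w → F (nrm (v - w)) ≤ ∑ j ∈ Finset.range n, (a j : ℝ) - D (ι v) (ι w)) ∧
      (∀ v w, bx (S n) v → bx (S n) w → ι v = ι w → v = w) ∧
      ∀ p, 0 < p → (∀ k < n, p ≤ P k) → MM β p ν ≤ ENNReal.ofReal (Real.exp (p * ∑ k ∈ Finset.range n,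
        (Real.log (((S (k+1) / S k : ℕ) + 1 : ℝ) ^ 2) / P k + β ^ 2 * P k * a k / 2))) := by
  have hS1 : ∀ k, 1 ≤ S k := fun k => hS0 ▸ hS (Nat.zero_le k)
  induction n with
  | zero =>
    refine ⟨Unit, inferInstance, inferInstance, _, _, fun _ => (), CG.base, by simp, ?_, ?_, ?_⟩
    · intro v w hv hw
      have := bx_nrm (hS1 0) hv hw
      simpa using (hFm this).trans (hF 0 le_rfl)
    · rintro ⟨a, b⟩ ⟨c, d⟩ ⟨h1, h2, h3, h4⟩ ⟨k1, k2, k3, k4⟩ _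
      rw [hS0] at *
      simp only [Prod.mk.injEq] at *
      omega
    · intro p _ _; rw [MM_base]; simp
  | succ n ih =>
    obtain ⟨W, i1, i2, ν, D, ι, hCG, hd, hc, hi, hm⟩ := ih (fun k hk => hF k (hk.trans (Nat.le_succ n)))
    set q := S (n+1) / S n with hq
    set s := S n with hs
    have hs0 : 0 < s := hS1 n
    obtain ⟨τ, hτ, hτ1, -⟩ := tree_step (I := Fin (q+1) × Fin (q+1)) hCG (a n)
    have := hτ.1
    have hsq : S (n+1) < s * (q + 1) := by
      rw [hq, Nat.mul_add, mul_one]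
      have := Nat.div_add_mod (S (n+1)) s
      have := Nat.mod_lt (S (n+1)) hs0
      omega
    refine ⟨_, inferInstance, inferInstance, τ, _, fun v => ((Fin.ofNat (q+1) (v.1.toNat / s), Fin.ofNat (q+1) (v.2.toNat / s)),
      ι ((v.1.toNat % s : ℕ), (v.2.toNat % s : ℕ))), hτ, ?_, ?_, ?_, ?_⟩
    · intro w; simp only [if_true]; rw [hd, Finset.sum_range_succ, add_comm]
    · intro v w hv hw
      simp only
      split_ifs with h
      · rw [Prod.mk.injEq] at h
        obtain ⟨h1, h2, h3, h4⟩ := hv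
        obtain ⟨k1, k2, k3, k4⟩ := hw
        have e1 := dg_eq (by omega) (by omega) h.1
        have e2 := dg_eq (by omega) (by omega) h.2
        have d1 := Nat.div_add_mod v.1.toNat s
        have d2 := Nat.div_add_mod v.2.toNat s
        have d3 := Nat.div_add_mod w.1.toNat s
        have d4 := Nat.div_add_mod w.2.toNat s
        rw [e1] at d1; rw [e2] at d2
        have hb : ∀ x y : ℕ, bx s ((x % s : ℕ), (y % s : ℕ)) := fun x y => by
          have := Nat.mod_lt x hs0
          have := Nat.mod_lt y hs0
          refine ⟨?_, ?_, ?_, ?_⟩ <;> dsimp only <;> omega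
        have := hc _ _ (hb v.1.toNat v.2.toNat) (hb w.1.toNat w.2.toNat)
        rw [Finset.sum_range_succ]
        have e : v - w = (((v.1.toNat % s : ℕ):ℤ), ((v.2.toNat % s : ℕ):ℤ)) - (((w.1.toNat % s : ℕ):ℤ), ((w.2.toNat % s : ℕ):ℤ)) := by
          ext
          · simp only [Prod.fst_sub]; omega
          · simp only [Prod.snd_sub]; omega
        rw [e]; linarith
      · have := bx_nrm (hS1 (n+1)) hv hw
        have := (hFm this).trans (hF (n+1) le_rfl)
        linarith
    · intro v w hv hw h
      rw [Prod.mk.injEq, Prod.mk.injEq] at h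
      obtain ⟨h1, h2, h3, h4⟩ := hv
      obtain ⟨k1, k2, k3, k4⟩ := hw
      have e1 := dg_eq (by omega) (by omega) h.1.1
      have e2 := dg_eq (by omega) (by omega) h.1.2
      have d1 := Nat.div_add_mod v.1.toNat s
      have d2 := Nat.div_add_mod v.2.toNat s
      have d3 := Nat.div_add_mod w.1.toNat s
      have d4 := Nat.div_add_mod w.2.toNat s
      rw [e1] at d1; rw [e2] at d2
      have hb : ∀ x y : ℕ, bx s ((x % s : ℕ), (y % s : ℕ)) := fun x y => by
        have := Nat.mod_lt x hs0
        have := Nat.mod_lt y hs0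
        refine ⟨?_, ?_, ?_, ?_⟩ <;> dsimp only <;> omega
      have := hi _ _ (hb v.1.toNat v.2.toNat) (hb w.1.toNat w.2.toNat) h.2
      rw [Prod.mk.injEq] at this
      ext <;> omega
    · intro p hp hpk
      refine MM_jensen hp (hpk n (Nat.lt_succ_self n)) ?_
      refine (hτ1 β _ (hP n) (hP1 n)).trans ?_
      refine (mul_le_mul_right (hm (P n) (hP n) fun k hk => hPm hk.le) _).trans ?_
      have hcard : ((Fintype.card (Fin (q+1) × Fin (q+1)) : ℕ) : ENNReal) = ENNReal.ofReal (Real.exp (Real.log ((q + 1 : ℝ) ^ 2))) := by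
        rw [Real.exp_log (by positivity), Fintype.card_prod, Fintype.card_fin, ← ENNReal.ofReal_natCast]
        congr 1; push_cast; ring
      rw [hcard, ← ENNReal.ofReal_mul (by positivity), ← ENNReal.ofReal_mul (by positivity), ← Real.exp_add, ← Real.exp_add,
        Finset.sum_range_succ]
      refine ENNReal.ofReal_le_ofReal (Real.exp_le_exp.2 (le_of_eq ?_))
      have := (hP n).ne'
      field_simp
      ring

theorem tree_low (s : ℕ → ℕ) (d : ℕ → ℕ) (hs0 : s 0 = 1) (hs1 : ∀ k, 1 ≤ s k) 
    (a : ℕ → NNReal) (G : ℝ → ℝ) (hG : Monotone G) (hG0 : 0 ≤ G 1) (β : ℝ) (n : ℕ)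
    (hd : ∀ k < n, (d k + 1) * (2 * s k) ≤ s (k+1))
    (hGn : ∀ k < n, ∑ j ∈ Finset.range (k+1), (a j : ℝ) ≤ G (s k)) :
    ∃ (W : Type) (_ : Fintype W) (_ : Nonempty W) (ν : Measure (W → ℝ)) (D : W → W → ℝ) (pos : W → Vtx), CG ν D ∧
      (∀ w, D w w = ∑ j ∈ Finset.range n, (a j : ℝ)) ∧
      (∀ v w, ∑ j ∈ Finset.range n, (a j : ℝ) - D v w ≤ G (nrm (pos v - pos w))) ∧
      (∀ w, bx (s n) (pos w)) ∧ Function.Injective pos ∧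
      MM β (-1) ν ≤ ∏ k ∈ Finset.range n, MM β (-1) (Measure.pi (fun _ : Fin (d k + 1) × Fin (d k + 1) => gaussianReal 0 (a k))) := by
  induction n with
  | zero =>
    refine ⟨Unit, inferInstance, inferInstance, _, _, fun _ => 0, CG.base, by simp, ?_, ?_, ?_, ?_⟩
    · intro v w; simpa [nrm] using hG0
    · intro w; simp [bx, hs0]
    · exact fun _ _ _ => rfl
    · rw [MM_base]; simp
  | succ n ih =>
    obtain ⟨W, i1, i2, ν, D, pos, hCG, hdg, hc, hb, hi, hm⟩ := ih (fun k hk => hd k (by omega)) (fun k hk => hGn k (by omega))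
    obtain ⟨τ, hτ, -, hτ1⟩ := tree_step (I := Fin (d n+1) × Fin (d n+1)) hCG (a n)
    have hsn := hs1 n
    have key : ∀ x y : ℤ, ∀ i j : Fin (d n + 1), i ≠ j → 0 ≤ x → x < s n → 0 ≤ y → y < s n →
        (s n : ℤ) ≤ |(((i : ℕ) : ℤ) * (2 * s n) + x) - (((j : ℕ) : ℤ) * (2 * s n) + y)| := by
      intro x y i j hij hx hx' hy hy'
      have : (i : ℕ) ≠ j := fun h => hij (Fin.ext h)
      rcases Nat.lt_or_gt_of_ne this with h | h
      · have : ((i:ℕ) + 1 : ℤ) * (2 * s n) ≤ ((j:ℕ):ℤ) * (2 * s n) :=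
          mul_le_mul_of_nonneg_right (by omega) (by omega)
        rw [add_mul, one_mul] at this
        simp only [abs_eq_max_neg]; omega
      · have : ((j:ℕ) + 1 : ℤ) * (2 * s n) ≤ ((i:ℕ):ℤ) * (2 * s n) :=
          mul_le_mul_of_nonneg_right (by omega) (by omega)
        rw [add_mul, one_mul] at this
        simp only [abs_eq_max_neg]; omega
    let ps : (Fin (d n+1) × Fin (d n+1)) × W → Vtx := fun z =>
      (((z.1.1 : ℕ) : ℤ) * (2 * s n) + (pos z.2).1, ((z.1.2 : ℕ) : ℤ) * (2 * s n) + (pos z.2).2)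
    have hfar : ∀ v w, v.1 ≠ w.1 → (s n : ℝ) ≤ nrm (ps v - ps w) := by
      intro v w h
      obtain ⟨a1, a2, a3, a4⟩ := hb v.2
      obtain ⟨b1, b2, b3, b4⟩ := hb w.2
      by_cases h1 : v.1.1 = w.1.1
      · have h2 : v.1.2 ≠ w.1.2 := fun h2 => h (Prod.ext h1 h2)
        refine le_trans ?_ (nrm_ge2 _)
        have := key _ _ _ _ h2 a3 a4 b3 b4
        exact_mod_cast this
      · refine le_trans ?_ (nrm_ge1 _)
        have := key _ _ _ _ h1 a1 a2 b1 b2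
        exact_mod_cast this
    have hnear : ∀ v w, v.1 = w.1 → ps v - ps w = pos v.2 - pos w.2 := by
      intro v w h
      simp only [ps, h]; ext <;> simp
    refine ⟨_, inferInstance, inferInstance, τ, _, ps, hτ, ?_, ?_, ?_, ?_, ?_⟩
    · intro w; simp only [if_true]; rw [hdg, Finset.sum_range_succ, add_comm]
    · intro v w
      split_ifs with h
      · rw [hnear v w h, Finset.sum_range_succ]; linarith [hc v.2 w.2]
      · have := (hGn n (Nat.lt_succ_self n)).trans (hG (hfar v w h)); linarith
    · intro w
      obtain ⟨a1, a2, a3, a4⟩ := hb w.2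
      have hdn := hd n (Nat.lt_succ_self n)
      have h1 : ((w.1.1 : ℕ) + 1) * (2 * s n) ≤ (d n + 1) * (2 * s n) := Nat.mul_le_mul_right _ w.1.1.isLt
      have h2 : ((w.1.2 : ℕ) + 1) * (2 * s n) ≤ (d n + 1) * (2 * s n) := Nat.mul_le_mul_right _ w.1.2.isLt
      zify at h1 h2 hdn
      rw [add_mul] at h1 h2
      have p1 : 0 ≤ ((w.1.1 : ℕ):ℤ) * (2 * s n) := by positivity
      have p2 : 0 ≤ ((w.1.2 : ℕ):ℤ) * (2 * s n) := by positivity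
      simp only [bx, ps]
      refine ⟨?_, ?_, ?_, ?_⟩ <;> omega
    · intro v w h
      by_cases h1 : v.1 = w.1
      · have := hnear v w h1
        rw [h, sub_self] at this
        exact Prod.ext h1 (hi (sub_eq_zero.1 this.symm))
      · exfalso
        by_cases h2 : v.1.1 = w.1.1
        · have h3 : v.1.2 ≠ w.1.2 := fun h2' => h1 (Prod.ext h2 h2')
          have := key _ _ _ _ h3 (hb v.2).2.2.1 (hb v.2).2.2.2 (hb w.2).2.2.1 (hb w.2).2.2.2
          have e := congrArg Prod.snd h
          simp only [ps] at e
          rw [e, sub_self, abs_zero] at this; omega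
        · have := key _ _ _ _ h2 (hb v.2).1 (hb v.2).2.1 (hb w.2).1 (hb w.2).2.1
          have e := congrArg Prod.fst h
          simp only [ps] at e
          rw [e, sub_self, abs_zero] at this; omega
    · refine (hτ1 β).trans ?_
      rw [Finset.prod_range_succ, mul_comm]
      exact mul_le_mul_left hm _

lemma ind_int (μ : Measure ℝ) [IsProbabilityMeasure μ] (y q : ℝ) (hq : q ≤ μ.real (Set.Ici y)) (hq0 : 0 ≤ q) :
    ∫⁻ x, ENNReal.ofReal (if y ≤ x then Real.exp (-1) else 1) ∂μ ≤ ENNReal.ofReal (Real.exp (-q/2)) := by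
  have he : Real.exp (-1) ≤ 1/2 := by
    rw [Real.exp_neg, one_div]
    exact inv_anti₀ (by norm_num) (by linarith [Real.add_one_le_exp (1:ℝ)])
  have e : ∀ x : ℝ, (if y ≤ x then Real.exp (-1) else 1) = 1 - (1 - Real.exp (-1)) * (Set.Ici y).indicator 1 x := by
    intro x
    by_cases h : y ≤ x <;> simp [h]
  simp_rw [e]
  have hi : Integrable (fun x => (1 - Real.exp (-1)) * (Set.Ici y).indicator (1 : ℝ → ℝ) x) μ :=
    ((integrable_const (1:ℝ)).indicator measurableSet_Ici).const_mul _
  rw [← ofReal_integral_eq_lintegral_ofReal (f := fun x => 1 - (1 - Real.exp (-1)) * (Set.Ici y).indicator (1 : ℝ → ℝ) x) ((integrable_const 1).sub hi)]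
  · refine ENNReal.ofReal_le_ofReal ?_
    have e2 : ∫ x, (1 - (1 - Real.exp (-1)) * (Set.Ici y).indicator (1 : ℝ → ℝ) x) ∂μ = 1 - (1 - Real.exp (-1)) * μ.real (Set.Ici y) := by
      rw [integral_sub (integrable_const 1) hi, integral_const_mul, integral_indicator_one measurableSet_Ici]; simp
    refine e2.le.trans ?_
    nlinarith [Real.add_one_le_exp (-q/2)]
  · refine ae_of_all _ fun x => ?_
    have := e x
    simp only [Pi.zero_apply]
    rw [← this]; split_ifs <;> positivity

lemma gauss_tail (a : NNReal) (ha : a ≠ 0) {y : ℝ} (hy : 0 ≤ y) :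
    (Real.sqrt (2 * Real.pi * a))⁻¹ * Real.exp (-(y+1)^2/(2*a)) ≤ (gaussianReal 0 a).real (Set.Ici y) := by
  rw [Measure.real, ← ENNReal.ofReal_le_iff_le_toReal (measure_ne_top _ _), gaussianReal_apply _ ha]
  calc ENNReal.ofReal ((Real.sqrt (2 * Real.pi * a))⁻¹ * Real.exp (-(y+1)^2/(2*a)))
      = ∫⁻ x in Set.Icc y (y+1), ENNReal.ofReal ((Real.sqrt (2 * Real.pi * a))⁻¹ * Real.exp (-(y+1)^2/(2*a))) := by
        rw [setLIntegral_const, Real.volume_Icc]; simp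
    _ ≤ ∫⁻ x in Set.Icc y (y+1), gaussianPDF 0 a x := by
        refine setLIntegral_mono' measurableSet_Icc fun x hx => ENNReal.ofReal_le_ofReal ?_
        rw [gaussianPDFReal, sub_zero]
        have : x ^ 2 ≤ (y+1)^2 := by nlinarith [hx.1, hx.2]
        gcongr
    _ ≤ _ := lintegral_mono_set Set.Icc_subset_Ici_self

lemma rem_bd {I : Type*} [Fintype I] [Nonempty I] (a : NNReal) (β y q : ℝ) (hβ : 0 ≤ β) (hq0 : 0 < q)
    (hq : q ≤ (gaussianReal 0 a).real (Set.Ici y)) :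
    MM β (-1) (Measure.pi (fun _ : I => gaussianReal 0 a)) ≤ ENNReal.ofReal (4 * Real.exp (-β*y) / (Fintype.card I * q) +
      2 * Real.exp (β^2*a/2) * Real.exp (-(Fintype.card I * q) / 4)) := by
  set n := Fintype.card I with hn
  have hn0 : (0:ℝ) < n := by exact_mod_cast Fintype.card_pos
  obtain ⟨i0⟩ := ‹Nonempty I›
  have hq1 : q ≤ 1 := hq.trans measureReal_le_one
  let f : I → ℝ → ENNReal := fun i x => if i = i0 then ENNReal.ofReal (Real.exp (-β * x)) else
    ENNReal.ofReal (if y ≤ x then Real.exp (-1) else 1)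
  have hfm : ∀ i, Measurable (f i) := fun i => by
    by_cases h : i = i0
    · simp only [f, h, if_true]; fun_prop
    · simp only [f, h, if_false]
      exact (Measurable.ite measurableSet_Ici measurable_const measurable_const).ennreal_ofReal
  have hpt : ∀ x : I → ℝ, ENNReal.ofReal ((∑ i, Real.exp (β * x i)) ^ (-1:ℝ)) ≤
      ENNReal.ofReal (4 * Real.exp (-β*y) / (n * q)) + ENNReal.ofReal (Real.exp (n*q/4)) * ∏ i, f i (x i) := by
    intro x
    set K := (Finset.univ.filter fun i => y ≤ x i).card with hK
    have hZ : 0 < ∑ i, Real.exp (β * x i) := Finset.sum_pos (fun v _ => Real.exp_pos _) ⟨i0, Finset.mem_univ _⟩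
    rw [Real.rpow_neg_one]
    by_cases h : n * q / 4 ≤ K
    · refine le_trans (ENNReal.ofReal_le_ofReal ?_) le_self_add
      have h1 : K * Real.exp (β * y) ≤ ∑ i, Real.exp (β * x i) := by
        calc K * Real.exp (β * y) = ∑ i ∈ Finset.univ.filter fun i => y ≤ x i, Real.exp (β * y) := by simp [hK]
          _ ≤ ∑ i ∈ Finset.univ.filter fun i => y ≤ x i, Real.exp (β * x i) := by
            refine Finset.sum_le_sum fun i hi => Real.exp_le_exp.2 (mul_le_mul_of_nonneg_left (Finset.mem_filter.1 hi).2 hβ)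
          _ ≤ _ := Finset.sum_le_sum_of_subset_of_nonneg (Finset.filter_subset _ _) fun _ _ _ => by positivity
      have h2 : n * q / 4 * Real.exp (β * y) ≤ ∑ i, Real.exp (β * x i) :=
        le_trans (mul_le_mul_of_nonneg_right h (by positivity)) h1
      refine (inv_anti₀ (by positivity) h2).trans (le_of_eq ?_)
      rw [neg_mul, Real.exp_neg]; field_simp
    · push Not at h
      refine le_trans ?_ le_add_self
      have h1 : ∏ i, f i (x i) = ENNReal.ofReal (Real.exp (-β * x i0)) *
          ENNReal.ofReal (∏ i ∈ Finset.univ.erase i0, (if y ≤ x i then Real.exp (-1) else 1)) := by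
        rw [← Finset.mul_prod_erase _ _ (Finset.mem_univ i0), ENNReal.ofReal_prod_of_nonneg (fun i _ => by split_ifs <;> positivity)]
        congr 1
        · simp [f]
        · exact Finset.prod_congr rfl fun i hi => by simp [f, Finset.ne_of_mem_erase hi]
      rw [h1, ← ENNReal.ofReal_mul (by positivity), ← ENNReal.ofReal_mul (by positivity)]
      refine ENNReal.ofReal_le_ofReal ?_
      have h2 : Real.exp (-K) ≤ ∏ i ∈ Finset.univ.erase i0, (if y ≤ x i then Real.exp (-1) else 1) := by
        rw [Finset.prod_ite, Finset.prod_const, Finset.prod_const_one, mul_one, ← Real.exp_nat_mul]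
        refine Real.exp_le_exp.2 ?_
        have : ((Finset.univ.erase i0).filter fun i => y ≤ x i).card ≤ K :=
          Finset.card_le_card (Finset.filter_subset_filter _ (Finset.erase_subset _ _))
        have : (((Finset.univ.erase i0).filter fun i => y ≤ x i).card:ℝ) ≤ K := by exact_mod_cast this
        linarith
      calc (∑ i, Real.exp (β * x i))⁻¹ ≤ (Real.exp (β * x i0))⁻¹ := inv_anti₀ (by positivity)
            (Finset.single_le_sum (f := fun i => Real.exp (β * x i)) (fun _ _ => by positivity) (Finset.mem_univ i0))
        _ = Real.exp (-β * x i0) * 1 := by rw [neg_mul, Real.exp_neg, mul_one]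
        _ ≤ Real.exp (-β * x i0) * (Real.exp (n*q/4) * Real.exp (-K)) := by
            rw [← Real.exp_add]
            exact mul_le_mul_of_nonneg_left (Real.one_le_exp (by linarith)) (by positivity)
        _ ≤ _ := by
          rw [mul_left_comm]
          exact mul_le_mul_of_nonneg_left (mul_le_mul_of_nonneg_left h2 (by positivity)) (by positivity)
  refine (lintegral_mono hpt).trans ?_
  rw [lintegral_add_left measurable_const, lintegral_const, measure_univ, mul_one,
    lintegral_const_mul _ (f := fun x : I → ℝ => ∏ i, f i (x i)) (Finset.measurable_prod _ fun i _ => (hfm i).comp (measurable_pi_apply i)),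
    lintegral_prod_eq_prod_lintegral_of_indepFun Finset.univ (fun i (x : I → ℝ) => f i (x i))
      (iIndepFun_pi (μ := fun _ : I => gaussianReal 0 a) (X := f) fun i => (hfm i).aemeasurable)
      (fun i => (hfm i).comp (measurable_pi_apply i)),
    ENNReal.ofReal_add (by positivity) (by positivity)]
  refine add_le_add le_rfl ?_
  have h3 : ∏ i, ∫⁻ x : I → ℝ, f i (x i) ∂(Measure.pi fun _ => gaussianReal 0 a) ≤
      ENNReal.ofReal (Real.exp (β^2*a/2)) * ENNReal.ofReal (Real.exp (-q/2)) ^ (n - 1) := by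
    rw [← Finset.mul_prod_erase _ _ (Finset.mem_univ i0)]
    refine mul_le_mul' ?_ ?_
    · rw [pi_lint _ (hfm i0)]
      simp only [f, if_true]
      rw [lexp_gauss]; simp
    · refine (Finset.prod_le_prod' (g := fun _ => ENNReal.ofReal (Real.exp (-q/2))) fun i hi => ?_).trans ?_
      · rw [pi_lint _ (hfm i)]
        simp only [f, Finset.ne_of_mem_erase hi, if_false]
        exact ind_int _ _ _ hq hq0.le
      · rw [Finset.prod_const, Finset.card_erase_of_mem (Finset.mem_univ _), Finset.card_univ]
  refine (mul_le_mul_right h3 _).trans ?_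
  rw [← ENNReal.ofReal_pow (by positivity), ← ENNReal.ofReal_mul (by positivity), ← ENNReal.ofReal_mul (by positivity)]
  refine ENNReal.ofReal_le_ofReal ?_
  rw [← Real.exp_nat_mul, Nat.cast_sub (by exact_mod_cast hn0), Nat.cast_one]
  have h4 : Real.exp (q/2) ≤ 2 := by
    have : Real.exp (1/2) ≤ 2 := by
      rw [← Real.le_log_iff_exp_le (by norm_num)]; linarith [Real.log_two_gt_d9]
    exact (Real.exp_le_exp.2 (by linarith)).trans this
  calc Real.exp (n*q/4) * (Real.exp (β^2*a/2) * Real.exp (((n:ℝ)-1) * (-q/2)))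
      = Real.exp (q/2) * Real.exp (β^2*a/2) * Real.exp (-(n*q)/4) := by
        rw [← Real.exp_add, ← Real.exp_add, ← Real.exp_add, ← Real.exp_add]; congr 1; ring
    _ ≤ _ := by gcongr

lemma lin_exp {c : ℝ} (hc : 0 < c) (B : ℝ) : ∀ᶠ L : ℝ in atTop, B * L + B ≤ Real.exp (c * L) := by
  have := (isLittleO_pow_exp_pos_mul_atTop 1 hc).def (c := (|B| * 2 + 1)⁻¹) (by positivity)
  filter_upwards [this, eventually_ge_atTop 1] with L h hL
  rw [Real.norm_of_nonneg (by positivity), Real.norm_of_nonneg (by positivity), pow_one,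
    ← div_le_iff₀' (by positivity), div_inv_eq_mul] at h
  nlinarith [le_abs_self B, abs_nonneg B]

set_option maxHeartbeats 800000 in
lemma rem_asymp {β x A δ K ε : ℝ} (hβ : 0 ≤ β) (hx : 0 ≤ x) (hA : 0 < A) (hK : 0 < K) (hxA : x^2/(2*A) < 2*δ) (hε : 0 < ε) :
    ∀ᶠ L : ℝ in atTop, ∀ (d : ℕ) (a : NNReal), (a:ℝ) = A * L → Real.exp (2*δ*L) / K ≤ ((d:ℝ)+1)^2 →
      MM β (-1) (Measure.pi (fun _ : Fin (d+1) × Fin (d+1) => gaussianReal 0 a)) ≤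
        ENNReal.ofReal (Real.exp ((-(β*x) - 2*δ + x^2/(2*A) + ε) * L)) := by
  set γ := 2*δ - x^2/(2*A) with hγ
  have hγ0 : 0 < γ := by linarith
  set e := min (ε/2) (γ/2) with he
  have he0 : 0 < e := lt_min (by linarith) (by linarith)
  have he1 : e ≤ ε/2 := min_le_left _ _
  have he2 : e ≤ γ/2 := min_le_right _ _
  set B := K * Real.sqrt (2*Real.pi*A) * Real.exp (x/A + 1/(2*A)) with hB
  have hB0 : 0 < B := by positivity
  filter_upwards [lin_exp he0 B, lin_exp (show 0 < ε/2 by linarith) 8, lin_exp (show 0 < γ/2 by linarith)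
    (4*|β^2*A/2+β*x+γ| + 16), eventually_ge_atTop 1] with L h1 h2 h3 hL d a ha hd
  have ha0 : a ≠ 0 := by
    intro h; rw [h] at ha; have : 0 < A * L := by positivity
    simp at ha; rcases ha with h | h <;> linarith
  have ht := gauss_tail a ha0 (y := x*L) (by positivity)
  set q := (Real.sqrt (2 * Real.pi * a))⁻¹ * Real.exp (-(x*L+1)^2/(2*a)) with hq
  have hap : (0:ℝ) < a := by rw [ha]; positivity
  have hq0 : 0 < q := by positivity
  refine (rem_bd a β (x*L) q hβ hq0 ht).trans (ENNReal.ofReal_le_ofReal ?_)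
  have hcard : ((Fintype.card (Fin (d+1) × Fin (d+1)) : ℕ):ℝ) = ((d:ℝ)+1)^2 := by
    rw [Fintype.card_prod, Fintype.card_fin]; push_cast; ring
  rw [hcard]
  have hnq : Real.exp ((γ - e) * L) ≤ ((d:ℝ)+1)^2 * q := by
    have hqb : Real.exp (-(x^2/(2*A)) * L) * (K / (B * L)) ≤ q := by
      have s1 : Real.sqrt (2 * Real.pi * a) ≤ Real.sqrt (2*Real.pi*A) * L := by
        rw [ha, ← mul_assoc, Real.sqrt_mul (by positivity)]
        gcongr
        rw [Real.sqrt_le_left (by linarith)]; nlinarith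
      have s2 : Real.exp (-(x^2/(2*A)) * L) * (Real.exp (x/A + 1/(2*A)))⁻¹ ≤ Real.exp (-(x*L+1)^2/(2*a)) := by
        rw [← Real.exp_neg, ← Real.exp_add]
        refine Real.exp_le_exp.2 ?_
        rw [ha]
        have : -(x*L+1)^2/(2*(A*L)) = -(x^2/(2*A)) * L - x/A - 1/(2*A) * L⁻¹ := by field_simp; ring
        rw [this]
        have : L⁻¹ ≤ 1 := inv_le_one_of_one_le₀ hL
        have : 1/(2*A) * L⁻¹ ≤ 1/(2*A) * 1 := by gcongr
        linarith
      calc Real.exp (-(x^2/(2*A)) * L) * (K / (B * L)) = (Real.sqrt (2*Real.pi*A) * L)⁻¹ * (Real.exp (-(x^2/(2*A)) * L) * (Real.exp (x/A + 1/(2*A)))⁻¹) := by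
            rw [hB]; field_simp
        _ ≤ _ := by rw [hq]; gcongr
    have hBL : B * L ≤ Real.exp (e * L) := by linarith
    calc Real.exp ((γ - e) * L) = Real.exp (2*δ*L) * Real.exp (-(x^2/(2*A)) * L) * (Real.exp (e*L))⁻¹ := by
          rw [← Real.exp_neg, ← Real.exp_add, ← Real.exp_add, hγ]; congr 1; ring
      _ ≤ Real.exp (2*δ*L) * Real.exp (-(x^2/(2*A)) * L) * (B * L)⁻¹ := by gcongr
      _ = Real.exp (2*δ*L) / K * (Real.exp (-(x^2/(2*A)) * L) * (K / (B * L))) := by field_simp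
      _ ≤ _ := by gcongr
  have t1 : 4 * Real.exp (-β*(x*L)) / (((d:ℝ)+1)^2 * q) ≤ Real.exp ((-(β*x) - 2*δ + x^2/(2*A) + ε) * L) / 2 := by
    rw [div_le_iff₀ (by positivity)]
    calc 4 * Real.exp (-β*(x*L)) ≤ Real.exp (ε/2*L) / 2 * Real.exp (-β*(x*L)) := by gcongr; linarith
      _ = Real.exp (-(β*x*L) + ε/2*L) / 2 := by rw [div_mul_eq_mul_div, ← Real.exp_add]; congr 2; ring
      _ ≤ Real.exp (-(β*x*L) + (ε - e)*L) / 2 := by gcongr; linarith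
      _ = Real.exp ((-(β*x) - 2*δ + x^2/(2*A) + ε) * L) / 2 * Real.exp ((γ - e) * L) := by
        rw [div_mul_eq_mul_div, ← Real.exp_add, hγ]; congr 2; ring
      _ ≤ _ := by gcongr
  have t2 : 2 * Real.exp (β^2*a/2) * Real.exp (-(((d:ℝ)+1)^2 * q) / 4) ≤ Real.exp ((-(β*x) - 2*δ + x^2/(2*A) + ε) * L) / 2 := by
    have hg : Real.exp (γ/2*L) ≤ ((d:ℝ)+1)^2 * q := by
      refine le_trans (Real.exp_le_exp.2 ?_) hnq; nlinarith
    have h4 : (4:ℝ) ≤ Real.exp 4 := by linarith [Real.add_one_le_exp (4:ℝ)]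
    have hab := le_abs_self (β^2*A/2+β*x+γ)
    have : Real.exp (β^2*a/2) * Real.exp (-(((d:ℝ)+1)^2 * q) / 4) * Real.exp 4 ≤ Real.exp ((-(β*x) - 2*δ + x^2/(2*A) + ε) * L) := by
      rw [← Real.exp_add, ← Real.exp_add]
      refine Real.exp_le_exp.2 ?_
      rw [ha]
      have : (-(β*x) - 2*δ + x^2/(2*A) + ε) * L = -(β*x+γ)*L + ε*L := by rw [hγ]; ring
      rw [this]
      have : 0 < ε * L := by positivity
      nlinarith
    have hp := mul_pos (Real.exp_pos (β^2*a/2)) (Real.exp_pos (-(((d:ℝ)+1)^2 * q) / 4))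
    have := (mul_le_mul_of_nonneg_left h4 hp.le).trans this
    linarith
  linarith

lemma sum_Icc1 (f : ℕ → ℝ) (M : ℕ) : ∑ i ∈ Finset.Icc 1 M, f i = ∑ k ∈ Finset.range M, f (k+1) := by
  induction M with
  | zero => simp
  | succ M ih => rw [Finset.sum_Icc_succ_top (by omega), ih, Finset.sum_range_succ]

lemma sc_mem {M : ℕ} {sigv lamv : ℕ → ℝ} (hp : ScaleParams M sigv lamv) {i : ℕ} (hi : i ≤ M) : lamv i ∈ Set.Icc (0:ℝ) 1 := by
  obtain ⟨-, -, h0, h1, h2⟩ := hp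
  exact ⟨h0 ▸ lam_mono h2 i 0 (Nat.zero_le _) hi, h1 ▸ lam_mono h2 M i hi le_rfl⟩

lemma Jf_inc {M : ℕ} {sigv lamv : ℕ → ℝ} (hp : ScaleParams M sigv lamv) {s t : ℝ} (hs : 0 ≤ s) (hst : s ≤ t) (ht : t ≤ 1)
    {A B : ℝ} (h : ∀ i ∈ Finset.Icc 1 M, lamv (i-1) < t → s < lamv i → A ≤ sigv i ^ 2 ∧ sigv i ^ 2 ≤ B) :
    A * (t - s) ≤ Jf M sigv lamv t - Jf M sigv lamv s ∧ Jf M sigv lamv t - Jf M sigv lamv s ≤ B * (t - s) := by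
  obtain ⟨-, -, h0, h1, h2⟩ := hp
  have e : t - s = ∑ i ∈ Finset.Icc 1 M, ((min (lamv i) t - min (lamv (i-1)) t) - (min (lamv i) s - min (lamv (i-1)) s)) := by
    rw [sum_Icc1]
    simp only [Nat.add_sub_cancel]
    rw [Finset.sum_sub_distrib, Finset.sum_range_sub (fun i => min (lamv i) t), Finset.sum_range_sub (fun i => min (lamv i) s), h0, h1,
      min_eq_right ht, min_eq_left (hs.trans hst), min_eq_left hs, min_eq_right (hst.trans ht)]; ring
  have key : ∀ i ∈ Finset.Icc 1 M,
      A * ((min (lamv i) t - min (lamv (i-1)) t) - (min (lamv i) s - min (lamv (i-1)) s)) ≤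
      sigv i ^ 2 * ((min (lamv i) t - min (lamv (i-1)) t) - (min (lamv i) s - min (lamv (i-1)) s)) ∧
      sigv i ^ 2 * ((min (lamv i) t - min (lamv (i-1)) t) - (min (lamv i) s - min (lamv (i-1)) s)) ≤
      B * ((min (lamv i) t - min (lamv (i-1)) t) - (min (lamv i) s - min (lamv (i-1)) s)) := by
    intro i hi
    have hm : lamv (i-1) ≤ lamv i := lam_mono h2 i (i-1) (by omega) (Finset.mem_Icc.1 hi).2
    by_cases c : lamv (i-1) < t ∧ s < lamv i
    · have hn : 0 ≤ (min (lamv i) t - min (lamv (i-1)) t) - (min (lamv i) s - min (lamv (i-1)) s) := by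
        grind
      exact ⟨mul_le_mul_of_nonneg_right (h i hi c.1 c.2).1 hn, mul_le_mul_of_nonneg_right (h i hi c.1 c.2).2 hn⟩
    · have hn : (min (lamv i) t - min (lamv (i-1)) t) - (min (lamv i) s - min (lamv (i-1)) s) = 0 := by
        grind
      rw [hn]; simp
  rw [e, Finset.mul_sum, Finset.mul_sum, Jf, Jf, ← Finset.sum_sub_distrib]
  simp_rw [← mul_sub]
  exact ⟨Finset.sum_le_sum fun i hi => (key i hi).1, Finset.sum_le_sum fun i hi => (key i hi).2⟩

noncomputable def LpC (M : ℕ) (sigv : ℕ → ℝ) : ℝ := 1 + ∑ i ∈ Finset.Icc 1 M, sigv i ^ 2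

lemma LpC_pos (M : ℕ) (sigv : ℕ → ℝ) : 0 < LpC M sigv := by
  have : 0 ≤ ∑ i ∈ Finset.Icc 1 M, sigv i ^ 2 := Finset.sum_nonneg fun i _ => sq_nonneg _
  rw [LpC]; linarith

lemma Jf_lip {M : ℕ} {sigv lamv : ℕ → ℝ} (hp : ScaleParams M sigv lamv) {s t : ℝ} (hs : 0 ≤ s) (hst : s ≤ t) (ht : t ≤ 1) :
    0 ≤ Jf M sigv lamv t - Jf M sigv lamv s ∧ Jf M sigv lamv t - Jf M sigv lamv s ≤ LpC M sigv * (t - s) := by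
  have := Jf_inc hp hs hst ht (A := 0) (B := LpC M sigv) fun i hi _ _ => ⟨sq_nonneg _, by
    have := Finset.single_le_sum (f := fun i => sigv i ^ 2) (fun i _ => sq_nonneg _) hi
    rw [LpC]; linarith⟩
  rwa [zero_mul] at this

lemma Jf_zero {M : ℕ} {sigv lamv : ℕ → ℝ} (hp : ScaleParams M sigv lamv) : Jf M sigv lamv 0 = 0 := by
  refine Finset.sum_eq_zero fun i hi => ?_
  rw [Finset.mem_Icc] at hi
  rw [min_eq_right (sc_mem hp hi.2).1, min_eq_right (sc_mem hp (show i - 1 ≤ M by omega)).1]; simp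

lemma Jf_int {M : ℕ} {sigv lamv : ℕ → ℝ} (hp : ScaleParams M sigv lamv) {f : ℝ → ℝ}
    (hf : ∀ i ∈ Finset.Icc 1 M, ∀ r, lamv (i-1) < r → r ≤ lamv i → f r = sigv i) {s : ℝ} (hs : s ∈ Set.Icc (0:ℝ) 1) :
    ∫ r in (0:ℝ)..s, f r ^ 2 = Jf M sigv lamv s := by
  have hc : ∀ k < M, ∀ r ∈ Set.uIoc (min (lamv k) s) (min (lamv (k+1)) s), f r ^ 2 = sigv (k+1) ^ 2 := by
    intro k hk r hr
    have hm := hp.2.2.2.2 k hk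
    rw [Set.uIoc_of_le (by grind)] at hr
    rw [hf (k+1) (by simp; omega) r (by simp; grind) (by grind)]
  have h1 := intervalIntegral.sum_integral_adjacent_intervals (f := fun r => f r ^ 2) (μ := volume) (a := fun k => min (lamv k) s) (n := M)
    (fun k hk => (intervalIntegrable_const (c := sigv (k+1) ^ 2)).congr fun r hr => (hc k hk r hr).symm)
  rw [hp.2.2.1, hp.2.2.2.1, min_eq_left hs.1, min_eq_right hs.2] at h1
  rw [← h1, Jf, sum_Icc1]
  refine Finset.sum_congr rfl fun k hk => ?_
  rw [intervalIntegral.integral_congr_ae (g := fun _ => sigv (k+1) ^ 2) (ae_of_all _ fun r hr => hc k (Finset.mem_range.1 hk) r hr)]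
  rw [intervalIntegral.integral_const, smul_eq_mul, mul_comm]; simp

lemma step_val {M : ℕ} {sigv lamv : ℕ → ℝ} (hp : ScaleParams M sigv lamv) : ∀ i ∈ Finset.Icc 1 M, ∀ r, lamv (i-1) < r → r ≤ lamv i →
    stepFn M sigv lamv r = sigv i := by
  intro i hi r h1 h2
  rw [Finset.mem_Icc] at hi
  have hr : 0 < r := (sc_mem hp (show i - 1 ≤ M by omega)).1.trans_lt h1
  rw [stepFn, if_neg hr.ne', zero_add, Finset.sum_eq_single i]
  · rw [if_pos ⟨h1, h2⟩]
  · intro j hj hji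
    rw [Finset.mem_Icc] at hj
    rw [if_neg]
    rintro ⟨h3, h4⟩
    rcases Nat.lt_or_gt_of_ne hji with h | h
    · have := lam_mono hp.2.2.2.2 (i-1) j (by omega) (by omega); linarith
    · have := lam_mono hp.2.2.2.2 (j-1) i (by omega) (by omega); linarith
  · intro h; exact absurd (Finset.mem_Icc.2 hi) h

lemma eff_sc {M : ℕ} {sigv lamv : ℕ → ℝ} {m : ℕ} {sigb lamb : ℕ → ℝ} {sigbar : ℝ → ℝ}
    (he : EffParams M sigv lamv m sigb lamb sigbar) : ScaleParams m sigb lamb := by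
  obtain ⟨h1, -, h2, h3, h4, -, h5, -⟩ := he
  exact ⟨h1, h5, h2, h3, h4⟩

lemma hull_facts {M : ℕ} {sigv lamv : ℕ → ℝ} (hp : ScaleParams M sigv lamv) {m : ℕ} {sigb lamb : ℕ → ℝ} {sigbar : ℝ → ℝ}
    (he : EffParams M sigv lamv m sigb lamb sigbar) :
    (∀ s ∈ Set.Icc (0:ℝ) 1, Jf M sigv lamv s ≤ Jf m sigb lamb s) ∧
    (∀ l ≤ m, Jf m sigb lamb (lamb l) = Jf M sigv lamv (lamb l)) := by
  have hb := eff_sc he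
  obtain ⟨-, -, -, -, -, hdec, hpos, -, hval, hhull⟩ := he
  have hJ : ∀ s ∈ Set.Icc (0:ℝ) 1, Jsig2 M sigv lamv s = Jf M sigv lamv s := fun s hs => Jf_int hp (step_val hp) hs
  have hH : ∀ s : ℝ, 0 < s → s ≤ 1 → concaveHull (Jsig2 M sigv lamv) s = Jf m sigb lamb s := fun s h0 h1 => by
    rw [hhull s h0 h1]; exact Jf_int hb hval ⟨h0.le, h1⟩
  have hle : ∀ s ∈ Set.Icc (0:ℝ) 1, Jf M sigv lamv s ≤ Jf m sigb lamb s := by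
    intro s hs
    rcases hs.1.eq_or_lt with h | h
    · rw [← h, Jf_zero hp, Jf_zero hb]
    · rw [← hH s h hs.2]
      refine le_csInf ⟨_, fun _ => Jf M sigv lamv 1, concaveOn_const _ (convex_Icc _ _), fun t ht => ?_, rfl⟩ ?_
      · rw [hJ t ht]; linarith [(Jf_lip hp ht.1 ht.2 le_rfl).1]
      · rintro y ⟨g, -, hg, rfl⟩
        rw [← hJ s hs]; exact hg s hs
  refine ⟨hle, fun l hl => ?_⟩
  rcases Nat.eq_zero_or_pos l with h0 | h0
  · rw [h0, hb.2.2.1, Jf_zero hp, Jf_zero hb]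
  refine le_antisymm ?_ (hle _ (sc_mem hb hl))
  by_contra hlt
  push Not at hlt
  have hx := sc_mem hb hl
  have hx0 : 0 < lamb l := lt_of_le_of_lt (sc_mem hb (show l - 1 ≤ m by omega)).1 (by
    have := hb.2.2.2.2 (l-1) (by omega); rwa [Nat.sub_add_cancel h0] at this)
  -- the slope
  have hanti : ∀ j, 1 ≤ j → ∀ i, 1 ≤ i → i ≤ j → j ≤ m → sigb j ≤ sigb i := by
    intro j hj
    induction j, hj using Nat.le_induction with
    | base => intro i h1 h2 _; rw [le_antisymm h2 h1]
    | succ j hj ih =>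
      intro i h1 h2 h3
      rcases Nat.lt_or_ge i (j+1) with h | h
      · exact (hdec j hj (by omega)).le.trans (ih i h1 (by omega) (by omega))
      · rw [le_antisymm h2 h]
  have hsl : 0 < sigb l := hpos l (Finset.mem_Icc.2 ⟨h0, hl⟩)
  obtain ⟨b, hb0, hbl, hbd⟩ : ∃ b, 0 ≤ b ∧ b < sigb l ∧ ∀ j ∈ Finset.Icc 1 m, l < j → sigb j ≤ b := by
    rcases hl.eq_or_lt with h | h
    · exact ⟨0, le_rfl, hsl, fun j hj hlj => by rw [Finset.mem_Icc] at hj; omega⟩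
    · refine ⟨sigb (l+1), (hpos _ (Finset.mem_Icc.2 ⟨by omega, h⟩)).le, hdec l h0 h, fun j hj hlj => ?_⟩
      exact hanti j (by omega) (l+1) (by omega) (by omega) (Finset.mem_Icc.1 hj).2
  have hbs : b ^ 2 < sigb l ^ 2 := by nlinarith
  set c := (sigb l ^ 2 - b ^ 2) / 2 with hc
  set θ := (sigb l ^ 2 + b ^ 2) / 2 with hθ
  have hc0 : 0 < c := by rw [hc]; linarith
  have hθ0 : 0 < θ := by rw [hθ]; nlinarith [sq_nonneg b]
  set x := lamb l with hxd
  have kr : ∀ s, x ≤ s → s ≤ 1 → Jf m sigb lamb s ≤ Jf m sigb lamb x + (θ - c) * (s - x) := by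
    intro s h1 h2
    have := (Jf_inc hb hx.1 h1 h2 (A := 0) (B := b^2) (fun i hi _ hxi => ⟨sq_nonneg _, ?_⟩)).2
    · rw [show θ - c = b^2 by rw [hθ, hc]; ring]; linarith
    · have : l < i := by
        by_contra hn; have := lam_mono hb.2.2.2.2 l i (by omega) hl; linarith
      have h3 := hbd i hi this
      have := hpos i hi
      gcongr
  have kl : ∀ s, 0 ≤ s → s ≤ x → Jf m sigb lamb s ≤ Jf m sigb lamb x + (θ + c) * (s - x) := by
    intro s h1 h2
    have := (Jf_inc hb h1 h2 hx.2 (A := sigb l ^2) (B := LpC m sigb) (fun i hi hxi _ => ⟨?_, by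
      have := Finset.single_le_sum (f := fun i => sigb i ^ 2) (fun i _ => sq_nonneg _) hi
      rw [LpC]; linarith⟩)).1
    · rw [show θ + c = sigb l^2 by rw [hθ, hc]; ring]; linarith
    · rw [Finset.mem_Icc] at hi
      have : i ≤ l := by
        by_contra hn; have := lam_mono hb.2.2.2.2 (i-1) l (by omega) (by omega); linarith
      have h3 := hanti l h0 i hi.1 this hl
      gcongr
  set gap := Jf m sigb lamb x - Jf M sigv lamv x with hgap
  have hg0 : 0 < gap := by linarith
  have hLp := LpC_pos M sigv
  set e := gap / (2 * (LpC M sigv + θ)) with hed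
  have he0 : 0 < e := by positivity
  have hee : (LpC M sigv + θ) * e = gap / 2 := by rw [hed]; field_simp
  set η := min (gap/2) (c * e) with hη
  have hη0 : 0 < η := lt_min (by linarith) (by positivity)
  have hη1 : η ≤ gap / 2 := min_le_left _ _
  have hη2 : η ≤ c * e := min_le_right _ _
  have hmaj : ∀ s ∈ Set.Icc (0:ℝ) 1, Jsig2 M sigv lamv s ≤ Jf m sigb lamb x - η + θ * (s - x) := by
    intro s hs
    rw [hJ s hs]
    rcases le_total x s with h | h
    · rcases le_total (s - x) e with h1 | h1
      · have := (Jf_lip hp hx.1 h hs.2).2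
        nlinarith
      · have := kr s h hs.2
        have := hle s hs
        nlinarith
    · rcases le_total (x - s) e with h1 | h1
      · have := (Jf_lip hp hs.1 h hx.2).1
        nlinarith
      · have := kl s hs.1 h
        have := hle s hs
        nlinarith
  have hfin : concaveHull (Jsig2 M sigv lamv) x ≤ Jf m sigb lamb x - η + θ * (x - x) := by
    refine csInf_le ⟨Jsig2 M sigv lamv x, ?_⟩ ⟨fun s => Jf m sigb lamb x - η + θ * (s - x), ?_, hmaj, rfl⟩
    · rintro y ⟨g, -, hg, rfl⟩; exact hg x hx
    · refine ⟨convex_Icc _ _, fun u _ v _ a b _ _ hab => le_of_eq ?_⟩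
      simp only [smul_eq_mul]
      have : b = 1 - a := by linarith
      rw [this]; ring
  rw [hH x hx0 hx.2] at hfin
  linarith

lemma eff_block {m : ℕ} {sigb lamb : ℕ → ℝ} (hb : ScaleParams m sigb lamb) {l : ℕ} (hl : l ∈ Finset.Icc 1 m) {s t : ℝ}
    (hs : lamb (l-1) ≤ s) (hst : s ≤ t) (ht : t ≤ lamb l) : Jf m sigb lamb t - Jf m sigb lamb s = sigb l ^ 2 * (t - s) := by
  have hl' := Finset.mem_Icc.1 hl
  have := Jf_inc hb ((sc_mem hb (show l - 1 ≤ m by omega)).1.trans hs) hst (ht.trans (sc_mem hb hl'.2).2) (A := sigb l ^ 2) (B := sigb l ^ 2)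
    (fun i hi h1 h2 => by
      rw [Finset.mem_Icc] at hi
      have : i = l := by
        rcases Nat.lt_trichotomy i l with h | h | h
        · have := lam_mono hb.2.2.2.2 (l-1) i (by omega) (by omega); linarith
        · exact h
        · have := lam_mono hb.2.2.2.2 (i-1) l (by omega) (by omega); linarith
      rw [this]; exact ⟨le_rfl, le_rfl⟩)
  linarith

lemma CG.comap {V W : Type*} [Fintype V] [Fintype W] {ν : Measure (W → ℝ)} {D : W → W → ℝ} (h : CG ν D) (ι : V → W) :
    CG (ν.map (fun x v => x (ι v))) (fun v w => D (ι v) (ι w)) := by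
  have hm : Measurable (fun (x : W → ℝ) v => x (ι v)) := by fun_prop
  have := h.1
  refine ⟨Measure.isProbabilityMeasure_map hm.aemeasurable, fun L => ?_, fun v w => ?_⟩
  · obtain ⟨s, hs⟩ := h.2.1 (L.comp (ContinuousLinearMap.pi fun v => ContinuousLinearMap.proj (ι v)))
    refine ⟨s, ?_⟩
    rw [Measure.map_map (by fun_prop) hm, ← hs]; rfl
  · rw [integral_map (f := fun x : V → ℝ => x v * x w) hm.aemeasurable (Measurable.aestronglyMeasurable (by fun_prop))]
    exact h.2.2 _ _

lemma psi_MM {V : Type*} [Fintype V] {N : ℕ} {P : Measure FieldSp} (h : IsGFF N P) (M : ℕ) (sigv lamv : ℕ → ℝ)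
    (x : V → Vtx) (hx : ∀ v, x v ∈ VN N) (β s : ℝ) :
    MM β s (P.map (fun ω v => lin N (gg N M sigv lamv (x v)) ω)) =
      ∫⁻ ω, ENNReal.ofReal ((∑ v, Real.exp (β * psiFld N M sigv lamv P (x v) ω)) ^ s) ∂P := by
  unfold MM
  rw [lintegral_map (f := fun y : V → ℝ => ENNReal.ofReal ((∑ v, Real.exp (β * y v)) ^ s)) (by fun_prop)
    (lin_fam_meas N _)]
  refine lintegral_congr_ae ?_
  filter_upwards [psi_all h M sigv lamv] with ω hω
  congr 3
  funext v
  rw [hω _ (hx v)]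

/-- summand of the free energy -/
noncomputable def hj (β s : ℝ) : ℝ := if β ≤ 2 / s then 1 + β^2*s^2/4 else β*s

lemma sigb_anti {m : ℕ} {sigb : ℕ → ℝ} (hd : ∀ l, 1 ≤ l → l < m → sigb (l + 1) < sigb l) :
    ∀ j, ∀ i, 1 ≤ i → i ≤ j → j ≤ m → sigb j ≤ sigb i := by
  intro j
  induction j with
  | zero => intro i h1 h2; omega
  | succ j ih =>
    intro i h1 h2 h3
    rcases Nat.lt_or_ge j i with h | h
    · rw [show i = j+1 by omega]
    · exact (hd j (by omega) (by omega)).le.trans (ih i h1 h (by omega))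

lemma fpsi_eq {M : ℕ} {sigv lamv : ℕ → ℝ} {m : ℕ} {sigb lamb : ℕ → ℝ} {sigbar : ℝ → ℝ}
    (he : EffParams M sigv lamv m sigb lamb sigbar) (β : ℝ) :
    fpsiLim m sigb lamb β = ∑ j ∈ Finset.Icc 1 m, hj β (sigb j) * (lamb j - lamb (j-1)) := by
  obtain ⟨hm, -, -, -, -, hd, hpos, -⟩ := he
  have hmono := sigb_anti hd
  obtain ⟨l, hl, hl1, hlm, hlj⟩ : ∃ l, lbeta m sigb β = l ∧ 1 ≤ l ∧ l ≤ m+1 ∧ ∀ j ∈ Finset.Icc 1 m, (j < l ↔ ¬ β ≤ 2 / sigb j) := by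
    have hcomp : ∀ i j, 1 ≤ i → i ≤ j → j ≤ m → 2/sigb i ≤ 2/sigb j := by
      intro i j h1 h2 h3
      have := hmono j i h1 h2 h3
      have := hpos j (by simp; omega)
      gcongr
    unfold lbeta
    split_ifs with hb
    · have hmem : m ∈ {l : ℕ | 1 ≤ l ∧ β ≤ 2 / sigb l} := ⟨hm, hb⟩
      have h1 := Nat.sInf_mem ⟨m, hmem⟩
      have h2 := Nat.sInf_le hmem
      refine ⟨_, rfl, h1.1, by omega, fun j hj => ?_⟩
      simp only [Finset.mem_Icc] at hj
      constructor
      · intro hlt hle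
        have := Nat.sInf_le (s := {l : ℕ | 1 ≤ l ∧ β ≤ 2 / sigb l}) ⟨hj.1, hle⟩
        omega
      · intro hn
        by_contra hc
        exact hn (h1.2.trans (hcomp _ _ h1.1 (by omega) hj.2))
    · refine ⟨_, rfl, by omega, le_rfl, fun j hj => ?_⟩
      simp only [Finset.mem_Icc] at hj
      refine ⟨fun _ hc => hb (hc.trans (hcomp _ _ hj.1 hj.2 le_rfl)), fun _ => by omega⟩
  unfold fpsiLim
  rw [hl]
  have e1 : Finset.Icc 1 (l-1) = Finset.Ico 1 l := by ext; simp; omega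
  have e2 : Finset.Icc l m = Finset.Ico l (m+1) := by ext; simp
  have e3 : Finset.Icc 1 m = Finset.Ico 1 (m+1) := by ext; simp
  rw [e1, e2, e3, ← Finset.sum_Ico_consecutive _ hl1 hlm]
  congr 1
  · refine Finset.sum_congr rfl fun j hj' => ?_
    simp only [Finset.mem_Ico] at hj'
    rw [hj, if_neg ((hlj j (by simp; omega)).1 hj'.2)]
    have := hpos j (by simp; omega)
    field_simp
  · refine Finset.sum_congr rfl fun j hj' => ?_
    simp only [Finset.mem_Ico] at hj'
    have h2 := (hlj j (by simp; omega)).not.1 (by omega)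
    rw [not_not] at h2
    rw [hj, if_pos h2]
    have := hpos j (by simp; omega)
    field_simp
    norm_num
    ring

lemma hj_P {β s p : ℝ} (hβ : 0 < β) (hs : 0 < s) (hp : p = min 1 (2/(s*β))) : 2/p + β^2*p*s^2/2 = 2*hj β s := by
  have hsb : 0 < s*β := by positivity
  unfold hj
  split_ifs with h
  · rw [le_div_iff₀ hs] at h
    rw [hp, min_eq_left (by rw [le_div_iff₀ hsb]; linarith)]
    ring
  · push Not at h
    rw [div_lt_iff₀ hs] at h
    rw [hp, min_eq_right (by rw [div_le_iff₀ hsb]; linarith)]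
    field_simp
    ring

lemma tele_sum (φ : ℕ → ℝ) {n k : ℕ} (h : k ≤ n) : ∑ j ∈ Finset.range k, (φ (n-j) - φ (n-j-1)) = φ n - φ (n-k) := by
  induction k with
  | zero => simp
  | succ k ih => rw [Finset.sum_range_succ, ih (by omega), Nat.sub_sub]; ring

lemma refl_sum (f : ℕ → ℝ) (n : ℕ) : ∑ k ∈ Finset.range n, f (n-k) = ∑ j ∈ Finset.Icc 1 n, f j := by
  rw [sum_Icc1, ← Finset.sum_range_reflect]
  refine Finset.sum_congr rfl fun k hk => ?_
  simp only [Finset.mem_range] at hk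
  congr 1; omega

lemma Jf_lip2 {M : ℕ} {sigv lamv : ℕ → ℝ} (hp : ScaleParams M sigv lamv) {s t d : ℝ} (hs0 : 0 ≤ s) (hs1 : s ≤ 1)
    (ht0 : 0 ≤ t) (ht1 : t ≤ 1) (hd : 0 ≤ d) (h : t - s ≤ d) : Jf M sigv lamv t - Jf M sigv lamv s ≤ LpC M sigv * d := by
  have hL := LpC_pos M sigv
  rcases le_total s t with hst | hst
  · have := (Jf_lip hp hs0 hst ht1).2
    nlinarith
  · have := (Jf_lip hp ht0 hst hs1).1
    have : 0 ≤ LpC M sigv * d := by positivity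
    linarith

lemma up_tree {M : ℕ} {sigv lamv : ℕ → ℝ} (hp : ScaleParams M sigv lamv) {m : ℕ} {sigb lamb : ℕ → ℝ} {sigbar : ℝ → ℝ}
    (he : EffParams M sigv lamv m sigb lamb sigbar) {β : ℝ} (hβ : 0 < β) :
    ∃ C' : ℝ, ∀ N : ℕ, 2 ≤ N → ∀ ρ : ℝ, 0 ≤ ρ → ρ ≤ 1 →
      ∃ (W : Type) (_ : Fintype W) (_ : Nonempty W) (ν : Measure (W → ℝ)) (D : W → W → ℝ) (ι : Vtx → W),
        CG ν D ∧ (∀ w, D w w = Real.log N * (Jf M sigv lamv 1 - Jf M sigv lamv ρ)) ∧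
        (∀ v ∈ VN N, ∀ w ∈ VN N, D (ι v) (ι w) ≤ Real.log N * (Jf M sigv lamv (max (1 - Real.log (nrm (v-w)) / Real.log N) ρ)
            - Jf M sigv lamv ρ) + LpC M sigv * Real.log 2) ∧
        (∀ v ∈ VN N, ∀ w ∈ VN N, ι v = ι w → v = w) ∧
        MM β (min 1 (2/(sigb 1 * β))) ν ≤ ENNReal.ofReal (Real.exp (min 1 (2/(sigb 1 * β)) *
          (2 * fpsiLim m sigb lamb β * Real.log N + C'))) := by
  have hb := eff_sc he
  have hhull := hull_facts hp he
  have hf := fpsi_eq he β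
  obtain ⟨hm, -, hl0, hl1, hlinc, hd, hpos, -⟩ := he
  have hanti := sigb_anti hd
  have hlm := lam_mono hlinc
  set Pk : ℕ → ℝ := fun k => min 1 (2/(sigb (max (m-k) 1) * β)) with hPk
  set J := Jf M sigv lamv with hJ
  have hPpos : ∀ k, 0 < Pk k := by
    intro k
    have := hpos (max (m-k) 1) (by simp; omega)
    simp only [hPk]; positivity
  have hPanti : Antitone Pk := by
    intro i j hij
    simp only [hPk]
    have := hpos (max (m-i) 1) (by simp; omega)
    have h2 := hanti (max (m-i) 1) (max (m-j) 1) (by omega) (by omega) (by omega)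
    gcongr
  refine ⟨∑ k ∈ Finset.range m, 2 * Real.log 3 / Pk k, fun N hN ρ hρ0 hρ1 => ?_⟩
  have hN1 : (1:ℝ) < N := by exact_mod_cast hN
  have hN0 : (0:ℝ) < N := by linarith
  set L := Real.log N with hL
  have hLp : 0 < L := Real.log_pos hN1
  have hlog2 : 0 < Real.log 2 := Real.log_pos (by norm_num)
  set u : ℕ → ℝ := fun k => 1 - lamb (m-k) with hu
  have hu0 : ∀ k, 0 ≤ u k := fun k => by
    have := (sc_mem hb (show m-k ≤ m by omega)).2; simp only [hu]; linarith
  have hum : Monotone u := by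
    intro i j hij
    have := hlm (m-i) (m-j) (by omega) (by omega)
    simp only [hu]; linarith
  set X : ℕ → ℝ := fun k => (N:ℝ) ^ (u k) with hX
  have hX1 : ∀ k, 1 ≤ X k := fun k => Real.one_le_rpow hN1.le (hu0 k)
  have hXm : Monotone X := fun i j hij => Real.rpow_le_rpow_of_exponent_le hN1.le (hum hij)
  set S : ℕ → ℕ := fun k => ⌊X k⌋₊ + (if k = 0 then 0 else 1) with hS
  have hS0 : S 0 = 1 := by
    simp only [hS, hX, hu, Nat.sub_zero, hl1]; simp
  have hSm : Monotone S := by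
    intro i j hij
    have h1 := Nat.floor_mono (hXm hij)
    simp only [hS]
    split_ifs <;> omega
  have hSlo : ∀ k, X k ≤ S k := by
    intro k
    rcases Nat.eq_zero_or_pos k with rfl | hk
    · rw [hS0]; simp only [hX, hu, Nat.sub_zero, hl1]; simp
    · simp only [hS, if_neg hk.ne']
      push_cast
      exact (Nat.lt_floor_add_one _).le
  have hShi : ∀ k, (S k : ℝ) ≤ 2 * X k := by
    intro k
    have h1 := Nat.floor_le (zero_le_one.trans (hX1 k))
    have h2 := hX1 k
    have h3 : ((if k = 0 then 0 else 1 : ℕ):ℝ) ≤ 1 := by split_ifs <;> simp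
    simp only [hS]; push_cast at h3 ⊢
    linarith
  have hmx : ∀ x : ℝ, x ≤ 1 → 0 ≤ max x ρ ∧ max x ρ ≤ 1 := fun x hx => ⟨hρ0.trans (le_max_right _ _), max_le hx hρ1⟩
  have hlmem : ∀ k, lamb (m-k) ≤ 1 := fun k => (sc_mem hb (show m-k ≤ m by omega)).2
  have ha0 : ∀ k, 0 ≤ L * (J (max (lamb (m-k)) ρ) - J (max (lamb (m-k-1)) ρ)) := by
    intro k
    have h1 := hlm (m-k) (m-k-1) (by omega) (by omega)
    exact mul_nonneg hLp.le (Jf_lip hp (hmx _ (h1.trans (hlmem k))).1 (max_le_max_right _ h1) (hmx _ (hlmem k)).2).1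
  set a : ℕ → NNReal := fun k => ⟨_, ha0 k⟩ with ha
  have hac : ∀ k, (a k : ℝ) = L * (J (max (lamb (m-k)) ρ) - J (max (lamb (m-k-1)) ρ)) := fun k => rfl
  have hasum : ∀ k ≤ m, ∑ j ∈ Finset.range k, (a j : ℝ) = L * (J 1 - J (max (lamb (m-k)) ρ)) := by
    intro k hk
    simp_rw [hac]
    rw [← Finset.mul_sum, tele_sum (fun i => J (max (lamb i) ρ)) hk, hl1, max_eq_left hρ1]
  have hlg : ∀ r : ℝ, 1 - Real.log (max r 1) / L ≤ 1 := fun r => by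
    have : 0 ≤ Real.log (max r 1) / L := div_nonneg (Real.log_nonneg (le_max_right _ _)) hLp.le
    linarith
  set F : ℝ → ℝ := fun r => L * (J 1 - J (max (1 - Real.log (max r 1) / L) ρ)) - LpC M sigv * Real.log 2 with hF
  have hFm : Monotone F := by
    intro r r' hr
    have h1 : Real.log (max r 1) ≤ Real.log (max r' 1) :=
      Real.log_le_log (by positivity) (max_le_max_right _ hr)
    have h2 : 1 - Real.log (max r' 1) / L ≤ 1 - Real.log (max r 1) / L := by gcongr
    have h3 := (Jf_lip hp (hmx _ (hlg r')).1 (max_le_max_right ρ h2) (hmx _ (hlg r)).2).1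
    simp only [hF]
    gcongr
    linarith
  have hFS : ∀ k ≤ m, F (S k) ≤ ∑ j ∈ Finset.range k, (a j : ℝ) := by
    intro k hk
    rw [hasum k hk]
    simp only [hF]
    have hS1 : (1:ℝ) ≤ S k := (hX1 k).trans (hSlo k)
    have h1 : Real.log (S k) ≤ Real.log 2 + u k * L := by
      rw [hL, ← Real.log_rpow hN0, ← Real.log_mul (by norm_num) (by positivity)]
      exact Real.log_le_log (by linarith) (hShi k)
    have h2 : max (lamb (m-k)) ρ - max (1 - Real.log (S k) / L) ρ ≤ Real.log 2 / L := by
      have : lamb (m-k) - Real.log 2 / L ≤ 1 - Real.log (S k) / L := by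
        have h4 : Real.log (S k) / L ≤ Real.log 2 / L + u k := by
          rw [div_add' _ _ _ hLp.ne']; gcongr
        simp only [hu] at h4; linarith
      have h5 : 0 ≤ Real.log 2 / L := by positivity
      rw [sub_le_iff_le_add]
      refine max_le ?_ ?_
      · linarith [le_max_left (1 - Real.log (S k) / L) ρ]
      · linarith [le_max_right (1 - Real.log (S k) / L) ρ]
    have h0 := hlg (S k)
    rw [max_eq_left hS1] at h0 ⊢
    have h3 := Jf_lip2 hp (hmx _ h0).1 (hmx _ h0).2 (hmx _ (hlmem k)).1 (hmx _ (hlmem k)).2 (by positivity) h2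
    have h4 : L * (J (max (lamb (m-k)) ρ) - J (max (1 - Real.log (S k) / L) ρ)) ≤ LpC M sigv * Real.log 2 := by
      calc _ ≤ L * (LpC M sigv * (Real.log 2 / L)) := by gcongr
        _ = _ := by field_simp
    linarith
  obtain ⟨W, i1, i2, ν, D, ι, hCG, hDD, hDF, hinj, hMM⟩ := tree_up S hS0 hSm a F hFm Pk hPpos (fun k => min_le_left _ _) hPanti β m hFS
  have hbx : ∀ v ∈ VN N, bx (S m) v := by
    intro v hv
    rw [mem_VN] at hv
    have : S m = N + 1 := by
      simp only [hS, hX, hu, Nat.sub_self, hl0]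
      rw [if_neg (by omega)]; simp
    rw [bx, this]; push_cast; omega
  have hDs : ∑ j ∈ Finset.range m, (a j : ℝ) = L * (J 1 - J ρ) := by
    rw [hasum m le_rfl, Nat.sub_self, hl0, max_eq_right hρ0]
  refine ⟨W, i1, i2, ν, D, ι, hCG, fun w => by rw [hDD, hDs], fun v hv w hw => ?_, fun v hv w hw => hinj v w (hbx v hv) (hbx w hw), ?_⟩
  · have := hDF v w (hbx v hv) (hbx w hw)
    rw [hDs] at this
    simp only [hF] at this
    rw [max_eq_left (one_le_nrm _)] at this
    linarith
  · have hp1 : min 1 (2/(sigb 1 * β)) = Pk m := by simp [hPk]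
    rw [hp1]
    refine (hMM (Pk m) (hPpos m) (fun k hk => hPanti hk.le)).trans ?_
    refine ENNReal.ofReal_le_ofReal (Real.exp_le_exp.2 (mul_le_mul_of_nonneg_left ?_ (hPpos m).le))
    rw [hf, ← refl_sum (fun j => hj β (sigb j) * (lamb j - lamb (j-1))), Finset.mul_sum, Finset.sum_mul,
      ← Finset.sum_add_distrib]
    refine Finset.sum_le_sum fun k hk => ?_
    simp only [Finset.mem_range] at hk
    have hmk : m - k ∈ Finset.Icc 1 m := by simp; omega
    have hδ : 0 < lamb (m-k) - lamb (m-k-1) := by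
      have := hlinc (m-k-1) (by omega)
      rw [show m-k-1+1 = m-k by omega] at this; linarith
    have hPk' := hj_P (p := Pk k) hβ (hpos _ hmk) (by simp only [hPk]; rw [max_eq_left (by omega)])
    have hal : (a k:ℝ) ≤ L * (sigb (m-k)^2 * (lamb (m-k) - lamb (m-k-1))) := by
      rw [hac, ← eff_block hb hmk le_rfl (by linarith) le_rfl, hhull.2 _ (by omega), hhull.2 _ (by omega)]
      refine mul_le_mul_of_nonneg_left ?_ hLp.le
      have q0 := (sc_mem hb (show m-k-1 ≤ m by omega)).1
      rcases le_total (lamb (m-k)) ρ with h | h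
      · rw [max_eq_right h, max_eq_right (by linarith), sub_self]
        exact (Jf_lip hp q0 (by linarith) (hlmem k)).1
      · rw [max_eq_left h]
        have := (Jf_lip hp q0 (le_max_left _ ρ) (hmx _ (by linarith [hlmem k])).2).1
        linarith
    have hq : Real.log (((S (k+1) / S k : ℕ) + 1 : ℝ)^2) ≤ 2 * Real.log 3 + 2 * (lamb (m-k) - lamb (m-k-1)) * L := by
      have hXr : X (k+1) = X k * (N:ℝ) ^ (lamb (m-k) - lamb (m-k-1)) := by
        simp only [hX]
        rw [← Real.rpow_add hN0]; congr 1; simp only [hu]; rw [Nat.sub_sub]; ring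
      have hr1 : 1 ≤ (N:ℝ) ^ (lamb (m-k) - lamb (m-k-1)) := Real.one_le_rpow hN1.le hδ.le
      have h1 : ((S (k+1) / S k : ℕ) : ℝ) ≤ 2 * (N:ℝ) ^ (lamb (m-k) - lamb (m-k-1)) := by
        have hSk : (0:ℝ) < S k := lt_of_lt_of_le zero_lt_one ((hX1 k).trans (hSlo k))
        refine (Nat.cast_div_le).trans ?_
        rw [div_le_iff₀ hSk]
        have := hShi (k+1)
        have := hSlo k
        rw [hXr] at *
        nlinarith
      have h2 : ((S (k+1) / S k : ℕ) : ℝ) + 1 ≤ 3 * (N:ℝ) ^ (lamb (m-k) - lamb (m-k-1)) := by linarith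
      rw [Real.log_pow]
      have h3 := Real.log_le_log (by positivity) h2
      rw [Real.log_mul (by norm_num) (by positivity), Real.log_rpow hN0] at h3
      push_cast; linarith
    have hPp := hPpos k
    have hkey : 2 * (hj β (sigb (m-k)) * (lamb (m-k) - lamb (m-k-1))) * L =
      (2/Pk k + β^2*Pk k*sigb (m-k)^2/2) * (lamb (m-k) - lamb (m-k-1)) * L := by rw [hPk']; ring
    rw [hkey]
    calc _ ≤ (2 * Real.log 3 + 2 * (lamb (m-k) - lamb (m-k-1)) * L) / Pk k + β^2 * Pk k * (L * (sigb (m-k)^2 * (lamb (m-k) - lamb (m-k-1)))) / 2 := by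
          gcongr
      _ = _ := by ring

lemma MM_pull {V W : Type*} [Fintype V] [Fintype W] (β : ℝ) {s : ℝ} (hs : 0 ≤ s) (ν : Measure (W → ℝ)) (ι : V → W)
    (hι : Function.Injective ι) : MM β s (ν.map (fun x v => x (ι v))) ≤ MM β s ν := by
  unfold MM
  rw [lintegral_map (f := fun y : V → ℝ => ENNReal.ofReal ((∑ v, Real.exp (β * y v)) ^ s)) (by fun_prop) (by fun_prop)]
  refine lintegral_mono fun x => ENNReal.ofReal_le_ofReal (Real.rpow_le_rpow (by positivity) ?_ hs)
  rw [← Finset.sum_image (s := Finset.univ) (g := ι) (f := fun w => Real.exp (β * x w)) (fun a _ b _ h => hι h)]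
  exact Finset.sum_le_univ_sum_of_nonneg fun w => (Real.exp_pos _).le

lemma ev_log (B : ℝ) : ∃ N₀ : ℕ, ∀ N ≥ N₀, B ≤ Real.log (N:ℝ) :=
  eventually_atTop.1 ((Real.tendsto_log_atTop.comp tendsto_natCast_atTop_atTop).eventually_ge_atTop B)

lemma class_up {M : ℕ} {sigv lamv : ℕ → ℝ} (hp : ScaleParams M sigv lamv) {m : ℕ} {sigb lamb : ℕ → ℝ} {sigbar : ℝ → ℝ}
    (he : EffParams M sigv lamv m sigb lamb sigbar) {β ε p : ℝ} (hβ : 0 < β) (hε : 0 < ε) (hpe : p = min 1 (2/(sigb 1 * β))) (hp0 : 0 < p) :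
    ∃ κ : ℝ, 0 < κ ∧ ∃ N₀ : ℕ, 2 ≤ N₀ ∧ ∀ N ≥ N₀, ∀ P : Measure FieldSp, IsGFF N P → ∀ ρ : ℝ, 0 ≤ ρ → ρ ≤ 1 → ∀ V : Finset Vtx,
      V ⊆ VN N → (∀ v ∈ V, |Real.log (dd N v) - (1-ρ) * Real.log N| ≤ κ * Real.log N) →
      ∫⁻ ω, ENNReal.ofReal ((∑ v ∈ V, Real.exp (β * psiFld N M sigv lamv P v ω)) ^ p) ∂P ≤
        ENNReal.ofReal (Real.exp (p * (2 * fpsiLim m sigb lamb β + ε) * Real.log N)) := by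
  obtain ⟨C', hT⟩ := up_tree hp he hβ
  obtain ⟨S, hS, hcov⟩ := cov_est hp
  have hp1 : p ≤ 1 := hpe ▸ min_le_left _ _
  set e : ℝ := p*ε/(2*β^2) with hedef
  have hepos : 0 < e := by positivity
  obtain ⟨N1, hN1, hcov⟩ := hcov (e/2) (by positivity)
  obtain ⟨N2, hN2⟩ := ev_log ((β^2*(LpC M sigv * Real.log 2)/2 + p*C')/(p*ε/2))
  refine ⟨e/(2*S), by positivity, max N1 N2, by omega, fun N hN P hP ρ hρ0 hρ1 V hV hdd => ?_⟩
  obtain ⟨W, i1, i2, ν, D, ι, hCG, hDD, hDle, hinj, hMM⟩ := hT N (by omega) ρ hρ0 hρ1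
  have hL := hN2 N (by omega)
  have hcov := hcov N (by omega) (e/(2*S)) ρ
  have hLp : 0 < Real.log N := Real.log_pos (by exact_mod_cast (show 1 < N by omega))
  set L := Real.log N
  rw [div_le_iff₀ (by positivity)] at hL
  rcases V.eq_empty_or_nonempty with rfl | hne
  · simp [Real.zero_rpow hp0.ne']
  have : Nonempty V := hne.to_subtype
  have hee : e/2 + S*(e/(2*S)) = e := by field_simp; ring
  rw [hee] at hcov
  have key := gauss_comp (V := V) (gff_fam hP (fun v : V => gg N M sigv lamv v)) (hCG.comap (fun v : V => ι v)) (s := p)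
    (κ := 2*e*L + LpC M sigv * Real.log 2) hβ.le hp1 (by have := LpC_pos M sigv; have := Real.log_pos one_lt_two; positivity) (by
      rintro ⟨v, hv⟩ ⟨w, hw⟩
      have hv' := hdd v hv
      have hw' := hdd w hw
      have h1 := hcov v (hV hv) v (hV hv) hv' hv'
      have h2 := hcov v (hV hv) w (hV hw) hv' hw'
      have h3 := hDle v (hV hv) w (hV hw)
      rw [nrm_self, Real.log_one, zero_div, sub_zero, max_eq_left hρ1] at h1
      simp only [hDD]
      rw [abs_le] at h1 h2
      have hC : 0 < LpC M sigv * Real.log 2 := mul_pos (LpC_pos M sigv) (Real.log_pos one_lt_two)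
      set X := QQ N (gg N M sigv lamv v) (gg N M sigv lamv v) - L * (Jf M sigv lamv 1 - Jf M sigv lamv ρ)
      set Y := QQ N (gg N M sigv lamv v) (gg N M sigv lamv w) - D (ι v) (ι w)
      have hX : X ≤ e*L := h1.2
      have hY : -(e*L + LpC M sigv * Real.log 2) ≤ Y := by simp only [Y]; linarith [h2.1]
      set Cc := LpC M sigv * Real.log 2
      have heL : 0 < e*L := by positivity
      have h5 : X - (1-p)*Y ≤ e*L + (e*L + Cc) := by nlinarith
      nlinarith)
  have e1 := psi_MM hP M sigv lamv (fun v : V => (v : Vtx)) (fun v => hV v.2) β p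
  unfold MM at e1
  rw [e1] at key
  have e2 := fun ω => Finset.sum_coe_sort V (fun v => Real.exp (β * psiFld N M sigv lamv P v ω))
  simp only [e2] at key
  have h2 := MM_pull β hp0.le ν (fun v : V => ι v) (fun v w h => Subtype.ext (hinj v (hV v.2) w (hV w.2) h))
  rw [← hpe] at hMM
  unfold MM at h2 hMM
  refine key.trans ((mul_le_mul_right (h2.trans hMM) _).trans ?_)
  rw [← ENNReal.ofReal_mul (by positivity), ← Real.exp_add]
  refine ENNReal.ofReal_le_ofReal (Real.exp_le_exp.2 ?_)
  have hbe : β^2*e = p*ε/2 := by rw [hedef]; field_simp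
  have : β^2*(2*e*L + LpC M sigv * Real.log 2)/2 = (p*ε/2)*L + β^2*(LpC M sigv * Real.log 2)/2 := by rw [← hbe]; ring
  rw [this]
  nlinarith

lemma psi_aem {N : ℕ} {P : Measure FieldSp} (h : IsGFF N P) (M : ℕ) (sigv lamv : ℕ → ℝ) (V : Finset Vtx) (hV : V ⊆ VN N) (β s : ℝ) :
    AEMeasurable (fun ω => ENNReal.ofReal ((∑ v ∈ V, Real.exp (β * psiFld N M sigv lamv P v ω)) ^ s)) P := by
  refine ⟨fun ω => ENNReal.ofReal ((∑ v ∈ V, Real.exp (β * lin N (gg N M sigv lamv v) ω)) ^ s), ?_, ?_⟩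
  · have := fun v => lin_meas N (gg N M sigv lamv v)
    fun_prop
  · filter_upwards [psi_all h M sigv lamv] with ω hω
    congr 2
    exact Finset.sum_congr rfl fun v hv => by rw [hω v (hV hv)]

lemma markov_exp {Ω : Type*} [MeasurableSpace Ω] {P : Measure Ω} {f : Ω → ℝ} {K A B : ℝ} (hK : 0 ≤ K)
    (hf : AEMeasurable (fun ω => ENNReal.ofReal (f ω)) P)
    (h : ∫⁻ ω, ENNReal.ofReal (f ω) ∂P ≤ ENNReal.ofReal (K * Real.exp A)) :
    P {ω | Real.exp B ≤ f ω} ≤ ENNReal.ofReal (K * Real.exp (A - B)) := by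
  have h1 := (mul_meas_ge_le_lintegral₀ hf (ENNReal.ofReal (Real.exp B))).trans h
  have h2 : P {ω | Real.exp B ≤ f ω} ≤ P {ω | ENNReal.ofReal (Real.exp B) ≤ ENNReal.ofReal (f ω)} :=
    measure_mono fun ω hω => ENNReal.ofReal_le_ofReal hω
  calc _ ≤ _ := h2
    _ = ENNReal.ofReal (Real.exp (-B)) * (ENNReal.ofReal (Real.exp B) * P {ω | ENNReal.ofReal (Real.exp B) ≤ ENNReal.ofReal (f ω)}) := by
      rw [← mul_assoc, ← ENNReal.ofReal_mul (by positivity), ← Real.exp_add]; simp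
    _ ≤ ENNReal.ofReal (Real.exp (-B)) * ENNReal.ofReal (K * Real.exp A) := by gcongr
    _ = _ := by rw [← ENNReal.ofReal_mul (by positivity), sub_eq_add_neg, Real.exp_add]; congr 1; ring

lemma upper {M : ℕ} {sigv lamv : ℕ → ℝ} (hp : ScaleParams M sigv lamv) {m : ℕ} {sigb lamb : ℕ → ℝ} {sigbar : ℝ → ℝ}
    (he : EffParams M sigv lamv m sigb lamb sigbar) {β η : ℝ} (hβ : 0 < β) (hη : 0 < η) :
    ∃ c K : ℝ, 0 < c ∧ 0 < K ∧ ∃ N₀ : ℕ, ∀ N ≥ N₀, ∀ P : Measure FieldSp, IsGFF N P →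
      P {ω | η < freeEnergy N M sigv lamv P β ω - fpsiLim m sigb lamb β} ≤ ENNReal.ofReal (K * Real.exp (-c * Real.log N)) := by
  have hs1 : 0 < sigb 1 := (eff_sc he).2.1 1 (by simp; exact (eff_sc he).1)
  obtain ⟨p, hpe, hp0, hp1⟩ : ∃ p : ℝ, p = min 1 (2/(sigb 1 * β)) ∧ 0 < p ∧ p ≤ 1 :=
    ⟨_, rfl, by positivity, min_le_left _ _⟩
  obtain ⟨κ, hκ, N₀, hN₀, hcl⟩ := class_up hp he hβ hη hpe hp0
  refine ⟨p*η, (⌊1/κ⌋₊+1:ℕ), by positivity, by positivity, N₀, fun N hN P hP => ?_⟩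
  have hcl := hcl N hN P hP
  have hN2 : 2 ≤ N := by omega
  have hLp : 0 < Real.log N := Real.log_pos (by exact_mod_cast (show 1 < N by omega))
  set L := Real.log N with hL
  set f := fpsiLim m sigb lamb β
  have hPp := hP.1
  set ρ : Vtx → ℝ := fun v => 1 - Real.log (dd N v) / L with hρ
  set cl : Vtx → ℕ := fun v => ⌊ρ v / κ⌋₊ with hcldef
  have hρm : ∀ v ∈ VN N, 0 ≤ ρ v ∧ ρ v ≤ 1 := by
    intro v hv
    have h1 := Real.log_nonneg (one_le_dd N v)
    have h2 := Real.log_le_log (by have := one_le_dd N v; linarith) (dd_le (by omega) hv)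
    have h3 : Real.log (dd N v) / L ≤ 1 := by rw [div_le_one hLp]; exact h2
    have h4 : 0 ≤ Real.log (dd N v) / L := by positivity
    simp only [hρ]; constructor <;> linarith
  have hclm : ∀ v ∈ VN N, cl v ∈ Finset.range (⌊1/κ⌋₊+1) := by
    intro v hv
    rw [Finset.mem_range, Nat.lt_succ_iff]
    refine Nat.floor_mono ?_
    have := (hρm v hv).2
    gcongr
  have hint : ∫⁻ ω, ENNReal.ofReal ((ZN N M sigv lamv P β ω)^p) ∂P ≤ ENNReal.ofReal ((⌊1/κ⌋₊+1:ℕ) * Real.exp (p * (2 * f + η) * L)) := by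
    calc _ ≤ ∫⁻ ω, ∑ c ∈ Finset.range (⌊1/κ⌋₊+1), ENNReal.ofReal ((∑ v ∈ VN N with cl v = c, Real.exp (β * psiFld N M sigv lamv P v ω))^p) ∂P := by
          refine lintegral_mono fun ω => ?_
          rw [← ENNReal.ofReal_sum_of_nonneg (fun c _ => by positivity), ZN, ← Finset.sum_fiberwise_of_maps_to hclm]
          exact ENNReal.ofReal_le_ofReal (sum_rpow_le' _ _ (fun c => by positivity) hp0 hp1)
      _ = ∑ c ∈ Finset.range (⌊1/κ⌋₊+1), ∫⁻ ω, ENNReal.ofReal ((∑ v ∈ VN N with cl v = c, Real.exp (β * psiFld N M sigv lamv P v ω))^p) ∂P :=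
          lintegral_finsetSum' _ fun c _ => psi_aem hP M sigv lamv _ (Finset.filter_subset _ _) β p
      _ ≤ ∑ c ∈ Finset.range (⌊1/κ⌋₊+1), ENNReal.ofReal (Real.exp (p * (2 * f + η) * L)) := by
          refine Finset.sum_le_sum fun c hc => hcl (c*κ) (by positivity) ?_ _ (Finset.filter_subset _ _) ?_
          · rw [Finset.mem_range, Nat.lt_succ_iff] at hc
            have := Nat.floor_le (show 0 ≤ 1/κ by positivity)
            have h2 : (c:ℝ) ≤ 1/κ := le_trans (by exact_mod_cast hc) this
            rwa [le_div_iff₀ hκ] at h2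
          · intro v hv
            rw [Finset.mem_filter] at hv
            have h1 := Nat.floor_le (div_nonneg (hρm v hv.1).1 hκ.le)
            have h2 := Nat.lt_floor_add_one (ρ v / κ)
            rw [show ⌊ρ v / κ⌋₊ = c from hv.2] at h1 h2
            rw [le_div_iff₀ hκ] at h1
            rw [div_lt_iff₀ hκ] at h2
            have h3 : Real.log (dd N v) = (1 - ρ v) * L := by simp only [hρ]; field_simp; ring
            rw [h3, ← sub_mul, abs_mul, abs_of_pos hLp]
            refine mul_le_mul_of_nonneg_right (abs_le.2 ⟨by nlinarith, by nlinarith⟩) hLp.le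
      _ = _ := by
          rw [Finset.sum_const, Finset.card_range, nsmul_eq_mul, ENNReal.ofReal_mul (by positivity), ENNReal.ofReal_natCast]
  have hmk := markov_exp (B := 2*p*L*(f+η)) (by positivity) (psi_aem hP M sigv lamv (VN N) (Finset.Subset.refl _) β p) hint
  rw [show p * (2 * f + η) * L - 2*p*L*(f+η) = -(p*η)*L by ring] at hmk
  refine (measure_mono fun ω hω => ?_).trans hmk
  simp only [Set.mem_ofPred_eq] at hω ⊢
  have hZ : 0 < ZN N M sigv lamv P β ω := Finset.sum_pos (fun v _ => Real.exp_pos _) ⟨(0,0), by rw [mem_VN]; simp⟩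
  change _ ≤ (ZN N M sigv lamv P β ω)^p
  rw [Real.rpow_def_of_pos hZ]
  refine Real.exp_le_exp.2 ?_
  rw [freeEnergy, Real.log_pow, ← hL] at hω
  push_cast at hω
  have h5 : f + η < Real.log (ZN N M sigv lamv P β ω) / (2*L) := by
    rw [div_eq_inv_mul]; linarith
  rw [lt_div_iff₀ (by positivity)] at h5
  nlinarith

lemma rem_opt {β σ δ ε : ℝ} (hβ : 0 < β) (hσ : 0 < σ) (hδ : 0 < δ) (hε : 0 < ε) :
    ∀ᶠ L : ℝ in atTop, ∀ (d : ℕ) (a : NNReal), (a:ℝ) = σ^2*δ*L → Real.exp (2*δ*L)/144 ≤ ((d:ℝ)+1)^2 →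
      MM β (-1) (Measure.pi (fun _ : Fin (d+1) × Fin (d+1) => gaussianReal 0 a)) ≤
        ENNReal.ofReal (Real.exp ((-(2*(hj β σ * δ)) + ε)*L)) := by
  have hA : 0 < σ^2*δ := by positivity
  obtain ⟨x0, hx0, hx1, hx2⟩ : ∃ x0 : ℝ, 0 < x0 ∧ x0 ≤ 2*σ*δ ∧ -(β*x0) - 2*δ + x0^2/(2*(σ^2*δ)) = -(2*(hj β σ * δ)) := by
    unfold hj
    split_ifs with h
    · rw [le_div_iff₀ hσ] at h
      refine ⟨β*(σ^2*δ), by positivity, by nlinarith [mul_pos hσ hδ], by field_simp; ring⟩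
    · exact ⟨2*σ*δ, by positivity, le_rfl, by field_simp; ring⟩
  set τ := min (1/2) (ε/2/(β*x0)) with hτ
  have hτ0 : 0 < τ := by positivity
  have hτ1 : τ ≤ 1/2 := min_le_left _ _
  have hτ2 : τ*(β*x0) ≤ ε/2 := by
    have := min_le_right (1/2) (ε/2/(β*x0))
    rwa [← hτ, le_div_iff₀ (by positivity)] at this
  have hsq : ((1-τ)*x0)^2/(2*(σ^2*δ)) ≤ (1-τ)*(x0^2/(2*(σ^2*δ))) := by
    rw [← mul_div_assoc]; gcongr
    nlinarith [sq_nonneg x0]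
  have hx3 : x0^2/(2*(σ^2*δ)) ≤ 2*δ := by
    rw [div_le_iff₀ (by positivity)]; nlinarith
  have hx4 : 0 < x0^2/(2*(σ^2*δ)) := by positivity
  have hev := rem_asymp (β := β) (x := (1-τ)*x0) (A := σ^2*δ) (δ := δ) (K := 144) (ε := ε/2) hβ.le
    (mul_nonneg (by linarith) hx0.le) hA (by norm_num) (by nlinarith) (by positivity)
  filter_upwards [hev, eventually_ge_atTop 0] with L hL hL0 d a ha hd
  refine (hL d a ha hd).trans (ENNReal.ofReal_le_ofReal (Real.exp_le_exp.2 (mul_le_mul_of_nonneg_right ?_ hL0)))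
  nlinarith

lemma blk_sum (g : ℕ → ℝ) {K : ℕ} (hK : 1 ≤ K) (q : ℕ) : ∑ i ∈ Finset.range (q*K), g (i/K) / K = ∑ l ∈ Finset.range q, g l := by
  induction q with
  | zero => simp
  | succ q ih =>
    rw [Nat.succ_mul, Finset.sum_range_add, ih, Finset.sum_range_succ]
    congr 1
    rw [Finset.sum_congr rfl (g := fun _ => g q / K)]
    · rw [Finset.sum_const, Finset.card_range, nsmul_eq_mul]; field_simp
    · intro x hx
      rw [Finset.mem_range] at hx
      rw [mul_comm q K, Nat.mul_add_div (by omega), Nat.div_eq_of_lt hx, add_zero]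

lemma grid {m : ℕ} {sigb lamb : ℕ → ℝ} (hb : ScaleParams m sigb lamb) (β : ℝ) {K : ℕ} (hK : 1 ≤ K) :
    ∃ (t : ℕ → ℝ) (b : ℕ → ℕ), t 0 = 0 ∧ t (m*K) = 1 ∧ (∀ r < m*K, t r < t (r+1) ∧ t (r+1) - t r ≤ 1/K ∧ b r ∈ Finset.Icc 1 m ∧
      lamb (b r - 1) ≤ t r ∧ t (r+1) ≤ lamb (b r)) ∧
      ∑ r ∈ Finset.range (m*K), hj β (sigb (b r)) * (t (r+1) - t r) = ∑ j ∈ Finset.Icc 1 m, hj β (sigb j) * (lamb j - lamb (j-1)) := by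
  obtain ⟨hm, -, hl0, hl1, hinc⟩ := id hb
  set t : ℕ → ℝ := fun r => ∑ i ∈ Finset.range r, (lamb (i/K+1) - lamb (i/K))/K with ht
  have hdiff : ∀ r, t (r+1) - t r = (lamb (r/K+1) - lamb (r/K))/K := fun r => by
    simp only [ht, Finset.sum_range_succ]; ring
  have htq : ∀ q, t (q*K) = lamb q := fun q => by
    simp only [ht]
    rw [blk_sum (fun l => lamb (l+1) - lamb l) hK, Finset.sum_range_sub, hl0, sub_zero]
  have hKp : (0:ℝ) < K := by exact_mod_cast hK
  have hlt : ∀ r < m*K, t r < t (r+1) := by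
    intro r hr
    have h1 : r/K < m := (Nat.div_lt_iff_lt_mul (by omega)).2 hr
    have := hinc _ h1
    have h2 := hdiff r
    have : 0 < (lamb (r/K+1) - lamb (r/K))/K := div_pos (by linarith) hKp
    linarith
  have hmono := lam_mono (M := m*K) (lamv := t) hlt
  refine ⟨t, fun r => r/K+1, by simp [ht], by rw [htq, hl1], fun r hr => ?_, ?_⟩
  · have h1 : r/K < m := (Nat.div_lt_iff_lt_mul (by omega)).2 hr
    have hq1 := Nat.div_mul_le_self r K
    have hq2 : r + 1 ≤ (r/K+1)*K := by
      have := Nat.lt_div_mul_add (a := r) (b := K) (by omega)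
      rw [add_mul, one_mul]; exact this
    have hq3 : (r/K+1)*K ≤ m*K := Nat.mul_le_mul_right _ h1
    refine ⟨hlt r hr, ?_, by simp; omega, ?_, ?_⟩
    · rw [hdiff]
      have := (sc_mem hb h1.le).1
      have := (sc_mem hb h1).2
      gcongr; linarith
    · rw [Nat.add_sub_cancel, ← htq]; exact hmono _ _ hq1 (by omega)
    · rw [← htq]; exact hmono _ _ hq2 hq3
  · simp_rw [hdiff]
    rw [sum_Icc1, ← blk_sum (fun k => hj β (sigb (k+1)) * (lamb (k+1) - lamb (k+1-1))) hK]
    refine Finset.sum_congr rfl fun r _ => ?_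
    simp only [Nat.add_sub_cancel]; ring

lemma low_tree {m : ℕ} {sigb lamb : ℕ → ℝ} (hb : ScaleParams m sigb lamb) {β ε : ℝ} (hβ : 0 < β) (hε : 0 < ε) {K : ℕ} (hK : 1 ≤ K) :
    ∃ N₀ : ℕ, ∀ N ≥ N₀, ∃ (W : Type) (_ : Fintype W) (_ : Nonempty W) (ν : Measure (W → ℝ)) (D : W → W → ℝ) (pos : W → Vtx),
        CG ν D ∧ (∀ w, D w w = Real.log N * Jf m sigb lamb 1) ∧
        (∀ v w, Real.log N * Jf m sigb lamb (max (1 - Real.log (nrm (pos v - pos w)) / Real.log N) 0)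
            - LpC m sigb * (Real.log N / K + Real.log 2) ≤ D v w) ∧
        (∀ w, bx ((N+1)/2) (pos w)) ∧ Function.Injective pos ∧
        MM β (-1) ν ≤ ENNReal.ofReal (Real.exp ((-(2 * ∑ j ∈ Finset.Icc 1 m, hj β (sigb j) * (lamb j - lamb (j-1))) + ε) * Real.log N)) := by
  obtain ⟨t, b, ht0, ht1, hr, hsum⟩ := grid hb β hK
  set n := m*K with hn
  have hn1 : 1 ≤ n := Nat.mul_pos hb.1 hK
  have hnp : (0:ℝ) < n := by exact_mod_cast hn1
  have hKp : (0:ℝ) < K := by exact_mod_cast hK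
  have htm := lam_mono (M := n) (lamv := t) (fun r h => (hr r h).1)
  have hlogN : Tendsto (fun N : ℕ => Real.log (N:ℝ)) atTop atTop := Real.tendsto_log_atTop.comp tendsto_natCast_atTop_atTop
  have hev1 : ∀ᶠ N : ℕ in atTop, ∀ r ∈ Finset.range n, ∀ (d : ℕ) (a : NNReal), (a:ℝ) = sigb (b r)^2*(t (r+1) - t r)*Real.log N →
      Real.exp (2*(t (r+1) - t r)*Real.log N)/144 ≤ ((d:ℝ)+1)^2 →
      MM β (-1) (Measure.pi (fun _ : Fin (d+1) × Fin (d+1) => gaussianReal 0 a)) ≤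
        ENNReal.ofReal (Real.exp ((-(2*(hj β (sigb (b r)) * (t (r+1) - t r))) + ε/n)*Real.log N)) := by
    rw [eventually_all_finset]
    intro r hr'
    rw [Finset.mem_range] at hr'
    have := hr r hr'
    exact hlogN.eventually (rem_opt hβ (hb.2.1 _ this.2.2.1) (sub_pos.2 this.1) (by positivity))
  have hev2 : ∀ᶠ N : ℕ in atTop, ∀ r ∈ Finset.range n, 6 ≤ (N:ℝ)^(t (r+1) - t r) := by
    rw [eventually_all_finset]
    intro r hr'
    rw [Finset.mem_range] at hr'
    exact ((tendsto_rpow_atTop (sub_pos.2 (hr r hr').1)).comp tendsto_natCast_atTop_atTop).eventually_ge_atTop 6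
  obtain ⟨N₀, hN₀⟩ := eventually_atTop.1 (hev1.and (hev2.and (eventually_ge_atTop 2)))
  refine ⟨N₀, fun N hN => ?_⟩
  obtain ⟨h1, h2, hN2⟩ := hN₀ N hN
  clear hN₀ hev1 hev2
  have hN1 : (1:ℝ) < N := by exact_mod_cast hN2
  have hN0 : (0:ℝ) < N := by linarith
  set L := Real.log N with hL
  have hLp : 0 < L := Real.log_pos hN1
  have hlog2 : 0 < Real.log 2 := Real.log_pos (by norm_num)
  have hLpC := LpC_pos m sigb
  set J := Jf m sigb lamb with hJ
  have htmem : ∀ k ≤ n, 0 ≤ t k ∧ t k ≤ 1 := fun k hk =>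
    ⟨ht0 ▸ htm k 0 (by omega) hk, ht1 ▸ htm n k hk le_rfl⟩
  set X : ℕ → ℝ := fun k => (N:ℝ) ^ (1 - t (n-k)) with hX
  have hX1 : ∀ k, 1 ≤ X k := fun k => Real.one_le_rpow hN1.le (by linarith [(htmem (n-k) (by omega)).2])
  set s : ℕ → ℕ := fun k => ⌈X k / 2⌉₊ with hs
  have hslo : ∀ k, X k / 2 ≤ s k := fun k => Nat.le_ceil _
  have hshi : ∀ k, (s k : ℝ) ≤ 3/2 * X k := fun k => by
    have := Nat.ceil_lt_add_one (show 0 ≤ X k / 2 by linarith [hX1 k])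
    simp only [hs]; linarith [hX1 k]
  have hs1 : ∀ k, 1 ≤ s k := fun k => Nat.one_le_ceil_iff.2 (by linarith [hX1 k])
  have hs0 : s 0 = 1 := by
    simp only [hs, hX, Nat.sub_zero, ht1, sub_self, Real.rpow_zero]
    refine le_antisymm (Nat.ceil_le.2 (by norm_num)) (Nat.one_le_ceil_iff.2 (by norm_num))
  have hsn : s n = (N+1)/2 := by
    simp only [hs, hX, Nat.sub_self, ht0, sub_zero, Real.rpow_one]
    have h3 : ((N+1)/2)*2 ≤ N+1 := Nat.div_mul_le_self _ _
    have h4 : N ≤ ((N+1)/2)*2 := by omega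
    refine le_antisymm (Nat.ceil_le.2 ?_) (Nat.le_of_lt_add_one ?_)
    · rw [div_le_iff₀ (by norm_num)]; exact_mod_cast h4
    · have := Nat.le_ceil ((N:ℝ)/2)
      rw [div_le_iff₀ (by norm_num)] at this
      have h5 : N ≤ ⌈(N:ℝ)/2⌉₊ * 2 := by exact_mod_cast this
      omega
  have ha0 : ∀ k, 0 ≤ L * (J (t (n-k)) - J (t (n-k-1))) := fun k =>
    mul_nonneg hLp.le (Jf_lip hb (htmem (n-k-1) (by omega)).1 (htm _ _ (by omega) (by omega)) (htmem (n-k) (by omega)).2).1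
  set a : ℕ → NNReal := fun k => ⟨_, ha0 k⟩ with ha
  have hac : ∀ k, (a k : ℝ) = L * (J (t (n-k)) - J (t (n-k-1))) := fun k => rfl
  have hasum : ∀ k ≤ n, ∑ j ∈ Finset.range k, (a j : ℝ) = L * (J 1 - J (t (n-k))) := by
    intro k hk
    simp_rw [hac]
    rw [← Finset.mul_sum, tele_sum (fun i => J (t i)) hk, ht1]
  have hlg : ∀ r : ℝ, 1 - Real.log (max r 1) / L ≤ 1 := fun r => by
    have : 0 ≤ Real.log (max r 1) / L := div_nonneg (Real.log_nonneg (le_max_right _ _)) hLp.le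
    linarith
  have hmx : ∀ x : ℝ, x ≤ 1 → 0 ≤ max x 0 ∧ max x 0 ≤ 1 := fun x hx => ⟨le_max_right _ _, max_le hx zero_le_one⟩
  set G : ℝ → ℝ := fun r => L * (J 1 - J (max (1 - Real.log (max r 1) / L) 0)) + LpC m sigb * (L/K + Real.log 2) with hG
  have hGm : Monotone G := by
    intro r r' hr
    have h1 : Real.log (max r 1) ≤ Real.log (max r' 1) :=
      Real.log_le_log (by positivity) (max_le_max_right _ hr)
    have h2 : 1 - Real.log (max r' 1) / L ≤ 1 - Real.log (max r 1) / L := by gcongr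
    have h3 := (Jf_lip hb (hmx _ (hlg r')).1 (max_le_max_right 0 h2) (hmx _ (hlg r)).2).1
    simp only [hG]
    gcongr
    linarith
  have hG1 : 0 ≤ G 1 := by
    simp only [hG, max_self, Real.log_one, zero_div, sub_zero]
    rw [max_eq_left zero_le_one, sub_self]; positivity
  have hXr : ∀ k < n, X (k+1) = X k * (N:ℝ)^(t (n-k-1+1) - t (n-k-1)) := by
    intro k hk
    simp only [hX]
    rw [← Real.rpow_add hN0, Nat.sub_sub, show n - (k+1) + 1 = n - k by omega]; congr 1; ring
  have hratio : ∀ k < n, (N:ℝ)^(t (n-k-1+1) - t (n-k-1)) / 6 * (2 * s k) ≤ s (k+1) := by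
    intro k hk
    have h3 := hslo (k+1)
    rw [hXr k hk] at h3
    have h4 := hshi k
    have h5 := h2 (n-k-1) (by simp; omega)
    nlinarith
  set d : ℕ → ℕ := fun k => s (k+1) / (2 * s k) - 1 with hd
  have hdk : ∀ k < n, (d k : ℝ) + 1 = ((s (k+1) / (2 * s k) : ℕ):ℝ) ∧ (N:ℝ)^(t (n-k-1+1) - t (n-k-1)) / 12 ≤ ((s (k+1) / (2 * s k) : ℕ):ℝ) := by
    intro k hk
    have h5 := h2 (n-k-1) (by simp; omega)
    have h6 := hratio k hk
    have hsk : (1:ℝ) ≤ s k := by exact_mod_cast hs1 k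
    have h7 : 2 * s k ≤ s (k+1) := by
      have : (2 * s k : ℝ) ≤ s (k+1) := by nlinarith
      exact_mod_cast this
    have h8 : 1 ≤ s (k+1) / (2 * s k) := (Nat.one_le_div_iff (by have := hs1 k; omega)).2 h7
    constructor
    · simp only [hd]; rw [Nat.cast_sub h8]; simp
    · have h9 : s (k+1) < (s (k+1) / (2 * s k) + 1) * (2 * s k) := by
        have := Nat.lt_div_mul_add (a := s (k+1)) (b := 2 * s k) (by have := hs1 k; omega)
        rw [add_mul, one_mul]; exact this
      have h10 : (s (k+1) : ℝ) < (((s (k+1) / (2 * s k) : ℕ):ℝ) + 1) * (2 * s k) := by exact_mod_cast h9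
      have h11 : (1:ℝ) ≤ ((s (k+1) / (2 * s k) : ℕ):ℝ) := by exact_mod_cast h8
      have h12 : (N:ℝ)^(t (n-k-1+1) - t (n-k-1)) / 6 < ((s (k+1) / (2 * s k) : ℕ):ℝ) + 1 :=
        lt_of_mul_lt_mul_right (h6.trans_lt h10) (by positivity)
      linarith
  obtain ⟨W, i1, i2, ν, D, pos, hCG, hDD, hDG, hbx, hinj, hMM⟩ := tree_low s d hs0 hs1 a G hGm hG1 β n (by
      intro k hk
      have : d k + 1 = s (k+1) / (2 * s k) := by exact_mod_cast (hdk k hk).1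
      rw [this]; exact Nat.div_mul_le_self _ _) (by
      intro k hk
      rw [hasum (k+1) (by omega)]
      simp only [hG]
      have hsk : (1:ℝ) ≤ s k := by exact_mod_cast hs1 k
      have h0 := hlg (s k)
      rw [max_eq_left hsk] at h0 ⊢
      have h3 : (1 - t (n-k)) * L - Real.log 2 ≤ Real.log (s k) := by
        rw [hL, ← Real.log_rpow hN0, ← Real.log_div (by positivity) (by norm_num)]
        exact Real.log_le_log (by positivity) (hslo k)
      have h4 : 1 - Real.log (s k) / L ≤ t (n-k) + Real.log 2 / L := by
        have : (1 - t (n-k)) - Real.log 2 / L ≤ Real.log (s k) / L := by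
          rw [sub_div' hLp.ne']; gcongr
        linarith
      have h5 := (hr (n-k-1) (by omega)).2.1
      rw [show n-k-1+1 = n-k by omega] at h5
      have h6 : 0 ≤ Real.log 2 / L := by positivity
      have h8 := htmem (n-(k+1)) (by omega)
      have h9 := htmem (n-k) (by omega)
      have h7 : max (1 - Real.log (s k) / L) 0 - t (n-(k+1)) ≤ 1/K + Real.log 2 / L := by
        rw [← Nat.sub_sub]
        have := max_le h4 (by linarith [h9.1] : (0:ℝ) ≤ t (n-k) + Real.log 2 / L)
        linarith
      have h10 := Jf_lip2 hb h8.1 h8.2 (hmx _ h0).1 (hmx _ h0).2 (by positivity) h7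
      have h11 : L * (J (max (1 - Real.log (s k) / L) 0) - J (t (n-(k+1)))) ≤ LpC m sigb * (L/K + Real.log 2) := by
        calc _ ≤ L * (LpC m sigb * (1/K + Real.log 2 / L)) := by gcongr
          _ = _ := by field_simp
      linarith)
  have hDs : ∑ j ∈ Finset.range n, (a j : ℝ) = L * J 1 := by
    rw [hasum n le_rfl, Nat.sub_self, ht0, hJ, Jf_zero hb, sub_zero]
  refine ⟨W, i1, i2, ν, D, pos, hCG, fun w => by rw [hDD, hDs], fun v w => ?_, fun w => hsn ▸ hbx w, hinj, hMM.trans ?_⟩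
  · have := hDG v w
    rw [hDs] at this
    simp only [hG] at this
    rw [max_eq_left (one_le_nrm _)] at this
    linarith
  · calc _ ≤ ∏ k ∈ Finset.range n, ENNReal.ofReal (Real.exp ((-(2*(hj β (sigb (b (n-k-1))) * (t (n-k-1+1) - t (n-k-1)))) + ε/n)*L)) := by
          refine Finset.prod_le_prod' fun k hk => ?_
          rw [Finset.mem_range] at hk
          have hrr := hr (n-k-1) (by omega)
          refine h1 (n-k-1) (by simp; omega) (d k) (a k) ?_ ?_
          · rw [hac, ← eff_block hb hrr.2.2.1 hrr.2.2.2.1 hrr.1.le hrr.2.2.2.2, show n-k-1+1 = n-k by omega]; ring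
          · obtain ⟨q1, q2⟩ := hdk k hk
            rw [q1]
            have h3 : Real.exp (2*(t (n-k-1+1) - t (n-k-1))*L) = ((N:ℝ)^(t (n-k-1+1) - t (n-k-1)))^2 := by
              rw [Real.rpow_def_of_pos hN0, ← Real.exp_nat_mul]; congr 1; push_cast; ring
            rw [h3]
            have h4 : 0 ≤ (N:ℝ)^(t (n-k-1+1) - t (n-k-1)) / 12 := by positivity
            have := pow_le_pow_left₀ h4 q2 2
            refine le_trans (le_of_eq (by ring)) this
      _ = ENNReal.ofReal (Real.exp (∑ k ∈ Finset.range n, (-(2*(hj β (sigb (b (n-k-1))) * (t (n-k-1+1) - t (n-k-1)))) + ε/n)*L)) := by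
          rw [Real.exp_sum, ENNReal.ofReal_prod_of_nonneg (fun _ _ => (Real.exp_pos _).le)]
      _ = _ := by
          congr 2
          rw [← Finset.sum_mul, Finset.sum_add_distrib, Finset.sum_neg_distrib, ← Finset.mul_sum, ← hsum,
            ← Finset.sum_range_reflect (fun r => hj β (sigb (b r)) * (t (r+1) - t r))]
          simp only [Finset.sum_const, Finset.card_range, nsmul_eq_mul]
          rw [mul_div_cancel₀ _ hnp.ne']
          simp only [Nat.sub_right_comm n 1]

lemma lower {M : ℕ} {sigv lamv : ℕ → ℝ} (hp : ScaleParams M sigv lamv) {m : ℕ} {sigb lamb : ℕ → ℝ} {sigbar : ℝ → ℝ}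
    (he : EffParams M sigv lamv m sigb lamb sigbar) {β η : ℝ} (hβ : 0 < β) (hη : 0 < η) :
    ∃ N₀ : ℕ, ∀ N ≥ N₀, ∀ P : Measure FieldSp, IsGFF N P →
      P {ω | η < fpsiLim m sigb lamb β - freeEnergy N M sigv lamv P β ω} ≤ ENNReal.ofReal (1 * Real.exp (-η * Real.log N)) := by
  have hb := eff_sc he
  obtain ⟨hh1, hh2⟩ := hull_facts hp he
  have hLc := LpC_pos m sigb
  obtain ⟨S, hS, hcov⟩ := cov_est hp
  set e : ℝ := η/(12*β^2) with hedef
  have hepos : 0 < e := by positivity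
  obtain ⟨K, hK1, hK2⟩ : ∃ K : ℕ, 1 ≤ K ∧ 8*β^2*LpC m sigb/η ≤ K :=
    ⟨⌈8*β^2*LpC m sigb/η⌉₊+1, by omega, by push_cast; linarith [Nat.le_ceil (8*β^2*LpC m sigb/η)]⟩
  have hKp : (0:ℝ) < K := by exact_mod_cast hK1
  obtain ⟨N1, hN1, hcov⟩ := hcov (e/2) (by positivity)
  obtain ⟨N2, hN2⟩ := ev_log (Real.log 8 / (e/(2*S)))
  obtain ⟨N3, hN3⟩ := ev_log (β^2*LpC m sigb*Real.log 2/(η/4))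
  obtain ⟨N4, hT⟩ := low_tree hb (ε := η/4) hβ (by positivity) hK1
  rw [← fpsi_eq he] at hT
  refine ⟨max (max N1 N2) (max (max N3 N4) 16), fun N hN P hP => ?_⟩
  obtain ⟨W, i1, i2, ν, D, pos, hCG, hDD, hDle, hbx, hinj, hMM⟩ := hT N (by omega)
  have hcov := hcov N (by omega) (e/(2*S)) 0
  have hl2 := hN2 N (by omega)
  have hl3 := hN3 N (by omega)
  have hN16 : 16 ≤ N := by omega
  have hNR : (16:ℝ) ≤ N := by exact_mod_cast hN16
  have hLp : 0 < Real.log N := Real.log_pos (by linarith)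
  have hPp := hP.1
  set L := Real.log N with hL
  set f := fpsiLim m sigb lamb β
  rw [div_le_iff₀ (by positivity)] at hl2 hl3
  rw [div_le_iff₀ hη] at hK2
  have hee : e/2 + S*(e/(2*S)) = e := by field_simp; ring
  rw [hee] at hcov
  set x : W → Vtx := fun w => pos w + ((((N/4 : ℕ) : ℤ), ((N/4 : ℕ) : ℤ)) : Vtx) with hx
  have hxb : ∀ w, ((N/4:ℕ):ℤ) ≤ (x w).1 ∧ (x w).1 < ((N/4:ℕ):ℤ) + (((N+1)/2 : ℕ):ℤ) ∧
      ((N/4:ℕ):ℤ) ≤ (x w).2 ∧ (x w).2 < ((N/4:ℕ):ℤ) + (((N+1)/2 : ℕ):ℤ) := by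
    intro w
    have := hbx w
    unfold bx at this
    simp only [hx, Prod.fst_add, Prod.snd_add]
    omega
  have hxV : ∀ w, x w ∈ VN N := by
    intro w
    have := hxb w
    rw [mem_VN]
    omega
  have hxd : ∀ w, |Real.log (dd N (x w)) - (1-0) * L| ≤ e/(2*S) * L := by
    intro w
    have h1 := dd_le (by omega) (hxV w)
    have h2 : (N:ℝ)/8 ≤ dd N (x w) := by
      have h3 := hxb w
      have h4 : (N:ℤ) ≤ 8 * min (min (x w).1 (N-(x w).1)) (min (x w).2 (N-(x w).2)) := by omega
      have h5 : (N:ℝ) ≤ 8 * ((min (min (x w).1 (N-(x w).1)) (min (x w).2 (N-(x w).2)) : ℤ):ℝ) := by exact_mod_cast h4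
      refine le_trans ?_ (le_max_right _ _)
      linarith
    have h3 := Real.log_le_log (by positivity) h2
    have h4 := Real.log_le_log (by have := one_le_dd N (x w); linarith) h1
    rw [Real.log_div (by positivity) (by norm_num)] at h3
    rw [abs_le]; constructor <;> linarith
  have hxi : Function.Injective x := fun v w h => hinj (add_right_cancel h)
  have key := gauss_comp (gff_fam hP (fun w : W => gg N M sigv lamv (x w))) hCG (s := -1)
    (κ := 3*e*L + 2*LpC m sigb*(L/K + Real.log 2)) hβ.le (by norm_num) (by have := Real.log_pos one_lt_two; positivity) (by
      intro v w
      have h1 := hcov _ (hxV v) _ (hxV v) (hxd v) (hxd v)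
      have h2 := hcov _ (hxV v) _ (hxV w) (hxd v) (hxd w)
      have h3 := hDle v w
      rw [show x v - x w = pos v - pos w by simp [hx]] at h2
      rw [nrm_self, Real.log_one, zero_div, sub_zero, max_eq_left zero_le_one] at h1
      rw [Jf_zero hp, sub_zero] at h1 h2
      rw [hDD]
      have h4 := hh2 m le_rfl
      rw [he.2.2.2.1] at h4
      have h5 := hh1 (max (1 - Real.log (nrm (pos v - pos w)) / L) 0) ⟨le_max_right _ _, max_le (by
        have : 0 ≤ Real.log (nrm (pos v - pos w)) / L := div_nonneg (Real.log_nonneg (one_le_nrm _)) hLp.le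
        linarith) zero_le_one⟩
      have h6 := mul_le_mul_of_nonneg_left h5 hLp.le
      rw [h4]
      rw [abs_le] at h1 h2
      nlinarith [h1.1, h2.2])
  have e1 := psi_MM hP M sigv lamv x hxV β (-1)
  unfold MM at e1 hMM
  rw [e1] at key
  have hint : ∫⁻ ω, ENNReal.ofReal ((ZN N M sigv lamv P β ω)^(-1:ℝ)) ∂P ≤ ENNReal.ofReal (1 * Real.exp ((-(2*f) + η) * L)) := by
    calc _ ≤ ∫⁻ ω, ENNReal.ofReal ((∑ w, Real.exp (β * psiFld N M sigv lamv P (x w) ω)) ^ (-1:ℝ)) ∂P := by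
          refine lintegral_mono fun ω => ENNReal.ofReal_le_ofReal (Real.rpow_le_rpow_of_nonpos ?_ ?_ (by norm_num))
          · exact Finset.sum_pos (fun v _ => Real.exp_pos _) Finset.univ_nonempty
          · rw [← Finset.sum_image (s := Finset.univ) (g := x) (f := fun w => Real.exp (β * psiFld N M sigv lamv P w ω)) (fun a _ b _ h => hxi h)]
            refine Finset.sum_le_sum_of_subset_of_nonneg ?_ fun _ _ _ => (Real.exp_pos _).le
            intro v hv
            obtain ⟨w, -, rfl⟩ := Finset.mem_image.1 hv
            exact hxV w
      _ ≤ _ := key.trans ((mul_le_mul_right hMM _).trans ?_)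
    rw [← ENNReal.ofReal_mul (by positivity), ← Real.exp_add, one_mul]
    refine ENNReal.ofReal_le_ofReal (Real.exp_le_exp.2 ?_)
    have q1 : β^2*e = η/12 := by rw [hedef]; field_simp
    have q2 : β^2*LpC m sigb*(L/K) ≤ η/8*L := by
      rw [mul_div_assoc', div_le_iff₀ hKp]; nlinarith
    have : β^2*(3*e*L + 2*LpC m sigb*(L/K + Real.log 2))/2 = 3/2*(β^2*e)*L + β^2*LpC m sigb*(L/K) + β^2*LpC m sigb*Real.log 2 := by ring
    rw [this, q1]
    nlinarith
  have hmk := markov_exp (B := -2*L*(f-η)) zero_le_one (psi_aem hP M sigv lamv (VN N) (Finset.Subset.refl _) β (-1)) hint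
  rw [show (-(2*f) + η) * L - -2*L*(f-η) = -η*L by ring] at hmk
  refine (measure_mono fun ω hω => ?_).trans hmk
  simp only [Set.mem_ofPred_eq] at hω ⊢
  have hZ : 0 < ZN N M sigv lamv P β ω := Finset.sum_pos (fun v _ => Real.exp_pos _) ⟨(0,0), by rw [mem_VN]; simp⟩
  change _ ≤ (ZN N M sigv lamv P β ω)^(-1:ℝ)
  rw [Real.rpow_def_of_pos hZ]
  refine Real.exp_le_exp.2 ?_
  rw [freeEnergy, Real.log_pow, ← hL] at hω
  push_cast at hω
  have h5 : Real.log (ZN N M sigv lamv P β ω) / (2*L) < f - η := by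
    rw [div_eq_inv_mul]; linarith
  rw [div_lt_iff₀ (by positivity)] at h5
  linarith

/-- **Lemma (Convergence in probability of the free energy, with polynomial rate).**
For every `η > 0` and `β > 0` there is `c = c(η,β,σ,λ) > 0` such that for all `N` large
enough, `P(|f_N^ψ(β) − f^ψ(β)| > η) ≤ N^{−c}`. -/
theorem free_energy_probability_rate
    (M : ℕ) (sigv lamv : ℕ → ℝ) (hparams : ScaleParams M sigv lamv)
    (m : ℕ) (sigb lamb : ℕ → ℝ) (sigbar : ℝ → ℝ)
    (heff : EffParams M sigv lamv m sigb lamb sigbar)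
    (P : ℕ → MeasureTheory.Measure FieldSp) (hGFF : ∀ N, IsGFF N (P N))
    (η β : ℝ) (hη : 0 < η) (hβ : 0 < β) :
    ∃ c : ℝ, 0 < c ∧ ∃ N₀ : ℕ, ∀ N ≥ N₀,
      P N {ω | η < |freeEnergy N M sigv lamv (P N) β ω - fpsiLim m sigb lamb β|}
        ≤ ENNReal.ofReal ((N : ℝ) ^ (-c)) := by
  obtain ⟨c, K, hc, hK, N1, hU⟩ := upper hparams heff hβ hη
  obtain ⟨N2, hD⟩ := lower hparams heff hβ hη
  set c0 := min c η with hc0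
  have hc0p : 0 < c0 := lt_min hc hη
  obtain ⟨N3, hN3⟩ := ev_log (Real.log (K+1) / (c0/2))
  refine ⟨c0/2, by positivity, max (max N1 N2) (max N3 2), fun N hN => ?_⟩
  have h1 := hU N (by omega) (P N) (hGFF N)
  have h2 := hD N (by omega) (P N) (hGFF N)
  have h3 := hN3 N (by omega)
  have hN1 : (1:ℝ) < N := by exact_mod_cast (show 1 < N by omega)
  have hLp : 0 < Real.log N := Real.log_pos hN1
  rw [div_le_iff₀ (by positivity)] at h3
  have hsub : {ω | η < |freeEnergy N M sigv lamv (P N) β ω - fpsiLim m sigb lamb β|} ⊆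
      {ω | η < freeEnergy N M sigv lamv (P N) β ω - fpsiLim m sigb lamb β} ∪
      {ω | η < fpsiLim m sigb lamb β - freeEnergy N M sigv lamv (P N) β ω} := by
    intro ω hω
    simp only [Set.mem_union, Set.mem_ofPred_eq] at hω ⊢
    rcases lt_abs.1 hω with h | h
    · exact Or.inl h
    · exact Or.inr (by linarith)
  refine (measure_mono hsub).trans ((measure_union_le _ _).trans ((add_le_add h1 h2).trans ?_))
  rw [← ENNReal.ofReal_add (by positivity) (by positivity)]
  refine ENNReal.ofReal_le_ofReal ?_
  rw [Real.rpow_def_of_pos (by linarith)]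
  have g1 : Real.exp (-c * Real.log N) ≤ Real.exp (-c0 * Real.log N) :=
    Real.exp_le_exp.2 (by have := min_le_left c η; nlinarith)
  have g2 : Real.exp (-η * Real.log N) ≤ Real.exp (-c0 * Real.log N) :=
    Real.exp_le_exp.2 (by have := min_le_right c η; nlinarith)
  have g3 : K + 1 ≤ Real.exp (c0/2 * Real.log N) := by
    rw [← Real.log_le_iff_le_exp (by positivity)]; linarith
  calc _ ≤ (K+1) * Real.exp (-c0 * Real.log N) := by nlinarith
    _ ≤ Real.exp (c0/2 * Real.log N) * Real.exp (-c0 * Real.log N) := by gcongr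
    _ = _ := by rw [← Real.exp_add]; congr 1; ring
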